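/- Let ℓ be a prime, r ≥ 1, let F be a finite field with ℓ^{2r} elements, and let σ : F → F be the involution σ(x) = x^{ℓ^r}. Then H_d(U_{n,n}(F,σ); F_ℓ) = 0 for all d with 0 < d < n, where F_ℓ is the ℓ-element field with trivial action. -/

import Mathlib

/-! # Group homology via the inhomogeneous bar complex (trivial coefficients) -/

namespace GroupHomologyBar

variable (G : Type) [Group G] (A : Type) [AddCommGroup A]

/-- Inhomogeneous `n`-chains of `G` with coefficients in `A`. -/
abbrev chains (n : ℕ) : Type := (Fin n → G) →₀ A

/-- The differential of the inhomogeneous bar complex with trivial `G`-action on the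
coefficients, sending `[g₁|…|g_{n+1}] ⊗ a` to
`[g₂|…|g_{n+1}] ⊗ a + ∑ⱼ (-1)^{j+1} [g₁|…|gⱼg_{j+1}|…|g_{n+1}] ⊗ a`
(the last summand of the sum being `(-1)^{n+1} [g₁|…|g_n] ⊗ a`). -/
noncomputable def d (n : ℕ) : chains G A (n + 1) →ₗ[ℤ] chains G A n :=
  Finsupp.lsum ℤ fun g =>
    (Finsupp.lsingle (Fin.tail g) : A →ₗ[ℤ] chains G A n)
      + ∑ j : Fin (n + 1),
          ((-1 : ℤ) ^ ((j : ℕ) + 1)) • Finsupp.lsingle (Fin.contractNth j (· * ·) g)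

/-- The `n`-cycles. -/
noncomputable def cycles : (n : ℕ) → Submodule ℤ (chains G A n)
  | 0 => ⊤
  | (n + 1) => LinearMap.ker (d G A n)

/-- The `n`-boundaries, viewed as a submodule of the `n`-cycles. -/
noncomputable def boundaries (n : ℕ) : Submodule ℤ (cycles G A n) :=
  Submodule.comap (cycles G A n).subtype (LinearMap.range (d G A n))

/-- The group homology `H_n(G; A)` of `G` with trivial coefficients in `A`. -/
abbrev Homology (n : ℕ) : Type := cycles G A n ⧸ boundaries G A n

variable {G}
variable {G' : Type} [Group G']

/-- The map on chains induced by a group homomorphism. -/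
noncomputable def chainsMap (φ : G →* G') (n : ℕ) : chains G A n →ₗ[ℤ] chains G' A n :=
  Finsupp.lmapDomain A ℤ fun v => φ ∘ v

lemma chainsMap_single (φ : G →* G') {n : ℕ} (v : Fin n → G) (a : A) :
    chainsMap A φ n (Finsupp.single v a) = Finsupp.single (φ ∘ v) a := by
  simp [chainsMap, Finsupp.mapDomain_single]

lemma d_single {n : ℕ} (g : Fin (n + 1) → G) (a : A) :
    d G A n (Finsupp.single g a)
      = Finsupp.single (Fin.tail g) a
        + ∑ j : Fin (n + 1),
            ((-1 : ℤ) ^ ((j : ℕ) + 1)) • Finsupp.single (Fin.contractNth j (· * ·) g) a := by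
  simp [d, Finsupp.lsum_single]

lemma d_chainsMap (φ : G →* G') (n : ℕ) :
    (d G' A n).comp (chainsMap A φ (n + 1)) = (chainsMap A φ n).comp (d G A n) := by
  apply Finsupp.lhom_ext
  intro g a
  have hc : ∀ j : Fin (n + 1),
      φ ∘ Fin.contractNth j (· * ·) g = Fin.contractNth j (· * ·) (φ ∘ g) := by
    intro j
    funext k
    simp only [Function.comp_apply, Fin.contractNth]
    split_ifs <;> simp
  simp only [LinearMap.comp_apply, chainsMap_single, d_single, map_add, map_sum, map_smul,
    chainsMap_single, Fin.comp_tail, hc]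

lemma chainsMap_mem_cycles (φ : G →* G') (n : ℕ) :
    ∀ x ∈ cycles G A n, chainsMap A φ n x ∈ cycles G' A n := by
  intro x hx
  cases n with
  | zero => trivial
  | succ n =>
    simp only [cycles, LinearMap.mem_ker] at hx ⊢
    have := congrArg (fun L : chains G A (n + 1) →ₗ[ℤ] chains G' A n => L x) (d_chainsMap A φ n)
    simp only [LinearMap.comp_apply] at this
    rw [this, hx, map_zero]

/-- The map on cycles induced by a group homomorphism. -/
noncomputable def cyclesMap (φ : G →* G') (n : ℕ) : cycles G A n →ₗ[ℤ] cycles G' A n :=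
  (chainsMap A φ n).restrict (chainsMap_mem_cycles A φ n)

/-- The map `H_n(G; A) → H_n(G'; A)` on group homology induced by a group
homomorphism `φ : G →* G'`. -/
noncomputable def inducedMap (φ : G →* G') (n : ℕ) :
    Homology G A n →ₗ[ℤ] Homology G' A n :=
  Submodule.mapQ _ _ (cyclesMap A φ n) (by
    rintro ⟨x, hx⟩ hmem
    simp only [boundaries, Submodule.mem_comap, Submodule.subtype_apply,
      LinearMap.mem_range] at hmem ⊢
    obtain ⟨y, hy⟩ := hmem
    refine ⟨chainsMap A φ (n + 1) y, ?_⟩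
    have := congrArg (fun L : chains G A (n + 1) →ₗ[ℤ] chains G' A n => L y) (d_chainsMap A φ n)
    simp only [LinearMap.comp_apply] at this
    rw [this, hy]
    rfl)

end GroupHomologyBar

section Isometries

variable (F : Type) [Field F] {W : Type} [AddCommGroup W] [Module F W]

/-- The group of linear automorphisms of a vector space `V` preserving a
function `Q : V → F` (e.g. a quadratic form). -/
def quadIsoms {V : Type} [AddCommGroup V] [Module F V] (Q : V → F) :
    Subgroup (V ≃ₗ[F] V) where
  carrier := {g | ∀ v, Q (g v) = Q v}
  one_mem' := fun _ => rfl
  mul_mem' := fun {a b} ha hb v => by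
    rw [show (a * b) v = a (b v) from rfl, ha, hb]
  inv_mem' := fun {a} ha v => by
    rw [show (a⁻¹ : V ≃ₗ[F] V) v = a.symm v from rfl, ← ha (a.symm v), a.apply_symm_apply]

/-- The group of linear automorphisms of a vector space `V` preserving a
pairing `ω : V → V → F` (e.g. a bilinear or sesquilinear form). -/
def bilinIsoms {V : Type} [AddCommGroup V] [Module F V] (ω : V → V → F) :
    Subgroup (V ≃ₗ[F] V) where
  carrier := {g | ∀ v w, ω (g v) (g w) = ω v w}
  one_mem' := fun _ _ => rfl
  mul_mem' := fun {a b} ha hb v w => by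
    rw [show (a * b) v = a (b v) from rfl, show (a * b) w = a (b w) from rfl, ha, hb]
  inv_mem' := fun {a} ha v w => by
    rw [show (a⁻¹ : V ≃ₗ[F] V) v = a.symm v from rfl,
      show (a⁻¹ : V ≃ₗ[F] V) w = a.symm w from rfl,
      ← ha (a.symm v) (a.symm w), a.apply_symm_apply, a.apply_symm_apply]

/-- The "orthogonal sum" form `x ↦ ∑ i, q (x i)` on `W^n`. -/
def sumForm (q : W → F) (n : ℕ) (x : Fin n → W) : F := ∑ i, q (x i)

/-- The "orthogonal sum" pairing `(x, y) ↦ ∑ i, β (x i) (y i)` on `W^n`. -/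
def pairForm (β : W → W → F) (n : ℕ) (x y : Fin n → W) : F := ∑ i, β (x i) (y i)

/-- The linear equivalence `W^{n+1} ≃ W^n × W` splitting off the last coordinate. -/
def lastSplit (n : ℕ) : (Fin (n + 1) → W) ≃ₗ[F] (Fin n → W) × W where
  toLinearMap := (LinearMap.funLeft F W Fin.castSucc).prod (LinearMap.proj (Fin.last n))
  invFun p := Fin.snoc p.1 p.2
  left_inv x := Fin.snoc_init_self x
  right_inv p := by
    refine Prod.ext (funext fun i => ?_) ?_
    · exact @Fin.snoc_castSucc n (fun _ => W) p.2 p.1 i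
    · exact @Fin.snoc_last n (fun _ => W) p.2 p.1

lemma lastSplit_symm_apply (n : ℕ) (p : Fin n → W) (w : W) :
    (lastSplit F n).symm (p, w) = Fin.snoc p w := rfl

/-- Extension of an automorphism of `W^n` to `W^{n+1}` by the identity on the
added last coordinate. -/
def stabAut (n : ℕ) (g : (Fin n → W) ≃ₗ[F] (Fin n → W)) :
    (Fin (n + 1) → W) ≃ₗ[F] (Fin (n + 1) → W) :=
  (lastSplit F n).trans ((g.prodCongr (LinearEquiv.refl F W)).trans (lastSplit F n).symm)

lemma stabAut_symm_apply (n : ℕ) (g : (Fin n → W) ≃ₗ[F] (Fin n → W))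
    (p : Fin n → W) (w : W) :
    stabAut F n g ((lastSplit F n).symm (p, w)) = (lastSplit F n).symm (g p, w) := by
  simp [stabAut, LinearEquiv.trans_apply, LinearEquiv.apply_symm_apply, LinearEquiv.prodCongr_apply]

lemma sumForm_snoc (q : W → F) (n : ℕ) (p : Fin n → W) (w : W) :
    sumForm F q (n + 1) ((lastSplit F n).symm (p, w)) = sumForm F q n p + q w := by
  simp [sumForm, lastSplit_symm_apply, Fin.sum_univ_castSucc, Fin.snoc_castSucc, Fin.snoc_last]

lemma pairForm_snoc (β : W → W → F) (n : ℕ) (p p' : Fin n → W) (w w' : W) :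
    pairForm F β (n + 1) ((lastSplit F n).symm (p, w)) ((lastSplit F n).symm (p', w'))
      = pairForm F β n p p' + β w w' := by
  simp [pairForm, lastSplit_symm_apply, Fin.sum_univ_castSucc, Fin.snoc_castSucc, Fin.snoc_last]

/-- The stabilization homomorphism on the isometry group of the form `sumForm q n`,
extending an isometry by the identity on the added summand. -/
def quadStab (q : W → F) (n : ℕ) :
    quadIsoms F (sumForm F q n) →* quadIsoms F (sumForm F q (n + 1)) where
  toFun g := ⟨stabAut F n g.1, by
    intro v
    obtain ⟨⟨p, w⟩, rfl⟩ : ∃ x, (lastSplit F n).symm x = v :=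
      ⟨lastSplit F n v, (lastSplit F n).symm_apply_apply v⟩
    rw [stabAut_symm_apply, sumForm_snoc, sumForm_snoc, g.2 p]⟩
  map_one' := by
    refine Subtype.ext (LinearEquiv.ext fun v => ?_)
    show stabAut F n 1 v = v
    obtain ⟨⟨p, w⟩, rfl⟩ : ∃ x, (lastSplit F n).symm x = v :=
      ⟨lastSplit F n v, (lastSplit F n).symm_apply_apply v⟩
    rw [stabAut_symm_apply]
    rfl
  map_mul' g h := by
    refine Subtype.ext (LinearEquiv.ext fun v => ?_)
    show stabAut F n (g.1 * h.1) v = stabAut F n g.1 (stabAut F n h.1 v)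
    obtain ⟨⟨p, w⟩, rfl⟩ : ∃ x, (lastSplit F n).symm x = v :=
      ⟨lastSplit F n v, (lastSplit F n).symm_apply_apply v⟩
    rw [stabAut_symm_apply, stabAut_symm_apply, stabAut_symm_apply]
    rfl

/-- The stabilization homomorphism on the isometry group of the pairing `pairForm β n`,
extending an isometry by the identity on the added summand. -/
def bilinStab (β : W → W → F) (n : ℕ) :
    bilinIsoms F (pairForm F β n) →* bilinIsoms F (pairForm F β (n + 1)) where
  toFun g := ⟨stabAut F n g.1, by
    intro v v'
    obtain ⟨⟨p, w⟩, rfl⟩ : ∃ x, (lastSplit F n).symm x = v :=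
      ⟨lastSplit F n v, (lastSplit F n).symm_apply_apply v⟩
    obtain ⟨⟨p', w'⟩, rfl⟩ : ∃ x, (lastSplit F n).symm x = v' :=
      ⟨lastSplit F n v', (lastSplit F n).symm_apply_apply v'⟩
    rw [stabAut_symm_apply, stabAut_symm_apply, pairForm_snoc, pairForm_snoc, g.2 p p']⟩
  map_one' := by
    refine Subtype.ext (LinearEquiv.ext fun v => ?_)
    show stabAut F n 1 v = v
    obtain ⟨⟨p, w⟩, rfl⟩ : ∃ x, (lastSplit F n).symm x = v :=
      ⟨lastSplit F n v, (lastSplit F n).symm_apply_apply v⟩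
    rw [stabAut_symm_apply]
    rfl
  map_mul' g h := by
    refine Subtype.ext (LinearEquiv.ext fun v => ?_)
    show stabAut F n (g.1 * h.1) v = stabAut F n g.1 (stabAut F n h.1 v)
    obtain ⟨⟨p, w⟩, rfl⟩ : ∃ x, (lastSplit F n).symm x = v :=
      ⟨lastSplit F n v, (lastSplit F n).symm_apply_apply v⟩
    rw [stabAut_symm_apply, stabAut_symm_apply, stabAut_symm_apply]
    rfl

end Isometries

/-- The hyperbolic Hermitian pairing (with respect to an involution `σ`) on `F² = F × F`. -/
def hermPair (F : Type) [Field F] (σ : F → F) (s t : F × F) : F := σ s.1 * t.2 + σ s.2 * t.1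

/-! Basic element-level wrapper around Mathlib's group homology. -/

namespace GH

open CategoryTheory

variable {k : Type} [CommRing k]
  {G G' G'' : Type} [Group G] [Group G'] [Group G'']
  {M M' M'' : Type} [AddCommGroup M] [AddCommGroup M'] [AddCommGroup M'']
  [Module k M] [Module k M'] [Module k M'']

/-- A morphism of pairs (group, representation). -/
@[ext]
structure PHom (ρ : Representation k G M) (ρ' : Representation k G' M') where
  φ : G →* G'
  f : M →ₗ[k] M'
  comm : ∀ g m, f (ρ g m) = ρ' (φ g) (f m)

namespace PHom

/-- The identity. -/
def id (ρ : Representation k G M) : PHom ρ ρ := ⟨MonoidHom.id G, LinearMap.id, fun _ _ => rfl⟩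

/-- Composition of morphisms of pairs. -/
def comp {ρ : Representation k G M} {ρ' : Representation k G' M'} {ρ'' : Representation k G'' M''}
    (v : PHom ρ' ρ'') (u : PHom ρ ρ') : PHom ρ ρ'' :=
  ⟨v.φ.comp u.φ, v.f ∘ₗ u.f, fun g m => by simp [u.comm, v.comm]⟩

/-- Morphism over the same group. -/
def mk₁ {ρ : Representation k G M} {ρ' : Representation k G M'} (f : M →ₗ[k] M')
    (h : ∀ g m, f (ρ g m) = ρ' g (f m)) : PHom ρ ρ' := ⟨MonoidHom.id G, f, h⟩

@[simp] lemma id_φ (ρ : Representation k G M) : (PHom.id ρ).φ = MonoidHom.id G := rfl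
@[simp] lemma id_f (ρ : Representation k G M) : (PHom.id ρ).f = LinearMap.id := rfl
@[simp] lemma comp_φ {ρ : Representation k G M} {ρ' : Representation k G' M'}
    {ρ'' : Representation k G'' M''} (v : PHom ρ' ρ'') (u : PHom ρ ρ') :
    (v.comp u).φ = v.φ.comp u.φ := rfl
@[simp] lemma comp_f {ρ : Representation k G M} {ρ' : Representation k G' M'}
    {ρ'' : Representation k G'' M''} (v : PHom ρ' ρ'') (u : PHom ρ ρ') :
    (v.comp u).f = v.f ∘ₗ u.f := rfl
@[simp] lemma mk₁_φ {ρ : Representation k G M} {ρ' : Representation k G M'} (f : M →ₗ[k] M')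
    (h : ∀ g m, f (ρ g m) = ρ' g (f m)) : (mk₁ f h).φ = MonoidHom.id G := rfl
@[simp] lemma mk₁_f {ρ : Representation k G M} {ρ' : Representation k G M'} (f : M →ₗ[k] M')
    (h : ∀ g m, f (ρ g m) = ρ' g (f m)) : (mk₁ f h).f = f := rfl

/-- The morphism in `Rep`. -/
noncomputable def rep {ρ : Representation k G M} {ρ' : Representation k G' M'} (u : PHom ρ ρ') :
    Rep.of ρ ⟶ Rep.res u.φ (Rep.of ρ') :=
  Rep.ofHom ⟨u.f, fun g => by ext m; exact u.comm g m⟩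

end PHom

/-- Group homology. -/
noncomputable def H (ρ : Representation k G M) (n : ℕ) : Type := groupHomology (Rep.of ρ) n

noncomputable instance (ρ : Representation k G M) (n : ℕ) : AddCommGroup (H ρ n) :=
  inferInstanceAs (AddCommGroup (groupHomology (Rep.of ρ) n))
noncomputable instance (ρ : Representation k G M) (n : ℕ) : Module k (H ρ n) :=
  inferInstanceAs (Module k (groupHomology (Rep.of ρ) n))

namespace PHom

variable {ρ : Representation k G M} {ρ' : Representation k G' M'} {ρ'' : Representation k G'' M''}

/-- Functoriality on chains. -/
noncomputable def chains (u : PHom ρ ρ') : groupHomology.inhomogeneousChains (Rep.of ρ) ⟶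
    groupHomology.inhomogeneousChains (Rep.of ρ') := groupHomology.chainsMap u.φ u.rep

lemma chains_comp (v : PHom ρ' ρ'') (u : PHom ρ ρ') :
    (v.comp u).chains = u.chains ≫ v.chains :=
  groupHomology.chainsMap_comp u.φ v.φ u.rep v.rep

lemma chains_single (u : PHom ρ ρ') (n : ℕ) (x : Fin n → G) (a : M) :
    (u.chains.f n).hom (Finsupp.single x a) = Finsupp.single (u.φ ∘ x) (u.f a) :=
  groupHomology.chainsMap_f_single u.φ u.rep n x a

/-- Functoriality of homology. -/
noncomputable def map (u : PHom ρ ρ') (n : ℕ) : H ρ n →ₗ[k] H ρ' n :=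
  (groupHomology.map u.φ u.rep n).hom

lemma map_id (n : ℕ) : (PHom.id ρ).map n = LinearMap.id := by
  have := groupHomology.map_id (A := Rep.of ρ) (n := n)
  exact congrArg ModuleCat.Hom.hom this

lemma map_comp (v : PHom ρ' ρ'') (u : PHom ρ ρ') (n : ℕ) :
    (v.comp u).map n = v.map n ∘ₗ u.map n := by
  have := groupHomology.map_comp (n := n) u.φ v.φ u.rep v.rep
  exact congrArg ModuleCat.Hom.hom this

lemma map_comp_apply (v : PHom ρ' ρ'') (u : PHom ρ ρ') (n : ℕ) (x : H ρ n) :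
    (v.comp u).map n x = v.map n (u.map n x) := by rw [map_comp]; rfl

lemma map_id_apply (n : ℕ) (x : H ρ n) : (PHom.id ρ).map n x = x := by rw [map_id]; rfl

lemma map_congr {u v : PHom ρ ρ'} (h : u.φ = v.φ) (h' : u.f = v.f) (n : ℕ) :
    u.map n = v.map n := by rw [PHom.ext h h']

lemma map_add (u v w : PHom ρ ρ') (h : u.φ = w.φ) (h' : v.φ = w.φ) (hf : w.f = u.f + v.f)
    (n : ℕ) : w.map n = u.map n + v.map n := by
  have : w.chains = u.chains + v.chains := by
    refine HomologicalComplex.hom_ext _ _ fun i => ModuleCat.hom_ext <|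
      Finsupp.lhom_ext fun x a => ?_
    refine (chains_single w i x a).trans ?_
    refine Eq.trans ?_ (congrArg₂ (· + ·) (chains_single u i x a) (chains_single v i x a)).symm
    rw [h, h', ← Finsupp.single_add, hf]
    rfl
  have h2 : HomologicalComplex.homologyMap w.chains n =
     HomologicalComplex.homologyMap u.chains n + HomologicalComplex.homologyMap v.chains n := by
    rw [this, HomologicalComplex.homologyMap_add]
  exact congrArg ModuleCat.Hom.hom h2

lemma map_zero (u : PHom ρ ρ') (h : u.f = 0) (n : ℕ) : u.map n = 0 := by
  have := map_add u u u rfl rfl (by simp [h]) n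
  simpa using this

end PHom

section H0
variable (ρ : Representation k G M)  {ρ' : Representation k G' M'}

/-- The class of an element in degree zero. -/
noncomputable def H0mk : M →ₗ[k] H ρ 0 := (groupHomology.H0π (Rep.of ρ)).hom

lemma H0mk_surjective : Function.Surjective (H0mk ρ) :=
  (ModuleCat.epi_iff_surjective (groupHomology.H0π (Rep.of ρ))).1 inferInstance

variable {ρ} in
lemma map_H0mk (u : PHom ρ ρ') (m : M) : u.map 0 (H0mk ρ m) = H0mk ρ' (u.f m) := by
  have := groupHomology.H0π_comp_map u.φ u.rep
  exact congrArg (fun t => ModuleCat.Hom.hom t m) this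

/-- The augmentation submodule. -/
def aug : Submodule k M := Representation.Coinvariants.ker ρ

lemma H0mk_eq_zero_iff (m : M) : H0mk ρ m = 0 ↔ m ∈ aug ρ := by
  have h1 : (groupHomology.H0Iso (Rep.of ρ)).hom.hom (H0mk ρ m) =
     Representation.Coinvariants.mk ρ m := 
    congrArg (fun t => ModuleCat.Hom.hom t m) (groupHomology.H0π_comp_H0Iso_hom (Rep.of ρ))
  have hinj : Function.Injective (groupHomology.H0Iso (Rep.of ρ)).hom.hom :=
    (ModuleCat.mono_iff_injective _).1 inferInstance
  constructor
  · intro h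
    rw [h] at h1
    erw [_root_.map_zero] at h1
    exact (Representation.Coinvariants.mk_eq_zero ρ).1 h1.symm
  · intro h
    apply hinj
    rw [h1]
    erw [_root_.map_zero]
    exact (Representation.Coinvariants.mk_eq_zero ρ).2 h

lemma H0mk_smul (g : G) (m : M) : H0mk ρ (ρ g m) = H0mk ρ m := by
  rw [← sub_eq_zero, ← map_sub, H0mk_eq_zero_iff]
  exact Representation.Coinvariants.sub_mem_ker g m

/-- Descent. -/
lemma H0_lift {N : Type} [AddCommGroup N] [Module k N] (f : M →ₗ[k] N)
    (h : ∀ g m, f (ρ g m) = f m) {m : M} (hm : H0mk ρ m = 0) : f m = 0 := by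
  rw [H0mk_eq_zero_iff] at hm
  have : aug ρ ≤ LinearMap.ker f := by
    unfold aug Representation.Coinvariants.ker
    rw [Submodule.span_le]
    rintro _ ⟨⟨g, m⟩, rfl⟩
    simp [h]
  exact this hm

end H0

section SES

/-- A short exact sequence of representations of `G`. -/
structure SES {M₁ M₂ M₃ : Type} [AddCommGroup M₁] [AddCommGroup M₂] [AddCommGroup M₃]
    [Module k M₁] [Module k M₂] [Module k M₃]
    (ρ₁ : Representation k G M₁) (ρ₂ : Representation k G M₂) (ρ₃ : Representation k G M₃) where
  i : M₁ →ₗ[k] M₂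
  q : M₂ →ₗ[k] M₃
  hi : ∀ g m, i (ρ₁ g m) = ρ₂ g (i m)
  hq : ∀ g m, q (ρ₂ g m) = ρ₃ g (q m)
  inj : Function.Injective i
  surj : Function.Surjective q
  ex : ∀ m, q m = 0 ↔ ∃ m', i m' = m

variable {M₁ M₂ M₃ : Type} [AddCommGroup M₁] [AddCommGroup M₂] [AddCommGroup M₃]
    [Module k M₁] [Module k M₂] [Module k M₃]
    {ρ₁ : Representation k G M₁} {ρ₂ : Representation k G M₂} {ρ₃ : Representation k G M₃}
variable {M₁' M₂' M₃' : Type} [AddCommGroup M₁'] [AddCommGroup M₂'] [AddCommGroup M₃']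
    [Module k M₁'] [Module k M₂'] [Module k M₃']
    {ρ₁' : Representation k G' M₁'} {ρ₂' : Representation k G' M₂'}
    {ρ₃' : Representation k G' M₃'}

namespace SES

variable (S : SES ρ₁ ρ₂ ρ₃) (S' : SES ρ₁' ρ₂' ρ₃')

/-- The injection as a morphism of pairs. -/
def I : PHom ρ₁ ρ₂ := PHom.mk₁ S.i S.hi
/-- The surjection as a morphism of pairs. -/
def Q : PHom ρ₂ ρ₃ := PHom.mk₁ S.q S.hq

/-- The short complex in `Rep`. -/
noncomputable def sc : ShortComplex (Rep.{0} k G) :=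
  ShortComplex.mk (X₁ := Rep.of ρ₁) (X₂ := Rep.of ρ₂) (X₃ := Rep.of ρ₃) S.I.rep S.Q.rep (by
    apply Rep.hom_ext
    apply Representation.IntertwiningMap.ext
    ext m
    exact (S.ex _).2 ⟨m, rfl⟩)

lemma shortExact : S.sc.ShortExact := by
  have h1 : S.sc.Exact := by
    have : (S.sc.map (forget₂ (Rep k G) (ModuleCat k))).Exact := by
      rw [ShortComplex.moduleCat_exact_iff]
      intro x hx
      exact (S.ex _).1 hx
    rwa [ShortComplex.exact_map_iff_of_faithful] at this
  exact { exact := h1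
          mono_f := (Rep.mono_iff_injective _).2 S.inj
          epi_g := (Rep.epi_iff_surjective _).2 S.surj }

/-- The connecting homomorphism. -/
noncomputable def δ (n : ℕ) : H ρ₃ (n + 1) →ₗ[k] H ρ₁ n :=
  (groupHomology.δ S.shortExact (n + 1) n rfl).hom

lemma exact₁ (n : ℕ) (x : H ρ₁ n) : S.I.map n x = 0 ↔ ∃ y, S.δ n y = x := by
  have h := groupHomology.mapShortComplex₁_exact S.shortExact (i := n + 1) (j := n) rfl
  constructor
  · intro hx
    rw [ShortComplex.moduleCat_exact_iff] at h
    exact h x hx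
  · rintro ⟨y, rfl⟩
    exact congrArg (fun t => ModuleCat.Hom.hom t y)
      (groupHomology.mapShortComplex₁ S.shortExact (i := n + 1) (j := n) rfl).zero

lemma exact₂ (n : ℕ) (x : H ρ₂ n) : S.Q.map n x = 0 ↔ ∃ y, S.I.map n y = x := by
  have h := groupHomology.mapShortComplex₂_exact S.shortExact n
  constructor
  · intro hx
    rw [ShortComplex.moduleCat_exact_iff] at h
    exact h x hx
  · rintro ⟨y, rfl⟩
    exact congrArg (fun t => ModuleCat.Hom.hom t y)
      (groupHomology.mapShortComplex₂ S.sc n).zero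

lemma exact₃ (n : ℕ) (x : H ρ₃ (n + 1)) : S.δ n x = 0 ↔ ∃ y, S.Q.map (n + 1) y = x := by
  have h := groupHomology.mapShortComplex₃_exact S.shortExact (i := n + 1) (j := n) rfl
  constructor
  · intro hx
    rw [ShortComplex.moduleCat_exact_iff] at h
    exact h x hx
  · rintro ⟨y, rfl⟩
    exact congrArg (fun t => ModuleCat.Hom.hom t y)
      (groupHomology.mapShortComplex₃ S.shortExact (i := n + 1) (j := n) rfl).zero

lemma Q_surj₀ : Function.Surjective (S.Q.map 0) := by
  intro x
  obtain ⟨m, rfl⟩ := H0mk_surjective _ x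
  obtain ⟨m', rfl⟩ := S.surj m
  exact ⟨H0mk _ m', map_H0mk _ _⟩

variable {S S'}

lemma δ_nat (a₁ : PHom ρ₁ ρ₁') (a₂ : PHom ρ₂ ρ₂') (a₃ : PHom ρ₃ ρ₃')
    (h₁ : a₁.φ = a₂.φ) (h₃ : a₃.φ = a₂.φ)
    (c₁ : ∀ m, a₂.f (S.i m) = S'.i (a₁.f m)) (c₂ : ∀ m, a₃.f (S.q m) = S'.q (a₂.f m))
    (n : ℕ) (x : H ρ₃ (n + 1)) : a₁.map n (S.δ n x) = S'.δ n (a₃.map (n + 1) x) := by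
  let Φ : S.sc.map (groupHomology.chainsFunctor k G) ⟶
      S'.sc.map (groupHomology.chainsFunctor k G') :=
    { τ₁ := a₁.chains
      τ₂ := a₂.chains
      τ₃ := a₃.chains
      comm₁₂ := by
        have h : S'.I.comp a₁ = a₂.comp S.I := PHom.ext
          (by rw [PHom.comp_φ, PHom.comp_φ, h₁]; rfl) (LinearMap.ext fun m => (c₁ m).symm)
        have h' := congrArg PHom.chains h
        rw [PHom.chains_comp, PHom.chains_comp] at h'
        exact h'
      comm₂₃ := by
        have h : S'.Q.comp a₂ = a₃.comp S.Q := PHom.ext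
          (by rw [PHom.comp_φ, PHom.comp_φ, h₃]; rfl) (LinearMap.ext fun m => (c₂ m).symm)
        have h' := congrArg PHom.chains h
        rw [PHom.chains_comp, PHom.chains_comp] at h'
        exact h' }
  have := HomologicalComplex.HomologySequence.δ_naturality Φ
    (groupHomology.map_chainsFunctor_shortExact S.shortExact)
    (groupHomology.map_chainsFunctor_shortExact S'.shortExact) (n + 1) n rfl
  exact congrArg (fun t => ModuleCat.Hom.hom t x) this

end SES

end SES

section exactness
variable (ρ : Representation k G M)

/-- Vanishing in terms of chains. -/
lemma H_subsingleton_iff (n : ℕ) : Subsingleton (H ρ (n + 1)) ↔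
    ∀ x : (Fin (n + 1) → G) →₀ M, (groupHomology.inhomogeneousChains.d (Rep.of ρ) n).hom x = 0 →
      ∃ y : (Fin (n + 2) → G) →₀ M,
        (groupHomology.inhomogeneousChains.d (Rep.of ρ) (n + 1)).hom y = x := by
  have h1 : Subsingleton (H ρ (n + 1)) ↔ Limits.IsZero (groupHomology (Rep.of ρ) (n + 1)) := by
    exact (ModuleCat.isZero_iff_subsingleton (M := groupHomology (Rep.of ρ) (n + 1))).symm
  rw [h1]
  have h2 : Limits.IsZero (groupHomology (Rep.of ρ) (n + 1)) ↔
     (groupHomology.inhomogeneousChains (Rep.of ρ)).ExactAt (n + 1) :=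
    (HomologicalComplex.exactAt_iff_isZero_homology _ _).symm
  rw [h2, HomologicalComplex.exactAt_iff' _ (n + 2) (n + 1) n (by simp) (by simp),
    ShortComplex.moduleCat_exact_iff]
  have e1 : (groupHomology.inhomogeneousChains (Rep.of ρ)).d (n + 1) n =
    groupHomology.inhomogeneousChains.d (Rep.of ρ) n := by
      exact groupHomology.inhomogeneousChains.d_def ..
  have e2 : (groupHomology.inhomogeneousChains (Rep.of ρ)).d (n + 2) (n + 1) =
    groupHomology.inhomogeneousChains.d (Rep.of ρ) (n + 1) := by
      exact groupHomology.inhomogeneousChains.d_def ..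
  rw [← e1, ← e2]
  exact Iff.rfl

end exactness

end GH

namespace GH

variable {k : Type} [CommRing k]
  {G G' G'' : Type} [Group G] [Group G'] [Group G'']
  {M M' M'' : Type} [AddCommGroup M] [AddCommGroup M'] [AddCommGroup M'']
  [Module k M] [Module k M'] [Module k M'']

section sub

/-- Restriction of a representation to an invariant submodule. -/
def subRep {G : Type} [Monoid G] (ρ : Representation k G M) (N : Submodule k M) (hN : ∀ g, ∀ m ∈ N, ρ g m ∈ N) :
    Representation k G N where
  toFun g := (ρ g).restrict (hN g)
  map_one' := by ext m; simp
  map_mul' g h := by ext m; simp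

@[simp] lemma subRep_coe {G : Type} [Monoid G] (ρ : Representation k G M) (N : Submodule k M)
    (hN : ∀ g, ∀ m ∈ N, ρ g m ∈ N) (g : G) (m : N) :
    ((subRep ρ N hN g m : N) : M) = ρ g m := rfl

/-- Quotient representation. -/
def quotRep {G : Type} [Monoid G] (ρ : Representation k G M) (N : Submodule k M) (hN : ∀ g, ∀ m ∈ N, ρ g m ∈ N) :
    Representation k G (M ⧸ N) where
  toFun g := N.mapQ N (ρ g) (hN g)
  map_one' := by
    apply Submodule.linearMap_qext; ext m; simp
  map_mul' g h := by
    apply Submodule.linearMap_qext; ext m; simp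

@[simp] lemma quotRep_mk {G : Type} [Monoid G] (ρ : Representation k G M) (N : Submodule k M)
    (hN : ∀ g, ∀ m ∈ N, ρ g m ∈ N) (g : G) (m : M) :
    quotRep ρ N hN g (N.mkQ m) = N.mkQ (ρ g m) := rfl

/-- The SES of a submodule. -/
def SES.ofSub (ρ : Representation k G M) (N : Submodule k M) (hN : ∀ g, ∀ m ∈ N, ρ g m ∈ N) :
    SES (subRep ρ N hN) ρ (quotRep ρ N hN) where
  i := N.subtype
  q := N.mkQ
  hi _ _ := rfl
  hq _ _ := rfl
  inj := N.subtype_injective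
  surj := N.mkQ_surjective
  ex m := by simp

/-- The SES of a surjection. -/
def SES.ofSurj {ρ : Representation k G M} {ρ' : Representation k G M'} (q : M →ₗ[k] M')
    (hq : ∀ g m, q (ρ g m) = ρ' g (q m)) (hs : Function.Surjective q) :
    SES (subRep ρ (LinearMap.ker q) (fun g m hm => by
      rw [LinearMap.mem_ker] at hm ⊢; rw [hq, hm, map_zero])) ρ ρ' where
  i := (LinearMap.ker q).subtype
  q := q
  hi _ _ := rfl
  hq := hq
  inj := Submodule.subtype_injective _
  surj := hs
  ex m := by simp

end sub

section iso

variable {ρ : Representation k G M} {ρ' : Representation k G M'}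

lemma PHom.map_bijective (f : M →ₗ[k] M') (h : ∀ g m, f (ρ g m) = ρ' g (f m))
    (hf : Function.Bijective f) (n : ℕ) : Function.Bijective ((PHom.mk₁ f h).map n) := by
  let e := LinearEquiv.ofBijective f hf
  let v : PHom ρ' ρ := PHom.mk₁ e.symm.toLinearMap (fun g m => by
    obtain ⟨m, rfl⟩ := hf.2 m
    have : ∀ m, e.symm (f m) = m := fun m => e.symm_apply_apply m
    change e.symm (ρ' g (f m)) = ρ g (e.symm (f m))
    rw [← h, this, this])
  have h1 : v.comp (PHom.mk₁ f h) = PHom.id ρ :=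
    PHom.ext rfl (LinearMap.ext fun m => e.symm_apply_apply m)
  have h2 : (PHom.mk₁ f h).comp v = PHom.id ρ' :=
    PHom.ext rfl (LinearMap.ext fun m => e.apply_symm_apply m)
  refine Function.bijective_iff_has_inverse.2 ⟨v.map n, fun x => ?_, fun x => ?_⟩
  · rw [← PHom.map_comp_apply, h1, PHom.map_id_apply]
  · rw [← PHom.map_comp_apply, h2, PHom.map_id_apply]

lemma H_subsingleton_of_surj {n : ℕ} {G : Type} [Group G] {ρ : Representation k G M}
    {ρ' : Representation k G' M'} (u : PHom ρ ρ') (hu : Function.Surjective (u.map n))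
    (h : Subsingleton (H ρ n)) : Subsingleton (H ρ' n) := hu.subsingleton

lemma H_subsingleton_of_bij (f : M →ₗ[k] M') (h : ∀ g m, f (ρ g m) = ρ' g (f m))
    (hf : Function.Bijective f) (n : ℕ) (hs : Subsingleton (H ρ n)) : Subsingleton (H ρ' n) :=
  (PHom.map_bijective f h hf n).2.subsingleton

lemma H_subsingleton_of_bij' (f : M →ₗ[k] M') (h : ∀ g m, f (ρ g m) = ρ' g (f m))
    (hf : Function.Bijective f) (n : ℕ) (hs : Subsingleton (H ρ' n)) : Subsingleton (H ρ n) :=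
  (PHom.map_bijective f h hf n).1.subsingleton

lemma H_subsingleton_of_subsingleton (ρ : Representation k G M) [Subsingleton M] (n : ℕ) :
    Subsingleton (H ρ n) := by
  refine subsingleton_of_forall_eq 0 fun x => ?_
  rw [← PHom.map_id_apply n x, PHom.map_zero _ (Subsingleton.elim _ _)]
  rfl

end iso

section Ind

variable (S : Type) [MulAction G S]

/-- The representation on `S →₀ M` twisted by `ρ`. -/
noncomputable def Ind (ρ : Representation k G M) : Representation k G (S →₀ M) where
  toFun g := Finsupp.lmapDomain M k (g • ·) ∘ₗ Finsupp.mapRange.linearMap (ρ g)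
  map_one' := by
    apply Finsupp.lhom_ext; intro s m; simp [Finsupp.mapDomain_single]
  map_mul' g h := by
    apply Finsupp.lhom_ext; intro s m; simp [Finsupp.mapDomain_single, mul_smul]

@[simp] lemma Ind_single (ρ : Representation k G M) (g : G) (s : S) (m : M) :
    Ind S ρ g (Finsupp.single s m) = Finsupp.single (g • s) (ρ g m) := by
  simp [Ind, Finsupp.mapDomain_single]

/-- The augmentation. -/
noncomputable def eps (k S : Type) [CommRing k] {M : Type} [AddCommGroup M] [Module k M] :
    (S →₀ M) →ₗ[k] M :=
  Finsupp.lsum k fun _ => LinearMap.id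

@[simp] lemma eps_single (s : S) (m : M) : eps k S (Finsupp.single s m) = m := by
  simp [eps]

lemma eps_comm (ρ : Representation k G M) (g : G) (x : S →₀ M) :
    eps k S (Ind S ρ g x) = ρ g (eps k S x) := by
  revert x
  refine LinearMap.congr_fun (f := eps k S ∘ₗ Ind S ρ g) (g := ρ g ∘ₗ eps k S) ?_
  apply Finsupp.lhom_ext; intro s m; simp

lemma eps_surj [Nonempty S] : Function.Surjective (eps k S : (S →₀ M) →ₗ[k] M) := fun m =>
  ⟨Finsupp.single (Classical.arbitrary S) m, by simp⟩

variable {S} in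
/-- Functoriality of `Ind`. -/
noncomputable def PHom.ind {S' : Type} [MulAction G' S'] {ρ : Representation k G M}
    {ρ' : Representation k G' M'} (u : PHom ρ ρ') (a : S → S')
    (ha : ∀ g s, a (g • s) = u.φ g • a s) : PHom (Ind S ρ) (Ind S' ρ') where
  φ := u.φ
  f := Finsupp.lmapDomain M' k a ∘ₗ Finsupp.mapRange.linearMap u.f
  comm g x := by
    revert x
    refine LinearMap.congr_fun (f := (Finsupp.lmapDomain M' k a ∘ₗ
      Finsupp.mapRange.linearMap u.f) ∘ₗ Ind S ρ g) (g := Ind S' ρ' (u.φ g) ∘ₗ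
      (Finsupp.lmapDomain M' k a ∘ₗ Finsupp.mapRange.linearMap u.f)) ?_
    apply Finsupp.lhom_ext; intro s m; simp [Finsupp.mapDomain_single, ha, u.comm]

variable {S} in
@[simp] lemma PHom.ind_f_single {S' : Type} [MulAction G' S'] {ρ : Representation k G M}
    {ρ' : Representation k G' M'} (u : PHom ρ ρ') (a : S → S')
    (ha : ∀ g s, a (g • s) = u.φ g • a s) (s : S) (m : M) :
    (u.ind a ha).f (Finsupp.single s m) = Finsupp.single (a s) (u.f m) := by
  simp [PHom.ind, Finsupp.mapDomain_single]

/-- Exactness of `Ind`. -/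
noncomputable def SES.ind {M₁ M₂ M₃ : Type} [AddCommGroup M₁] [AddCommGroup M₂] [AddCommGroup M₃]
    [Module k M₁] [Module k M₂] [Module k M₃]
    {ρ₁ : Representation k G M₁} {ρ₂ : Representation k G M₂} {ρ₃ : Representation k G M₃}
    (T : SES ρ₁ ρ₂ ρ₃) : SES (Ind S ρ₁) (Ind S ρ₂) (Ind S ρ₃) where
  i := Finsupp.mapRange.linearMap T.i
  q := Finsupp.mapRange.linearMap T.q
  hi g x := by
    revert x
    refine LinearMap.congr_fun (f := Finsupp.mapRange.linearMap T.i ∘ₗ Ind S ρ₁ g)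
      (g := Ind S ρ₂ g ∘ₗ Finsupp.mapRange.linearMap T.i) ?_
    apply Finsupp.lhom_ext; intro s m; simp [T.hi]
  hq g x := by
    revert x
    refine LinearMap.congr_fun (f := Finsupp.mapRange.linearMap T.q ∘ₗ Ind S ρ₂ g)
      (g := Ind S ρ₃ g ∘ₗ Finsupp.mapRange.linearMap T.q) ?_
    apply Finsupp.lhom_ext; intro s m; simp [T.hq]
  inj := Finsupp.mapRange_injective _ (map_zero T.i) T.inj
  surj := Finsupp.mapRange_surjective _ (map_zero T.q) T.surj
  ex x := by
    constructor
    · intro h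
      have h' : ∀ s, T.q (x s) = 0 := fun s => by
        have := DFunLike.congr_fun h s
        simpa using this
      choose a ha using fun s => (T.ex _).1 (h' s)
      refine ⟨Finsupp.onFinset x.support a fun s hs => ?_, ?_⟩
      · rw [Finsupp.mem_support_iff, ← ha]
        intro h0
        exact hs (T.inj (by rw [h0, map_zero]))
      · ext s
        simp [ha]
    · rintro ⟨y, rfl⟩
      ext s
      simpa using (T.ex _).2 ⟨y s, rfl⟩

variable {S} in
open groupHomology in
lemma Ind_acyclic (ρ : Representation k G M) (r : S → G) (hr : ∀ g s, r (g • s) = g * r s)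
    (n : ℕ) : Subsingleton (H (Ind S ρ) (n + 1)) := by
  let h (n : ℕ) : ((Fin n → G) →₀ (S →₀ M)) →ₗ[k] ((Fin (n + 1) → G) →₀ (S →₀ M)) :=
    Finsupp.lsum k fun γ => Finsupp.lsum k fun s =>
      Finsupp.lsingle (Fin.cons (r s)⁻¹ γ) ∘ₗ Finsupp.lsingle ((r s)⁻¹ • s) ∘ₗ ρ (r s)⁻¹
  have hs (n : ℕ) (γ : Fin n → G) (s : S) (m : M) :
      h n (Finsupp.single γ (Finsupp.single s m)) =
       Finsupp.single (Fin.cons (r s)⁻¹ γ : Fin (n + 1) → G)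
         (Finsupp.single ((r s)⁻¹ • s) (ρ (r s)⁻¹ m)) := by
    simp only [h]
    rw [Finsupp.lsum_single, Finsupp.lsum_single]
    rfl
  have key (x : (Fin (n + 1) → G) →₀ (S →₀ M)) :
      (inhomogeneousChains.d (Rep.of (Ind S ρ)) (n + 1)).hom (h (n + 1) x) +
       h n ((inhomogeneousChains.d (Rep.of (Ind S ρ)) n).hom x) = x := by
    revert x
    refine LinearMap.congr_fun (f := (inhomogeneousChains.d (Rep.of (Ind S ρ)) (n + 1)).hom ∘ₗ
      (h (n + 1)) + (h n) ∘ₗ (inhomogeneousChains.d (Rep.of (Ind S ρ)) n).hom)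
      (g := LinearMap.id) ?_
    refine Finsupp.lhom_ext' fun γ => Finsupp.lhom_ext fun s m => ?_
    simp only [LinearMap.comp_apply, LinearMap.add_apply, Finsupp.lsingle_apply,
      LinearMap.id_apply]
    rw [hs]
    erw [inhomogeneousChains.d_single, inhomogeneousChains.d_single]
    simp only [Fin.cons_zero, inv_inv, Ind_single, Fin.cons_succ, smul_inv_smul,
      Representation.self_inv_apply, map_add, map_sum, map_smul, hs]
    rw [Fin.sum_univ_succ, add_assoc, add_assoc]
    simp only [hr]
    have h0 : (Fin.contractNth (0 : Fin (n + 2)) (· * ·) (Fin.cons (r s)⁻¹ γ : Fin (n + 2) → G))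
       = Fin.cons ((γ 0)⁻¹ * r s)⁻¹ (fun i : Fin n => γ i.succ) := by
      ext i
      refine Fin.cases ?_ (fun i => ?_) i
      · simp [Fin.contractNth]
      · simp [Fin.contractNth]
    have h1 (j : Fin (n + 1)) : (Fin.contractNth (j.succ) (· * ·)
        (Fin.cons (r s)⁻¹ γ : Fin (n + 2) → G)) =
        Fin.cons (r s)⁻¹ (Fin.contractNth j (· * ·) γ) := by
      ext i
      refine Fin.cases ?_ (fun i => ?_) i
      · simp [Fin.contractNth]
      · simp only [Fin.contractNth, Fin.val_succ, Fin.cons_succ, add_lt_add_iff_right,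
          add_left_inj, ← Fin.succ_castSucc]
    simp only [h0, h1]
    have e1 : ((γ 0)⁻¹ * r s)⁻¹ • (γ 0)⁻¹ • s = (r s)⁻¹ • s := by
      rw [smul_smul]; congr 1; group
    have e2 : ρ ((γ 0)⁻¹ * r s)⁻¹ (ρ (γ 0)⁻¹ m) = ρ (r s)⁻¹ m := by
      rw [← Module.End.mul_apply, ← map_mul]; congr 2; group
    rw [e1, e2]
    rw [add_eq_left, ← sub_eq_zero]
    simp only [pow_succ, Fin.val_succ, Fin.val_zero, pow_zero]
    simp [Finset.sum_neg_distrib]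
    try abel
  rw [H_subsingleton_iff]
  intro x hx
  refine ⟨h (n + 1) x, ?_⟩
  have := key x
  rw [hx, map_zero, add_zero] at this
  exact this

end Ind
end GH

namespace GH

variable {k : Type} [CommRing k]
  {G G' G'' : Type} [Group G] [Group G'] [Group G'']
  {M M' M'' : Type} [AddCommGroup M] [AddCommGroup M'] [AddCommGroup M'']
  [Module k M] [Module k M'] [Module k M'']

section shift

variable {M₁ M₂ M₃ : Type} [AddCommGroup M₁] [AddCommGroup M₂] [AddCommGroup M₃]
    [Module k M₁] [Module k M₂] [Module k M₃]
    {ρ₁ : Representation k G M₁} {ρ₂ : Representation k G M₂} {ρ₃ : Representation k G M₃}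

lemma SES.δ_inj (S : SES ρ₁ ρ₂ ρ₃) (n : ℕ) (h : Subsingleton (H ρ₂ (n + 1))) :
    Function.Injective (S.δ n) := by
  rw [injective_iff_map_eq_zero]
  intro x hx
  obtain ⟨y, rfl⟩ := (S.exact₃ n x).1 hx
  rw [Subsingleton.elim y 0, map_zero]

lemma SES.δ_surj (S : SES ρ₁ ρ₂ ρ₃) (n : ℕ) (h : Subsingleton (H ρ₂ n)) :
    Function.Surjective (S.δ n) := fun x =>
  (S.exact₁ n x).1 (Subsingleton.elim _ _)

lemma SES.mid (S : SES ρ₁ ρ₂ ρ₃) (n : ℕ) (h : Subsingleton (H ρ₁ n)) (h' : Subsingleton (H ρ₃ n)) :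
    Subsingleton (H ρ₂ n) := by
  refine subsingleton_of_forall_eq 0 fun x => ?_
  obtain ⟨y, rfl⟩ := (S.exact₂ n x).1 (Subsingleton.elim _ _)
  rw [Subsingleton.elim y 0, map_zero]

/-- The kernel of the augmentation. -/
noncomputable def Omega (ρ : Representation k G M) :
    Representation k G (LinearMap.ker (eps k G : (G →₀ M) →ₗ[k] M)) :=
  subRep (Ind G ρ) _ (fun g m hm => by
      rw [LinearMap.mem_ker] at hm ⊢; rw [eps_comm, hm, map_zero])

/-- The dimension shifting sequence. -/
noncomputable def omegaSES (ρ : Representation k G M) : SES (Omega ρ) (Ind G ρ) ρ :=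
  SES.ofSurj (eps k G) (eps_comm G ρ) (eps_surj G)

variable {ρ : Representation k G M} {ρ' : Representation k G' M'}

/-- Functoriality of the free module. -/
noncomputable def PHom.free (u : PHom ρ ρ') : PHom (Ind G ρ) (Ind G' ρ') :=
  u.ind u.φ (fun g s => map_mul u.φ g s)

lemma PHom.free_f_single (u : PHom ρ ρ') (g : G) (m : M) :
    u.free.f (Finsupp.single g m) = Finsupp.single (u.φ g) (u.f m) := by
  simp [PHom.free]

lemma PHom.eps_free (u : PHom ρ ρ') (x : G →₀ M) : eps k G' (u.free.f x) = u.f (eps k G x) := by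
  revert x
  refine LinearMap.congr_fun (f := eps k G' ∘ₗ u.free.f) (g := u.f ∘ₗ eps k G) ?_
  apply Finsupp.lhom_ext; intro s m; simp [PHom.free]

/-- Functoriality of `Omega`. -/
noncomputable def PHom.omega (u : PHom ρ ρ') : PHom (Omega ρ) (Omega ρ') where
  φ := u.φ
  f := u.free.f.restrict (fun x hx => by
    rw [LinearMap.mem_ker] at hx ⊢
    rw [u.eps_free, hx, _root_.map_zero])
  comm g m := Subtype.ext (u.free.comm g m.1)

lemma Ind_self_acyclic (ρ : Representation k G M) (n : ℕ) : Subsingleton (H (Ind G ρ) (n + 1)) :=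
  Ind_acyclic ρ id (fun _ _ => rfl) n

lemma omega_δ_inj (ρ : Representation k G M) (n : ℕ) : Function.Injective ((omegaSES ρ).δ n) :=
  (omegaSES ρ).δ_inj n (Ind_self_acyclic ρ n)

lemma omega_δ_nat (u : PHom ρ ρ') (n : ℕ) (x : H ρ (n + 1)) :
    u.omega.map n ((omegaSES ρ).δ n x) = (omegaSES ρ').δ n (u.map (n + 1) x) :=
  SES.δ_nat u.omega u.free u rfl rfl (fun _ => rfl) (fun m => (u.eps_free m).symm) n x

end shift

/-- Inner automorphism. -/
def innerHom (ρ : Representation k G M) (g : G) : PHom ρ ρ where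
  φ := (MulAut.conj g).toMonoidHom
  f := ρ g
  comm h m := by
    change ρ g (ρ h m) = ρ (g * h * g⁻¹) (ρ g m)
    simp only [← Module.End.mul_apply, ← map_mul]
    simp

lemma inner_map_gen (n : ℕ) : ∀ {M : Type} [AddCommGroup M] [Module k M]
    (ρ : Representation k G M) (g : G) (u : PHom ρ ρ) (_ : u.φ = (MulAut.conj g).toMonoidHom)
    (_ : u.f = ρ g), u.map n = LinearMap.id := by
  induction n with
  | zero =>
    intro M _ _ ρ g u h1 h2
    ext x
    obtain ⟨m, rfl⟩ := H0mk_surjective _ x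
    rw [map_H0mk, h2, H0mk_smul]; rfl
  | succ n ih =>
    intro M _ _ ρ g u h1 h2
    ext x
    apply omega_δ_inj
    let w := innerHom (Omega ρ) g
    have hw := ih (Omega ρ) g w rfl rfl
    have := SES.δ_nat (S := omegaSES ρ) (S' := omegaSES ρ) w (innerHom (Ind G ρ) g) u rfl h1
      (fun m => rfl) (fun m => by rw [h2]; exact (eps_comm G ρ g m).symm) n x
    rw [← this, hw]; rfl

lemma inner_map (ρ : Representation k G M) (g : G) (n : ℕ) (x : H ρ n) :
    (innerHom ρ g).map n x = x := by
  rw [inner_map_gen n ρ g _ rfl rfl]; rfl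

section Shapiro

variable {C : Type} [Group C] (S : Type) [MulAction G S]

/-- The Shapiro map. -/
noncomputable def shap (ρ : Representation k G M) (ι : C →* G) (s₀ : S)
    (h₀ : ∀ c, ι c • s₀ = s₀) : PHom (ρ.comp ι) (Ind S ρ) where
  φ := ι
  f := Finsupp.lsingle s₀
  comm c m := by simp [h₀]

/-- The corestriction. -/
def cores (ρ : Representation k G M) (ι : C →* G) : PHom (ρ.comp ι) ρ where
  φ := ι
  f := LinearMap.id
  comm _ _ := rfl

/-- Restricting an SES. -/
def SES.res {M₁ M₂ M₃ : Type} [AddCommGroup M₁] [AddCommGroup M₂] [AddCommGroup M₃]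
    [Module k M₁] [Module k M₂] [Module k M₃]
    {ρ₁ : Representation k G M₁} {ρ₂ : Representation k G M₂} {ρ₃ : Representation k G M₃}
    (T : SES ρ₁ ρ₂ ρ₃) (ι : C →* G) : SES (ρ₁.comp ι) (ρ₂.comp ι) (ρ₃.comp ι) where
  i := T.i
  q := T.q
  hi _ m := T.hi _ m
  hq _ m := T.hq _ m
  inj := T.inj
  surj := T.surj
  ex := T.ex

lemma res_acyclic {ι : C →* G} (ρ : Representation k G M) (r : G → C)
    (hr : ∀ c g, r (ι c * g) = c * r g) (n : ℕ) :
    Subsingleton (H ((Ind G ρ).comp ι) (n + 1)) := by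
  let _ : MulAction C G := MulAction.compHom G ι
  refine H_subsingleton_of_bij (ρ := Ind G (ρ.comp ι)) LinearMap.id (fun c x => ?_)
    Function.bijective_id (n + 1) (Ind_acyclic (S := G) (ρ.comp ι) r hr n)
  revert x
  refine LinearMap.congr_fun (f := Ind G (ρ.comp ι) c) (g := (Ind G ρ).comp ι c) ?_
  apply Finsupp.lhom_ext; intro s m
  rw [Ind_single]
  exact (Ind_single G ρ (ι c) s m).symm

lemma exists_retraction (ι : C →* G) (hι : Function.Injective ι) :
    ∃ r : G → C, ∀ c g, r (ι c * g) = c * r g := by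
  have key : ∀ g : G, ∃ c : C, ι c * (Quotient.out (Quotient.mk (QuotientGroup.rightRel ι.range) g))
     = g := by
    intro g
    have := Quotient.exact (Quotient.out_eq (Quotient.mk (QuotientGroup.rightRel ι.range) g))
    obtain ⟨c, hc⟩ := QuotientGroup.rightRel_apply.1 this
    exact ⟨c, by rw [hc]; group⟩
  choose r hr using key
  refine ⟨r, fun c g => hι ?_⟩
  have h1 := hr (ι c * g)
  have h2 := hr g
  have : Quotient.mk (QuotientGroup.rightRel ι.range) (ι c * g) =
    Quotient.mk (QuotientGroup.rightRel ι.range) g := by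
    apply Quotient.sound
    apply QuotientGroup.rightRel_apply.2
    exact ⟨c⁻¹, by simp⟩
  rw [this] at h1
  rw [map_mul]
  have h3 := h1.trans (congrArg (ι c * ·) h2.symm)
  rw [← mul_assoc] at h3
  exact mul_right_cancel h3

variable {S}

lemma Ind_Ind_acyclic (ρ : Representation k G M) (n : ℕ) :
    Subsingleton (H (Ind S (Ind G ρ)) (n + 1)) := by
  have h := Ind_acyclic (S := S × G) ρ Prod.snd (fun g s => rfl) n
  let e : (S × G →₀ M) ≃ₗ[k] (S →₀ (G →₀ M)) := Finsupp.curryLinearEquiv k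
  refine H_subsingleton_of_bij (ρ := Ind (S × G) ρ) e.toLinearMap (fun g x => ?_)
    e.bijective (n + 1) h
  revert x
  refine LinearMap.congr_fun (f := e.toLinearMap ∘ₗ Ind (S × G) ρ g)
    (g := Ind S (Ind G ρ) g ∘ₗ e.toLinearMap) ?_
  apply Finsupp.lhom_ext
  rintro ⟨s, h⟩ m
  simp [e]

variable (s₀ : S) (ι : C →* G) (h₀ : ∀ c, ι c • s₀ = s₀) (hι : Function.Injective ι)
  (htr : ∀ s : S, ∃ g : G, g • s₀ = s) (hst : ∀ g : G, g • s₀ = s₀ → ∃ c, ι c = g)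

include hι htr hst in
lemma shap_bijective (n : ℕ) : ∀ {M : Type} [AddCommGroup M] [Module k M]
    (ρ : Representation k G M), Function.Bijective ((shap S ρ ι s₀ h₀).map n) := by
  induction n with
  | zero =>
    intro M _ _ ρ
    constructor
    · rw [injective_iff_map_eq_zero]
      intro x hx
      obtain ⟨m, rfl⟩ := H0mk_surjective _ x
      rw [map_H0mk] at hx
      choose o ho using htr
      let f : (S →₀ M) →ₗ[k] H (ρ.comp ι) 0 := Finsupp.lsum k fun s =>
        H0mk (ρ.comp ι) ∘ₗ ρ (o s₀ * (o s)⁻¹)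
      have hf : ∀ s m, f (Finsupp.single s m) = H0mk (ρ.comp ι) (ρ (o s₀ * (o s)⁻¹) m) := by
        intro s m; simp only [f]; rw [Finsupp.lsum_single]; rfl
      have := H0_lift (Ind S ρ) f (fun g x => by
        revert x
        refine LinearMap.congr_fun (f := f ∘ₗ Ind S ρ g) (g := f) ?_
        apply Finsupp.lhom_ext
        intro s m
        rw [LinearMap.comp_apply, Ind_single, hf, hf]
        obtain ⟨c, hc⟩ := hst (o s₀ * (o (g • s))⁻¹ * g * (o s) * (o s₀)⁻¹) (by
          simp only [mul_smul]
          have e0 : (o s₀)⁻¹ • s₀ = s₀ := by rw [inv_smul_eq_iff, ho]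
          rw [e0, ho]
          have : (o (g • s))⁻¹ • g • s = s₀ := by rw [inv_smul_eq_iff, ho]
          rw [this, ho])
        have : ρ (o s₀ * (o (g • s))⁻¹) (ρ g m) =
            (ρ.comp ι) c (ρ (o s₀ * (o s)⁻¹) m) := by
          change _ = ρ (ι c) _
          simp only [hc, ← Module.End.mul_apply, ← map_mul]
          congr 2
          group
        rw [this, H0mk_smul]) hx
      have h2 : f (Finsupp.single s₀ m) = H0mk (ρ.comp ι) m := by rw [hf]; simp
      exact h2.symm.trans this
    · intro x
      obtain ⟨y, rfl⟩ := H0mk_surjective _ x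
      induction y using Finsupp.induction_linear with
      | zero => exact ⟨0, by simp⟩
      | add a b ha hb =>
        obtain ⟨a', ha⟩ := ha
        obtain ⟨b', hb⟩ := hb
        exact ⟨a' + b', by rw [map_add, ha, hb, map_add]⟩
      | single s m =>
        obtain ⟨g, rfl⟩ := htr s
        refine ⟨H0mk _ (ρ g⁻¹ m), ?_⟩
        rw [map_H0mk, ← H0mk_smul (Ind S ρ) g]
        simp [shap]
  | succ n ih =>
    intro M _ _ ρ
    let T := omegaSES ρ
    have nat : ∀ x, (shap S (Omega ρ) ι s₀ h₀).map n ((T.res ι).δ n x) =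
        (T.ind S).δ n ((shap S ρ ι s₀ h₀).map (n + 1) x) := fun x =>
      SES.δ_nat (S := T.res ι) (S' := T.ind S) (shap S (Omega ρ) ι s₀ h₀)
        (shap S (Ind G ρ) ι s₀ h₀) (shap S ρ ι s₀ h₀) rfl rfl
        (fun m => by simp [SES.ind, shap, SES.res]) (fun m => by simp [SES.ind, shap, SES.res]) n x
    have nat2 : ∀ x, (shap S (Ind G ρ) ι s₀ h₀).map n ((T.res ι).I.map n x) =
       (T.ind S).I.map n ((shap S (Omega ρ) ι s₀ h₀).map n x) := fun x => by
      rw [← PHom.map_comp_apply, ← PHom.map_comp_apply]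
      congr 2
      refine PHom.ext rfl (LinearMap.ext fun m => ?_)
      simp [SES.ind, shap, SES.res, SES.I]
    have d2 := (T.ind S).δ_inj n (Ind_Ind_acyclic ρ n)
    obtain ⟨r, hr⟩ := exists_retraction ι hι
    have d1 := (T.res ι).δ_inj n (res_acyclic ρ r hr n)
    constructor
    · rw [injective_iff_map_eq_zero]
      intro x hx
      apply d1
      apply (ih (Omega ρ)).1
      rw [nat, hx, map_zero, map_zero, map_zero]
    · intro x
      obtain ⟨y, hy⟩ := (ih (Omega ρ)).2 ((T.ind S).δ n x)
      have : (T.res ι).I.map n y = 0 := by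
        apply (ih (Ind G ρ)).1
        rw [nat2, hy, map_zero]
        exact ((T.ind S).exact₁ n _).2 ⟨x, rfl⟩
      obtain ⟨z, rfl⟩ := ((T.res ι).exact₁ n y).1 this
      refine ⟨z, d2 ?_⟩
      rw [← nat, hy]

include h₀ hι htr hst in
/-- Transfer: surjectivity of corestriction for invertible index. -/
lemma cores_surj [Fintype S] (hS : IsUnit ((Fintype.card S : ℕ) : k)) (ρ : Representation k G M)
    (n : ℕ) : Function.Surjective ((cores ρ ι).map n) := by
  obtain ⟨c, hc⟩ := hS.exists_right_inv
  let e : PHom (Ind S ρ) ρ := PHom.mk₁ (eps k S) (eps_comm S ρ)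
  let t : PHom ρ (Ind S ρ) := PHom.mk₁ (∑ s : S, Finsupp.lsingle s ∘ₗ (c • LinearMap.id))
    (fun g m => by
      simp only [LinearMap.sum_apply, map_sum, LinearMap.comp_apply, Finsupp.lsingle_apply,
        Ind_single, LinearMap.smul_apply, LinearMap.id_apply, map_smul]
      exact (Equiv.sum_comp (MulAction.toPerm (β := S) g) (fun s => c • Finsupp.single s (ρ g m))).symm)
  have h1 : e.comp t = PHom.id ρ := PHom.ext rfl (LinearMap.ext fun m => by
    simp only [e, t, PHom.comp_f, PHom.mk₁_f, LinearMap.comp_apply, LinearMap.sum_apply, map_sum,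
      Finsupp.lsingle_apply, eps_single, LinearMap.smul_apply, LinearMap.id_apply, PHom.id_f]
    rw [Finset.sum_const, Finset.card_univ, ← Nat.cast_smul_eq_nsmul k, smul_smul, hc, one_smul])
  have h2 : e.comp (shap S ρ ι s₀ h₀) = cores ρ ι := PHom.ext rfl (LinearMap.ext fun m => by
    simp [e, shap, cores])
  intro x
  obtain ⟨y, hy⟩ := (shap_bijective s₀ ι h₀ hι htr hst n ρ).2 (t.map n x)
  refine ⟨y, ?_⟩
  rw [← h2, PHom.map_comp_apply, hy, ← PHom.map_comp_apply, h1, PHom.map_id_apply]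

end Shapiro

lemma H_coprime [Fintype G] (hG : IsUnit ((Fintype.card G : ℕ) : k)) (ρ : Representation k G M)
    (n : ℕ) : Subsingleton (H ρ (n + 1)) := by
  obtain ⟨c, hc⟩ := hG.exists_right_inv
  let e : PHom (Ind G ρ) ρ := PHom.mk₁ (eps k G) (eps_comm G ρ)
  let t : PHom ρ (Ind G ρ) := PHom.mk₁ (∑ s : G, Finsupp.lsingle s ∘ₗ (c • LinearMap.id))
    (fun g m => by
      simp only [LinearMap.sum_apply, map_sum, LinearMap.comp_apply, Finsupp.lsingle_apply,
        Ind_single, LinearMap.smul_apply, LinearMap.id_apply, map_smul]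
      exact (Equiv.sum_comp (MulAction.toPerm (β := G) g) (fun s => c • Finsupp.single s (ρ g m))).symm)
  have h1 : e.comp t = PHom.id ρ := PHom.ext rfl (LinearMap.ext fun m => by
    simp only [e, t, PHom.comp_f, PHom.mk₁_f, LinearMap.comp_apply, LinearMap.sum_apply, map_sum,
      Finsupp.lsingle_apply, eps_single, LinearMap.smul_apply, LinearMap.id_apply, PHom.id_f]
    rw [Finset.sum_const, Finset.card_univ, ← Nat.cast_smul_eq_nsmul k, smul_smul, hc, one_smul])
  have := Ind_self_acyclic ρ n
  refine subsingleton_of_forall_eq 0 fun x => ?_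
  rw [← PHom.map_id_apply (n + 1) x, ← h1, PHom.map_comp_apply, Subsingleton.elim (t.map (n + 1) x) 0,
    map_zero]

end GH

namespace GH

variable {k : Type} [CommRing k]
  {G G' G'' : Type} [Group G] [Group G'] [Group G'']
  {M M' M'' : Type} [AddCommGroup M] [AddCommGroup M'] [AddCommGroup M'']
  [Module k M] [Module k M'] [Module k M'']

section LHS

variable {N Q : Type} [Group N] [Group Q] {c : Q →* MulAut N}

open SemidirectProduct

/-- Action of an element of the quotient on the pair. -/
def qHom (ρ : Representation k (N ⋊[c] Q) M) (q : Q) :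
    PHom (ρ.comp (inl : N →* N ⋊[c] Q)) (ρ.comp (inl : N →* N ⋊[c] Q)) where
  φ := (c q).toMonoidHom
  f := ρ (inr q)
  comm n m := by
    change ρ (inr q) (ρ (inl n) m) = ρ (inl (c q n)) (ρ (inr q) m)
    rw [inl_aut]
    simp only [← Module.End.mul_apply, ← map_mul]
    simp

/-- The representation of the quotient on the homology of the kernel. -/
noncomputable def QRep (ρ : Representation k (N ⋊[c] Q) M) (j : ℕ) :
    Representation k Q (H (ρ.comp (inl : N →* N ⋊[c] Q)) j) where
  toFun q := (qHom ρ q).map j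
  map_one' := by
    change _ = LinearMap.id
    rw [← PHom.map_id (ρ := ρ.comp inl)]
    apply PHom.map_congr
    · ext n; simp [qHom]
    · simp [qHom]; rfl
  map_mul' q q' := by
    change _ = (qHom ρ q).map j ∘ₗ (qHom ρ q').map j
    rw [← PHom.map_comp]
    apply PHom.map_congr
    · ext n; simp [qHom]
    · simp [qHom]; rfl

lemma QRep_apply (ρ : Representation k (N ⋊[c] Q) M) (j : ℕ) (q : Q) :
    QRep ρ j q = (qHom ρ q).map j := rfl

/-- The edge morphism. -/
noncomputable def edge (ρ : Representation k (N ⋊[c] Q) M) : PHom ρ (QRep ρ 0) where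
  φ := rightHom
  f := H0mk (ρ.comp (inl : N →* N ⋊[c] Q))
  comm g m := by
    rw [QRep_apply, map_H0mk]
    change _ = H0mk _ (ρ (inr g.right) m)
    conv_lhs => rw [← inl_left_mul_inr_right g, map_mul]
    exact H0mk_smul (ρ.comp (inl : N →* N ⋊[c] Q)) g.left _

variable {M₁ M₂ M₃ : Type} [AddCommGroup M₁] [AddCommGroup M₂] [AddCommGroup M₃]
    [Module k M₁] [Module k M₂] [Module k M₃]
    {ρ₁ : Representation k (N ⋊[c] Q) M₁} {ρ₂ : Representation k (N ⋊[c] Q) M₂}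
    {ρ₃ : Representation k (N ⋊[c] Q) M₃}

lemma QRep_δ (T : SES ρ₁ ρ₂ ρ₃) (j : ℕ) (q : Q) (x) :
    (T.res inl).δ j (QRep ρ₃ (j + 1) q x) = QRep ρ₁ j q ((T.res inl).δ j x) :=
  (SES.δ_nat (S := T.res inl) (S' := T.res inl) (qHom ρ₁ q) (qHom ρ₂ q) (qHom ρ₃ q) rfl rfl
    (fun m => (T.hi _ m).symm) (fun m => (T.hq _ m).symm) j x).symm

lemma QRep_I (T : SES ρ₁ ρ₂ ρ₃) (j : ℕ) (q : Q) (x) :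
    (T.res inl).I.map j (QRep ρ₁ j q x) = QRep ρ₂ j q ((T.res inl).I.map j x) := by
  rw [QRep_apply, QRep_apply, ← PHom.map_comp_apply, ← PHom.map_comp_apply]
  congr 2
  exact PHom.ext rfl (LinearMap.ext fun m => T.hi _ m)

lemma QRep_Q (T : SES ρ₁ ρ₂ ρ₃) (j : ℕ) (q : Q) (x) :
    (T.res inl).Q.map j (QRep ρ₂ j q x) = QRep ρ₃ j q ((T.res inl).Q.map j x) := by
  rw [QRep_apply, QRep_apply, ← PHom.map_comp_apply, ← PHom.map_comp_apply]
  congr 2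
  exact PHom.ext rfl (LinearMap.ext fun m => T.hq _ m)

lemma edge_injective (d : ℕ) : ∀ {M : Type} [AddCommGroup M] [Module k M]
    (ρ : Representation k (N ⋊[c] Q) M)
    (_ : ∀ i j, i + j = d → 1 ≤ j → Subsingleton (H (QRep ρ j) i)),
    Function.Injective ((edge ρ).map d) := by
  induction d with
  | zero =>
    intro M _ _ ρ _
    rw [injective_iff_map_eq_zero]
    intro x hx
    obtain ⟨m, rfl⟩ := H0mk_surjective _ x
    rw [map_H0mk] at hx
    have := H0_lift _ ((cores ρ (inl : N →* N ⋊[c] Q)).map 0) (fun q x => ?_) hx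
    · exact (map_H0mk (cores ρ (inl : N →* N ⋊[c] Q)) m).symm.trans this
    · obtain ⟨m, rfl⟩ := H0mk_surjective _ x
      rw [QRep_apply, map_H0mk, map_H0mk, map_H0mk]
      exact H0mk_smul ρ (inr q) m
  | succ d ih =>
    intro M _ _ ρ hρ
    let T := omegaSES ρ
    let TN := T.res (inl : N →* N ⋊[c] Q)
    have hac (n : ℕ) : Subsingleton (H ((Ind (N ⋊[c] Q) ρ).comp inl) (n + 1)) :=
      res_acyclic (ι := (inl : N →* N ⋊[c] Q)) ρ (fun g => g.left) (fun n g => by simp) n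
    have hIH : Function.Injective ((edge (Omega ρ)).map d) := by
      apply ih
      intro i j hij hj
      obtain ⟨j, rfl⟩ : ∃ j', j = j' + 1 := ⟨j - 1, by omega⟩
      exact H_subsingleton_of_bij (TN.δ (j + 1)) (QRep_δ T (j + 1))
        ⟨TN.δ_inj _ (hac _), TN.δ_surj _ (hac _)⟩ i (hρ i (j + 2) (by omega) (by omega))
    let A := SES.ofSurj (ρ := QRep (Ind (N ⋊[c] Q) ρ) 0) (ρ' := QRep ρ 0) (TN.Q.map 0)
      (QRep_Q T 0) TN.Q_surj₀
    let Bq := (TN.I.map 0).codRestrict (LinearMap.ker (TN.Q.map 0))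
      (fun x => (TN.exact₂ 0 _).2 ⟨x, rfl⟩)
    let B : SES (QRep ρ 1) (QRep (Omega ρ) 0) (subRep (QRep (Ind (N ⋊[c] Q) ρ) 0)
        (LinearMap.ker (TN.Q.map 0)) (fun g m hm => by
          rw [LinearMap.mem_ker] at hm ⊢; rw [QRep_Q T, hm, map_zero])) :=
      { i := TN.δ 0
        q := Bq
        hi := QRep_δ T 0
        hq := fun g m => Subtype.ext (QRep_I T 0 g m)
        inj := TN.δ_inj _ (hac _)
        surj := by
          rintro ⟨y, hy⟩
          obtain ⟨x, rfl⟩ := (TN.exact₂ 0 _).1 hy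
          exact ⟨x, rfl⟩
        ex := fun m => by
          rw [← TN.exact₁]
          exact Subtype.ext_iff }
    rw [injective_iff_map_eq_zero]
    intro x hx
    apply omega_δ_inj
    rw [map_zero]
    apply hIH
    rw [map_zero]
    have hB : ∀ y, B.Q.map d y = 0 → y = 0 := fun y hy => by
      obtain ⟨z, rfl⟩ := (B.exact₂ d y).1 hy
      have := hρ d 1 rfl le_rfl
      rw [Subsingleton.elim z 0, map_zero]
    apply hB
    rw [← PHom.map_comp_apply]
    refine (SES.δ_nat (S := T) (S' := A) (B.Q.comp (edge (Omega ρ))) (edge (Ind _ ρ)) (edge ρ)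
      rfl rfl (fun m => ?_) (fun m => ?_) d x).trans ?_
    · change H0mk _ _ = TN.I.map 0 (H0mk _ m)
      rw [map_H0mk]; rfl
    · change H0mk _ _ = TN.Q.map 0 (H0mk _ m)
      rw [map_H0mk]; rfl
    · exact (congrArg (A.δ d) hx).trans (map_zero _)

end LHS
end GH

namespace GH

variable {k : Type} [CommRing k]
  {G G' G'' : Type} [Group G] [Group G'] [Group G'']
  {M M' M'' : Type} [AddCommGroup M] [AddCommGroup M'] [AddCommGroup M'']
  [Module k M] [Module k M'] [Module k M'']

lemma H_finite [Finite G] (n : ℕ) : ∀ {M : Type} [AddCommGroup M] [Module k M] [Finite M]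
    (ρ : Representation k G M), Finite (H ρ n) := by
  induction n with
  | zero =>
    intro M _ _ _ ρ
    exact Finite.of_surjective _ (H0mk_surjective ρ)
  | succ n ih =>
    intro M _ _ _ ρ
    have : Finite (G →₀ M) := Finite.of_injective (fun f : G →₀ M => (f : G → M))
      DFunLike.coe_injective
    have := ih (Omega ρ)
    exact Finite.of_injective _ (omega_δ_inj ρ n)

/-- Trivial representation. -/
def triv (k G M : Type) [CommRing k] [Group G] [AddCommGroup M] [Module k M] :
    Representation k G M := 1

@[simp] lemma triv_apply (g : G) (m : M) : triv k G M g m = m := rfl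

lemma H_triv {k : Type} [Field k] {M : Type} [AddCommGroup M] [Module k M] [Finite M]
    (ρ : Representation k G M) (hρ : ∀ g m, ρ g m = m) (n : ℕ)
    (h : Subsingleton (H (triv k G k) n)) : Subsingleton (H ρ n) := by
  let E (f : M →ₗ[k] M) : PHom ρ ρ := PHom.mk₁ f (fun g m => by rw [hρ, hρ])
  let L : (M →ₗ[k] M) →+ (H ρ n →ₗ[k] H ρ n) :=
    { toFun := fun f => (E f).map n
      map_zero' := PHom.map_zero (E 0) rfl n
      map_add' := fun f g => PHom.map_add (E f) (E g) (E (f + g)) rfl rfl rfl n }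
  have hfin : Module.Finite k M := Module.Finite.of_finite
  let b := Module.finBasis k M
  have h1 : (LinearMap.id : M →ₗ[k] M) =
      ∑ i, (LinearMap.toSpanSingleton k M (b i)) ∘ₗ (b.coord i) := by
    ext m
    simp [LinearMap.sum_apply, b.sum_repr]
  have h2 : L LinearMap.id = LinearMap.id := PHom.map_id n
  refine subsingleton_of_forall_eq 0 fun x => ?_
  have h3 : x = L LinearMap.id x := by rw [h2]; rfl
  rw [h3, h1, map_sum, LinearMap.sum_apply]
  refine Finset.sum_eq_zero fun i _ => ?_
  let u : PHom ρ (triv k G k) := PHom.mk₁ (b.coord i) (fun g m => by rw [hρ]; rfl)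
  let v : PHom (triv k G k) ρ := PHom.mk₁ (LinearMap.toSpanSingleton k M (b i))
    (fun g m => by rw [hρ]; rfl)
  change (v.comp u).map n x = 0
  rw [PHom.map_comp_apply, Subsingleton.elim (u.map n x) 0, map_zero]

section alg

variable {Λ : Type} [CommMonoid Λ]

lemma intertwine (ν : Representation k Λ M) (ν' : Representation k Λ M') (f : M →ₗ[k] M')
    (h : ∀ w m, f (ν w m) = ν' w (f m)) (a : MonoidAlgebra k Λ) (m : M) :
    f (ν.asAlgebraHom a m) = ν'.asAlgebraHom a (f m) := by
  induction a using MonoidAlgebra.induction_on with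
  | of w => simp [h]
  | add a b ha hb => simp [ha, hb]
  | smul r a ha => simp [ha]

lemma asAlgebraHom_mono {Λ' : Type} [CommMonoid Λ'] (ν : Representation k Λ' M) (t : Λ →* Λ')
    (a : MonoidAlgebra k Λ) :
    Representation.asAlgebraHom (ν.comp t) a = ν.asAlgebraHom (MonoidAlgebra.mapDomainAlgHom k k t a) := by
  induction a using MonoidAlgebra.induction_on with
  | of w => simp
  | add a b ha hb => rw [map_add, map_add, map_add, ha, hb]
  | smul r a ha => rw [map_smul, map_smul, map_smul, ha]

/-- The element `1 - [w]`. -/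
noncomputable def om (k : Type) [CommRing k] (w : Λ) : MonoidAlgebra k Λ := 1 - MonoidAlgebra.of k Λ w

lemma om_apply (ν : Representation k Λ M) (w : Λ) (m : M) :
    ν.asAlgebraHom (om k w) m = m - ν w m := by
  simp [om]

lemma om_idem (w : Λ) (hw : w * w = w) : om k w * om k w = om k w := by
  have : MonoidAlgebra.of k Λ w * MonoidAlgebra.of k Λ w = MonoidAlgebra.of k Λ w := by
    rw [← map_mul, hw]
  unfold om
  linear_combination this

lemma prod_om_idem {ι : Type} (s : Finset ι) (w : ι → Λ) (hw : ∀ i, w i * w i = w i) :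
    (∏ i ∈ s, om k (w i)) * (∏ i ∈ s, om k (w i)) = ∏ i ∈ s, om k (w i) := by
  rw [← Finset.prod_mul_distrib]
  exact Finset.prod_congr rfl fun i _ => om_idem _ (hw i)

end alg

section LP

variable {B : Type} [AddCommGroup B] {Λ : Type} [CommMonoid Λ] (φ : Λ →* AddMonoid.End B)

/-- Compatibility between an action of the group and an action of a monoid of operators. -/
def Compat (ρ : Representation k (Multiplicative B) M) (ν : Representation k Λ M) : Prop :=
  ∀ (w : Λ) (b : B) (m : M), ν w (ρ (.ofAdd b) m) = ρ (.ofAdd (φ w b)) (ν w m)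

variable {φ} {ρ : Representation k (Multiplicative B) M} {ν : Representation k Λ M}
  {ρ' : Representation k (Multiplicative B) M'} {ν' : Representation k Λ M'}

/-- The morphism of pairs attached to an operator. -/
def Compat.hom (h : Compat φ ρ ν) (w : Λ) : PHom ρ ρ where
  φ := AddMonoidHom.toMultiplicative (φ w)
  f := ν w
  comm g m := h w g.toAdd m

/-- Action of operators on homology. -/
noncomputable def Compat.rep (h : Compat φ ρ ν) (j : ℕ) : Representation k Λ (H ρ j) where
  toFun w := (h.hom w).map j
  map_one' := by
    change _ = LinearMap.id
    rw [← PHom.map_id (ρ := ρ)]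
    apply PHom.map_congr
    · simp [Compat.hom]; rfl
    · simp [Compat.hom]; rfl
  map_mul' q q' := by
    change _ = (h.hom q).map j ∘ₗ (h.hom q').map j
    rw [← PHom.map_comp]
    apply PHom.map_congr
    · simp [Compat.hom]; rfl
    · simp [Compat.hom]; rfl

lemma Compat.rep_apply (h : Compat φ ρ ν) (j : ℕ) (w : Λ) : h.rep j w = (h.hom w).map j := rfl

lemma Compat.map_mk₁ (h : Compat φ ρ ν) (h' : Compat φ ρ' ν') (f : M →ₗ[k] M')
    (hf : ∀ g m, f (ρ g m) = ρ' g (f m)) (hν : ∀ w m, f (ν w m) = ν' w (f m)) (j : ℕ)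
    (a : MonoidAlgebra k Λ) (x : H ρ j) :
    (PHom.mk₁ f hf).map j ((h.rep j).asAlgebraHom a x) =
      (h'.rep j).asAlgebraHom a ((PHom.mk₁ f hf).map j x) := by
  refine intertwine _ _ _ (fun w m => ?_) a x
  rw [Compat.rep_apply, Compat.rep_apply, ← PHom.map_comp_apply, ← PHom.map_comp_apply]
  congr 2
  exact PHom.ext rfl (LinearMap.ext fun m => hν w m)

variable {M₁ M₂ M₃ : Type} [AddCommGroup M₁] [AddCommGroup M₂] [AddCommGroup M₃]
    [Module k M₁] [Module k M₂] [Module k M₃]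
    {ρ₁ : Representation k (Multiplicative B) M₁} {ρ₂ : Representation k (Multiplicative B) M₂}
    {ρ₃ : Representation k (Multiplicative B) M₃}
    {ν₁ : Representation k Λ M₁} {ν₂ : Representation k Λ M₂} {ν₃ : Representation k Λ M₃}

lemma Compat.map_δ (T : SES ρ₁ ρ₂ ρ₃) (h₁ : Compat φ ρ₁ ν₁) (h₂ : Compat φ ρ₂ ν₂)
    (h₃ : Compat φ ρ₃ ν₃) (hi : ∀ w m, T.i (ν₁ w m) = ν₂ w (T.i m))
    (hq : ∀ w m, T.q (ν₂ w m) = ν₃ w (T.q m)) (j : ℕ) (a : MonoidAlgebra k Λ) (x : H ρ₃ (j + 1)) :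
    T.δ j ((h₃.rep (j + 1)).asAlgebraHom a x) = (h₁.rep j).asAlgebraHom a (T.δ j x) := by
  refine intertwine _ _ _ (fun w m => ?_) a x
  exact (SES.δ_nat (S := T) (S' := T) (h₁.hom w) (h₂.hom w) (h₃.hom w) rfl rfl
    (fun m => (hi w m).symm) (fun m => (hq w m).symm) j m).symm

end LP

end GH

namespace GH

variable {k : Type} [CommRing k]
  {M M' M'' : Type} [AddCommGroup M] [AddCommGroup M'] [AddCommGroup M'']
  [Module k M] [Module k M'] [Module k M'']

section K

variable {B : Type} [AddCommGroup B]

/-- Fixed points of an endomorphism. -/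
def FixS (e : AddMonoid.End B) : Type := {b : B // e b = b}

/-- Translation action through an idempotent. -/
@[reducible] def fixAct (e : AddMonoid.End B) (he : ∀ b, e (e b) = e b) :
    MulAction (Multiplicative B) (FixS e) where
  smul g s := ⟨e g.toAdd + s.1, by rw [map_add, he, s.2]⟩
  one_smul s := Subtype.ext (by change e 0 + s.1 = s.1; simp)
  mul_smul g h s := Subtype.ext (by
    change e (g.toAdd + h.toAdd) + s.1 = e g.toAdd + (e h.toAdd + s.1)
    rw [map_add, add_assoc])

variable {Λ : Type} [CommMonoid Λ] {φ : Λ →* AddMonoid.End B}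
  {ι : Type} [DecidableEq ι] {e : ι → AddMonoid.End B} {π : ι → Λ}
  (hπ : ∀ i b, φ (π i) b = b - e i b) (idem : ∀ i b, e i (e i b) = e i b)
  (orth : ∀ i j, i ≠ j → ∀ b, e i (e j b) = 0) (hcomm : ∀ w i b, φ w (e i b) = e i (φ w b))

include hπ idem orth hcomm in
lemma lemmaK (j : ℕ) : ∀ (s : Finset ι) {M : Type} [AddCommGroup M] [Module k M]
    {ρ : Representation k (Multiplicative B) M} {ν : Representation k Λ M} (h : Compat φ ρ ν)
    (_ : ∀ i ∈ s, (∀ m, ν (π i) m = m) ∧ ∀ b m, ρ (.ofAdd (e i b)) m = m) (_ : j + 1 ≤ s.card)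
    (x : H ρ j), (h.rep j).asAlgebraHom (∏ i ∈ s, om k (π i)) x = 0 := by
  induction j with
  | zero =>
    intro s M _ _ ρ ν h hs hc x
    obtain ⟨i, hi⟩ := Finset.card_pos.1 (by omega : 0 < s.card)
    rw [← Finset.mul_prod_erase s _ hi, map_mul, Module.End.mul_apply, om_apply, sub_eq_zero]
    obtain ⟨m, hm⟩ := H0mk_surjective ρ ((h.rep 0).asAlgebraHom (∏ i ∈ s.erase i, om k (π i)) x)
    rw [← hm, Compat.rep_apply, map_H0mk]
    exact congrArg _ ((hs i hi).1 m).symm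
  | succ j ih =>
    intro s M _ _ ρ ν h hs hc x
    obtain ⟨i, hi⟩ := Finset.card_pos.1 (by omega : 0 < s.card)
    rw [← Finset.mul_prod_erase s _ hi, map_mul, Module.End.mul_apply, om_apply, sub_eq_zero]
    set y := (h.rep (j + 1)).asAlgebraHom (∏ i ∈ s.erase i, om k (π i)) x with hy
    let _ := fixAct (e i) (idem i)
    have hsm (b : B) (s : FixS (e i)) : (Multiplicative.ofAdd b • s).1 = e i b + s.1 := rfl
    let ρE := Ind (FixS (e i)) ρ
    have : Nonempty (FixS (e i)) := ⟨⟨0, map_zero _⟩⟩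
    let a (w : Λ) : FixS (e i) → FixS (e i) := fun s => ⟨φ w s.1, by rw [← hcomm, s.2]⟩
    have ha (w : Λ) (g : Multiplicative B) (s : FixS (e i)) :
      a w (g • s) = (h.hom w).φ g • a w s := Subtype.ext (by
        change φ w (e i g.toAdd + s.1) = e i (φ w g.toAdd) + φ w s.1
        rw [map_add, hcomm])
    let νE : Representation k Λ (FixS (e i) →₀ M) :=
      { toFun := fun w => ((h.hom w).ind (a w) (ha w)).f
        map_one' := by
          apply Finsupp.lhom_ext; intro s m
          rw [PHom.ind_f_single]
          congr 1
          · exact Subtype.ext (by simp [a])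
          · simp [Compat.hom]
        map_mul' := fun w w' => by
          apply Finsupp.lhom_ext; intro s m
          rw [Module.End.mul_apply, PHom.ind_f_single, PHom.ind_f_single, PHom.ind_f_single]
          congr 1
          · exact Subtype.ext (by simp [a])
          · simp [Compat.hom] }
    have hνE (w s m) : νE w (Finsupp.single s m) = Finsupp.single (a w s) (ν w m) :=
      PHom.ind_f_single (h.hom w) (a w) (ha w) s m
    have hE : Compat φ ρE νE := fun w b m => ((h.hom w).ind (a w) (ha w)).comm (.ofAdd b) m
    let T : SES _ ρE ρ := SES.ofSurj (eps k (FixS (e i))) (eps_comm _ ρ) (eps_surj _)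
    have hqν (w m) : T.q (νE w m) = ν w (T.q m) := by
      revert m
      refine LinearMap.congr_fun (f := T.q ∘ₗ νE w) (g := ν w ∘ₗ T.q) ?_
      apply Finsupp.lhom_ext; intro s m
      simp only [LinearMap.comp_apply, hνE]
      exact (eps_single (k := k) _ _ _).trans (congrArg _ (eps_single (k := k) _ _ _).symm)
    let ν' : Representation k Λ (LinearMap.ker (eps k (FixS (e i)) : (FixS (e i) →₀ M) →ₗ[k] M)) :=
      { toFun := fun w => (νE w).restrict (fun m hm => by
          have : T.q (νE w m) = 0 := by rw [hqν, show T.q m = 0 from hm, map_zero]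
          exact this)
        map_one' := by ext1 m; exact Subtype.ext (by simp)
        map_mul' := fun w w' => by ext1 m; exact Subtype.ext (LinearMap.congr_fun (map_mul νE w w') m.1) }
    have h' : Compat φ (subRep ρE (LinearMap.ker (eps k (FixS (e i)) : (FixS (e i) →₀ M) →ₗ[k] M))
        (fun g m hm => by
          rw [LinearMap.mem_ker] at hm ⊢; rw [eps_comm, hm, map_zero])) ν' := fun w b m => Subtype.ext (hE w b m.1)
    have hδ : T.δ j y = 0 := by
      rw [hy, Compat.map_δ T h' hE h (fun _ _ => rfl) hqν]
      apply ih (s.erase i) h'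
      · intro l hl
        have hls := Finset.mem_of_mem_erase hl
        have hli := Finset.ne_of_mem_erase hl
        constructor
        · intro m
          refine Subtype.ext ?_
          change νE (π l) m.1 = m.1
          generalize m.1 = m
          revert m
          refine LinearMap.congr_fun (f := νE (π l)) (g := LinearMap.id) ?_
          apply Finsupp.lhom_ext; intro s m
          rw [hνE, (hs l hls).1]
          congr 1
          refine Subtype.ext ?_
          change φ (π l) s.1 = s.1
          rw [hπ, ← s.2, orth l i hli, sub_zero]
        · intro b m
          refine Subtype.ext ?_
          change ρE (.ofAdd (e l b)) m.1 = m.1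
          generalize m.1 = m
          revert m
          refine LinearMap.congr_fun (f := ρE (.ofAdd (e l b))) (g := LinearMap.id) ?_
          apply Finsupp.lhom_ext; intro s m
          simp only [ρE]
          rw [Ind_single, (hs l hls).2]
          congr 1
          refine Subtype.ext ?_
          change e i (e l b) + s.1 = s.1
          rw [orth i l hli.symm, zero_add]
      · rw [Finset.card_erase_of_mem hi]; omega
    obtain ⟨z, hz⟩ := (T.exact₃ j y).1 hδ
    let ιC : Multiplicative (AddMonoidHom.ker (e i)) →* Multiplicative B :=
      AddMonoidHom.toMultiplicative (AddSubgroup.subtype _)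
    have hsh := shap_bijective (k := k) (S := FixS (e i)) ⟨0, map_zero _⟩ ιC
      (fun c => Subtype.ext (by
        change e i (c.toAdd.1) + 0 = 0
        rw [add_zero]; exact c.toAdd.2)) (fun c c' hc => Subtype.ext hc)
      (fun s => ⟨.ofAdd s.1, Subtype.ext (by
        change e i s.1 + 0 = s.1
        rw [add_zero, s.2])⟩)
      (fun g hg => ⟨.ofAdd ⟨g.toAdd, by
        have := congrArg Subtype.val hg
        change e i g.toAdd + 0 = 0 at this
        rwa [add_zero] at this⟩, rfl⟩) (j + 1) ρ
    obtain ⟨c, rfl⟩ := hsh.2 z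
    rw [← hz, Compat.rep_apply, ← PHom.map_comp_apply, ← PHom.map_comp_apply]
    congr 2
    refine PHom.ext ?_ ?_
    · ext c
      change c.1 = φ (π i) c.1
      rw [hπ, show e i c.1 = 0 from c.2, sub_zero]
    · ext m
      exact ((hs i hi).1 _).symm

end K

section comb
open scoped Classical in
lemma comb {R ι : Type} [CommRing R] (J : Ideal R) (a b : ι → R) (z : R) (j N : ℕ)
    (hx : ∀ t : Finset ι, j + 1 ≤ t.card → ∏ i ∈ t, (1 - a i) ∈ J)
    (hy : ∀ t : Finset ι, N ≤ t.card → z * ∏ i ∈ t, (1 - b i) ∈ J) (t : Finset ι)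
    (ht : N + j ≤ t.card) : z * ∏ i ∈ t, (1 - a i * b i) ∈ J := by
  have key : ∀ t t₁ t₂ : Finset ι, Disjoint t t₁ → Disjoint t t₂ → 
      N + j ≤ t.card + t₁.card + t₂.card →
      z * (∏ i ∈ t₁, (1 - a i)) * (∏ i ∈ t₂, (1 - b i)) * ∏ i ∈ t, (1 - a i * b i) ∈ J := by
    intro t
    induction t using Finset.induction_on with
    | empty =>
      intro t₁ t₂ _ _ h
      rw [Finset.card_empty] at h
      rw [Finset.prod_empty, mul_one]
      by_cases h1 : j + 1 ≤ t₁.card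
      · have := J.mul_mem_left (z * ∏ i ∈ t₂, (1 - b i)) (hx t₁ h1)
        convert this using 1; ring
      · have := J.mul_mem_left (∏ i ∈ t₁, (1 - a i)) (hy t₂ (by omega))
        convert this using 1; ring
    | insert i t hi ih =>
      intro t₁ t₂ h1 h2 h
      rw [Finset.disjoint_insert_left] at h1 h2
      rw [Finset.card_insert_of_notMem hi] at h
      have e1 := ih (insert i t₁) t₂ (by rw [Finset.disjoint_insert_right]; exact ⟨hi, h1.2⟩) h2.2
        (by rw [Finset.card_insert_of_notMem h1.1]; omega)
      have e2 := ih t₁ (insert i t₂) h1.2 (by rw [Finset.disjoint_insert_right]; exact ⟨hi, h2.2⟩)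
        (by rw [Finset.card_insert_of_notMem h2.1]; omega)
      rw [Finset.prod_insert h1.1] at e1
      rw [Finset.prod_insert h2.1] at e2
      rw [Finset.prod_insert hi]
      have := J.add_mem e1 (J.mul_mem_left (a i) e2)
      convert this using 1; ring
  have := key t ∅ ∅ (by simp) (by simp) (by simpa using ht)
  simpa using this
end comb
end GH

namespace GH

section additivity
variable {k : Type} [CommRing k] {M : Type} [AddCommGroup M] [Module k M]
  {B B' B'' : Type} [AddCommGroup B] [AddCommGroup B'] [AddCommGroup B'']

variable (k M) in
/-- Morphism of trivial pairs. -/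
def tm (f : B →+ B') : PHom (triv k (Multiplicative B) M) (triv k (Multiplicative B') M) :=
  ⟨AddMonoidHom.toMultiplicative f, LinearMap.id, fun _ _ => rfl⟩

lemma tm_comp (g : B' →+ B'') (f : B →+ B') : tm k M (g.comp f) = (tm k M g).comp (tm k M f) := rfl

lemma tm_comp_apply (g : B' →+ B'') (f : B →+ B') (n : ℕ) (x) :
    (tm k M (g.comp f)).map n x = (tm k M g).map n ((tm k M f).map n x) := by
  rw [tm_comp, PHom.map_comp_apply]

lemma tm_zero (n : ℕ) : (tm k M (0 : B →+ B')).map (n + 1) = 0 := by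
  have h1 : (0 : B →+ B') = (0 : PUnit.{1} →+ B').comp (0 : B →+ PUnit.{1}) := rfl
  have : Subsingleton (H (triv k (Multiplicative PUnit.{1}) M) (n + 1)) := by
    let _ : Fintype (Multiplicative PUnit.{1}) := inferInstanceAs (Fintype PUnit.{1})
    refine H_coprime ?_ _ n
    have : Fintype.card (Multiplicative PUnit.{1}) = 1 := rfl
    rw [this]; simp
  ext x
  rw [h1, tm_comp_apply, Subsingleton.elim ((tm k M (0 : B →+ PUnit.{1})).map (n + 1) x) 0, map_zero]
  rfl

/-- Scaling of the two factors of a product. -/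
def sphi (B : Type) [AddCommGroup B] : ℤ × ℤ →* AddMonoid.End (B × B) where
  toFun c := AddMonoidHom.prodMap (c.1 • AddMonoidHom.id B) (c.2 • AddMonoidHom.id B)
  map_one' := AddMonoidHom.ext fun x => Prod.ext (one_smul ℤ x.1) (one_smul ℤ x.2)
  map_mul' c d := AddMonoidHom.ext fun x => Prod.ext (mul_smul c.1 d.1 x.1) (mul_smul c.2 d.2 x.2)

lemma sphi_apply (B : Type) [AddCommGroup B] (c : ℤ × ℤ) (x : B × B) :
    sphi B c x = (c.1 • x.1, c.2 • x.2) := rfl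

lemma tm_add_prod (x : H (triv k (Multiplicative (B × B)) M) 1) :
    x = (tm k M ((AddMonoidHom.inl B B).comp (AddMonoidHom.fst B B))).map 1 x +
     (tm k M ((AddMonoidHom.inr B B).comp (AddMonoidHom.snd B B))).map 1 x := by
  let φ := sphi B
  let e : Bool → AddMonoid.End (B × B) := fun i => bif i then φ (1, 0) else φ (0, 1)
  let π : Bool → ℤ × ℤ := fun i => bif i then (0, 1) else (1, 0)
  have hc : Compat φ (triv k (Multiplicative (B × B)) M) 1 := fun _ _ _ => rfl
  have := lemmaK (k := k) (φ := φ) (e := e) (π := π) (by rintro (_ | _) ⟨a, b⟩ <;> simp [e, π, φ, sphi_apply])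
    (by rintro (_ | _) ⟨a, b⟩ <;> simp [e, φ, sphi_apply])
    (by rintro (_ | _) (_ | _) h ⟨a, b⟩ <;> simp [e, φ, sphi_apply] at h ⊢)
    (by rintro ⟨c, d⟩ (_ | _) ⟨a, b⟩ <;> simp [e, φ, sphi_apply]) 1 Finset.univ hc
    (fun i _ => ⟨fun m => rfl, fun b m => rfl⟩) (by simp) x
  rw [Fintype.prod_bool, map_mul, Module.End.mul_apply, om_apply, om_apply, map_sub,
    ← Module.End.mul_apply, ← map_mul] at this
  simp only [π, cond_true, cond_false, Prod.mk_mul_mk, mul_zero, zero_mul, mul_one] at this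
  have h0 : hc.rep 1 (0, 0) = 0 := by
    rw [← tm_zero (k := k) (M := M) (B := B × B) (B' := B × B)]
    apply PHom.map_congr
    · simp only [Compat.hom, tm]
      congr 1
      ext x
      · exact zero_smul ℤ x.1
      · exact zero_smul ℤ x.2
    · rfl
  have h1 : hc.rep 1 (1, 0) = (tm k M ((AddMonoidHom.inl B B).comp (AddMonoidHom.fst B B))).map 1 := by
    apply PHom.map_congr
    · simp only [Compat.hom, tm]
      congr 1
      ext x
      · exact one_smul ℤ x.1
      · exact zero_smul ℤ x.2
    · rfl
  have h2 : hc.rep 1 (0, 1) = (tm k M ((AddMonoidHom.inr B B).comp (AddMonoidHom.snd B B))).map 1 := by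
    apply PHom.map_congr
    · simp only [Compat.hom, tm]
      congr 1
      ext x
      · exact zero_smul ℤ x.1
      · exact one_smul ℤ x.2
    · rfl
  rw [h0, h1, h2] at this
  simp only [LinearMap.zero_apply, sub_zero] at this
  rw [sub_sub, sub_eq_zero] at this
  exact this

lemma tm_add (f g : B →+ B') : (tm k M (f + g)).map 1 = (tm k M f).map 1 + (tm k M g).map 1 := by
  ext x
  have h : f + g = ((AddMonoidHom.id B').coprod (AddMonoidHom.id B')).comp (f.prod g) := by
    ext b; simp
  rw [h, tm_comp_apply, tm_add_prod ((tm k M (f.prod g)).map 1 x), map_add, ← tm_comp_apply,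
    ← tm_comp_apply, ← tm_comp_apply, ← tm_comp_apply, LinearMap.add_apply]
  congr 3
  · congr 1; ext b; simp
  · congr 1; ext b; simp

lemma tm_sum {α : Type} (s : Finset α) (f : α → (B →+ B')) :
    (tm k M (∑ a ∈ s, f a)).map 1 = ∑ a ∈ s, (tm k M (f a)).map 1 := by
  let L : (B →+ B') →+ (H (triv k (Multiplicative B) M) 1 →ₗ[k] H (triv k (Multiplicative B') M) 1) :=
    { toFun := fun f => (tm k M f).map 1
      map_zero' := tm_zero 0
      map_add' := tm_add }
  exact map_sum L f s

end additivity

variable {p : ℕ} [Fact p.Prime]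

lemma exists_H0_ne {G : Type} [Group G] [Finite G] (hG : IsPGroup p G) {M : Type} [AddCommGroup M]
    [Module (ZMod p) M] [Finite M] [Nontrivial M] (ρ : Representation (ZMod p) G M) :
    ∃ m, H0mk ρ m ≠ 0 := by
  let D := M →ₗ[ZMod p] ZMod p
  have : Finite D := Finite.of_injective (fun f : D => (f : M → ZMod p)) DFunLike.coe_injective
  have hDn : Nontrivial D := inferInstanceAs (Nontrivial (Module.Dual (ZMod p) M))
  let _ : MulAction G D :=
    { smul := fun g f => f ∘ₗ ρ g⁻¹
      one_smul := fun f => by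
        change f ∘ₗ ρ 1⁻¹ = f
        simp; rfl
      mul_smul := fun g h f => by
        change f ∘ₗ ρ (g * h)⁻¹ = (f ∘ₗ ρ h⁻¹) ∘ₗ ρ g⁻¹
        rw [mul_inv_rev, map_mul]; rfl }
  have hcard : p ∣ Nat.card D := by
    obtain ⟨x, hx⟩ := exists_ne (0 : D)
    have h1 : addOrderOf x = p := addOrderOf_eq_prime (by
      rw [← Nat.cast_smul_eq_nsmul (ZMod p)]; simp) hx
    rw [← h1]; exact addOrderOf_dvd_natCard x
  obtain ⟨f, hf, hf0⟩ := hG.exists_fixed_point_of_prime_dvd_card_of_fixed_point D hcard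
    (a := 0) (fun g => by change (0 : D) ∘ₗ _ = 0; rfl)
  by_contra! hm
  apply hf0
  symm
  ext m
  refine H0_lift ρ f (fun g m => ?_) (hm m)
  have := hf g⁻¹
  change f ∘ₗ ρ (g⁻¹)⁻¹ = f at this
  rw [inv_inv] at this
  exact LinearMap.congr_fun this m

section deviss

variable {B : Type} [AddCommGroup B] [Finite B] {Λ : Type} [CommMonoid Λ] {φ : Λ →* AddMonoid.End B}

lemma deviss (hB : IsPGroup p (Multiplicative B)) (Θ : Set (MonoidAlgebra (ZMod p) Λ))
    (θ : MonoidAlgebra (ZMod p) Λ) (hθ : θ * θ = θ) (j : ℕ)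
    (htriv : ∀ {M : Type} [AddCommGroup M] [Module (ZMod p) M] [Finite M]
      {ρ : Representation (ZMod p) (Multiplicative B) M} {ν : Representation (ZMod p) Λ M}
      (h : Compat φ ρ ν), (∀ g m, ρ g m = m) → (∀ a ∈ Θ, ∀ m, ν.asAlgebraHom a m = 0) →
      ∀ x, (h.rep j).asAlgebraHom θ x = 0) (n : ℕ) :
    ∀ {M : Type} [AddCommGroup M] [Module (ZMod p) M] [Finite M]
      {ρ : Representation (ZMod p) (Multiplicative B) M} {ν : Representation (ZMod p) Λ M}
      (h : Compat φ ρ ν), Nat.card M = n → (∀ a ∈ Θ, ∀ m, ν.asAlgebraHom a m = 0) →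
      ∀ x, (h.rep j).asAlgebraHom θ x = 0 := by
  induction n using Nat.strong_induction_on with
  | _ n ih =>
    intro M _ _ _ ρ ν h hM hΘ x
    rcases subsingleton_or_nontrivial M with hs | hn
    · exact htriv h (fun _ _ => Subsingleton.elim _ _) hΘ x
    have hN1 : ∀ g, ∀ m ∈ aug ρ, ρ g m ∈ aug ρ := fun g m hm => by
      rw [← H0mk_eq_zero_iff] at hm ⊢; rw [H0mk_smul, hm]
    have hN2 : ∀ w, ∀ m ∈ aug ρ, ν w m ∈ aug ρ := fun w m hm => by
      rw [← H0mk_eq_zero_iff] at hm ⊢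
      have := map_H0mk (h.hom w) m
      rw [hm, map_zero] at this
      exact this.symm
    let T := SES.ofSub ρ (aug ρ) hN1
    have h1 : Compat φ (subRep ρ (aug ρ) hN1) (subRep ν (aug ρ) hN2) :=
      fun w b m => Subtype.ext (h w b m.1)
    have h3 : Compat φ (quotRep ρ (aug ρ) hN1) (quotRep ν (aug ρ) hN2) := fun w b m => by
      obtain ⟨m, rfl⟩ := (aug ρ).mkQ_surjective m
      simp only [quotRep_mk]
      rw [h w b m]
    have hlt : Nat.card (aug ρ) < n := by
      rw [← hM]
      obtain ⟨m, hm⟩ := exists_H0_ne hB ρ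
      refine Set.Finite.card_lt_card (s := (aug ρ : Set M)) (t := Set.univ) (Set.toFinite _)
        ?_ |>.trans_eq (by simp)
      rw [Set.ssubset_univ_iff]
      intro hu
      apply hm
      rw [H0mk_eq_zero_iff]
      change m ∈ (aug ρ : Set M)
      rw [hu]; trivial
    have k1 : ∀ y, (h1.rep j).asAlgebraHom θ y = 0 := ih _ hlt h1 rfl (fun a ha m => Subtype.ext (by
      have := intertwine (subRep ν (aug ρ) hN2) ν (aug ρ).subtype (fun _ _ => rfl) a m
      rw [hΘ a ha] at this
      exact this))
    have hfq : Finite (M ⧸ aug ρ) := Finite.of_surjective _ (aug ρ).mkQ_surjective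
    have k3 : ∀ y, (h3.rep j).asAlgebraHom θ y = 0 := htriv h3 (fun g m => by
      obtain ⟨m, rfl⟩ := (aug ρ).mkQ_surjective m
      rw [quotRep_mk, ← sub_eq_zero, ← map_sub]
      simp only [Submodule.mkQ_apply, Submodule.Quotient.mk_eq_zero]
      rw [← H0mk_eq_zero_iff, map_sub, H0mk_smul, sub_self]) (fun a ha m => by
      obtain ⟨m, rfl⟩ := (aug ρ).mkQ_surjective m
      have := intertwine ν (quotRep ν (aug ρ) hN2) (aug ρ).mkQ (fun _ _ => rfl) a m
      rw [hΘ a ha, map_zero] at this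
      exact this.symm)
    have e1 := Compat.map_mk₁ h h3 (aug ρ).mkQ (fun _ _ => rfl) (fun _ _ => rfl) j θ x
    rw [k3] at e1
    obtain ⟨y, hy⟩ := (T.exact₂ j _).1 e1
    have e2 := Compat.map_mk₁ h1 h (aug ρ).subtype (fun _ _ => rfl) (fun _ _ => rfl) j θ y
    rw [k1, map_zero] at e2
    rw [← hθ, map_mul, Module.End.mul_apply, ← hy]
    exact e2.symm

end deviss

end GH

namespace GH

section trivcase
variable {p : ℕ} [Fact p.Prime] {B : Type} [AddCommGroup B] {Λ : Type} [CommMonoid Λ]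
  {φ : Λ →* AddMonoid.End B} {M : Type} [AddCommGroup M] [Module (ZMod p) M]

/-- Morphism of trivial pairs attached to a map of coefficients. -/
def cm (G : Type) [Group G] (f : M →ₗ[ZMod p] M) : PHom (triv (ZMod p) G M) (triv (ZMod p) G M) :=
  PHom.mk₁ f (fun _ _ => rfl)

lemma cm_add (G : Type) [Group G] (f g : M →ₗ[ZMod p] M) (j : ℕ) :
    (cm G (f + g)).map j = (cm G f).map j + (cm G g).map j :=
  PHom.map_add (cm G f) (cm G g) (cm G (f + g)) rfl rfl rfl j

/-- For a trivial group action, homology is additive in the coefficients. -/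
noncomputable def coefL (B : Type) [AddCommGroup B] (j : ℕ) : (M →ₗ[ZMod p] M) →+
    (H (triv (ZMod p) (Multiplicative B) M) j →ₗ[ZMod p] H (triv (ZMod p) (Multiplicative B) M) j) where
  toFun f := (cm (Multiplicative B) f).map j
  map_zero' := PHom.map_zero _ rfl j
  map_add' f g := cm_add _ f g j

lemma rep_coef {ν : Representation (ZMod p) Λ M}
    (h : Compat φ (triv (ZMod p) (Multiplicative B) M) ν) (t : Λ →* Λ) (j : ℕ)
    (hφ : ∀ w, φ (t w) = 1) (a : MonoidAlgebra (ZMod p) Λ) :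
    (h.rep j).asAlgebraHom (MonoidAlgebra.mapDomainAlgHom (ZMod p) (ZMod p) t a) =
      coefL B j (ν.asAlgebraHom (MonoidAlgebra.mapDomainAlgHom (ZMod p) (ZMod p) t a)) := by
  rw [← asAlgebraHom_mono, ← asAlgebraHom_mono]
  induction a using MonoidAlgebra.induction_on with
  | of w =>
    simp only [Representation.asAlgebraHom_of]
    change (h.hom (t w)).map j = _
    refine PHom.map_congr (u := h.hom (t w)) (v := cm (Multiplicative B) (ν (t w))) ?_ rfl j
    simp only [Compat.hom, hφ]
    rfl
  | add a b ha hb => rw [map_add, map_add, map_add, ha, hb]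
  | smul r a ha =>
    rw [map_smul, map_smul, ha]
    exact (ZMod.map_smul (coefL (p := p) (M := M) B j) r _).symm

variable {ι : Type} [DecidableEq ι] {π : ι → Λ} {e : ι → AddMonoid.End B}

lemma mapDomain_om {Λ' : Type} [CommMonoid Λ'] (t : Λ →* Λ') (w : Λ) :
    MonoidAlgebra.mapDomainAlgHom (ZMod p) (ZMod p) t (om (ZMod p) w) = om (ZMod p) (t w) := by
  rw [om, map_sub, map_one, om]
  simp

lemma mapDomain_prod_om {Λ' : Type} [CommMonoid Λ'] (t : Λ →* Λ') (s : Finset ι) (π : ι → Λ) :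
    MonoidAlgebra.mapDomainAlgHom (ZMod p) (ZMod p) t (∏ i ∈ s, om (ZMod p) (π i)) =
      ∏ i ∈ s, om (ZMod p) (t (π i)) := by
  rw [map_prod]
  exact Finset.prod_congr rfl fun i _ => mapDomain_om t _

/-- Main combinatorial lemma for the trivial action, with a general multiplier `z`. -/
lemma triv_gen (hπ : ∀ i b, φ (π i) b = b - e i b) (idem : ∀ i b, e i (e i b) = e i b)
    (orth : ∀ i j, i ≠ j → ∀ b, e i (e j b) = 0)
    (hcomm : ∀ w i b, φ w (e i b) = e i (φ w b))
    {ρ : Representation (ZMod p) (Multiplicative B) M}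
    {ν : Representation (ZMod p) Λ M} (h : Compat φ ρ ν) (hρ : ∀ g m, ρ g m = m) (j N : ℕ)
    (z : MonoidAlgebra (ZMod p) Λ)
    (hy : ∀ (h2 : Compat (φ.comp (MonoidHom.fst Λ Λ)) (triv (ZMod p) (Multiplicative B) M)
      (ν.comp (MonoidHom.snd Λ Λ))) (t : Finset ι), N ≤ t.card →
      (h2.rep j).asAlgebraHom (MonoidAlgebra.mapDomainAlgHom (ZMod p) (ZMod p)
        ((MonoidHom.id Λ).prod (MonoidHom.id Λ)) z * ∏ i ∈ t, om (ZMod p) ((1 : Λ), π i)) = 0)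
    (t : Finset ι) (ht : N + j ≤ t.card) (x : H ρ j) :
    (h.rep j).asAlgebraHom (z * ∏ i ∈ t, om (ZMod p) (π i)) x = 0 := by
  obtain rfl : ρ = triv (ZMod p) (Multiplicative B) M := by
    ext g m; exact hρ g m
  have h2 : Compat (φ.comp (MonoidHom.fst Λ Λ)) (triv (ZMod p) (Multiplicative B) M)
      (ν.comp (MonoidHom.snd Λ Λ)) := fun _ _ _ => rfl
  have h3 : h.rep j = (h2.rep j).comp ((MonoidHom.id Λ).prod (MonoidHom.id Λ)) := rfl
  rw [h3]
  erw [asAlgebraHom_mono]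
  rw [map_mul, mapDomain_prod_om]
  let J := RingHom.ker (h2.rep j).asAlgebraHom.toRingHom
  have := comb J (fun i => MonoidAlgebra.of (ZMod p) (Λ × Λ) (π i, 1))
    (fun i => MonoidAlgebra.of (ZMod p) (Λ × Λ) (1, π i))
    (MonoidAlgebra.mapDomainAlgHom (ZMod p) (ZMod p) ((MonoidHom.id Λ).prod (MonoidHom.id Λ)) z)
    j N ?_ (fun t ht => hy h2 t ht) t ht
  · have h4 : ∀ i, (1 - MonoidAlgebra.of (ZMod p) (Λ × Λ) (π i, 1) *
        MonoidAlgebra.of (ZMod p) (Λ × Λ) (1, π i)) =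
        om (ZMod p) (((MonoidHom.id Λ).prod (MonoidHom.id Λ)) (π i)) := fun i => by
      rw [← map_mul, Prod.mk_mul_mk, one_mul, mul_one]; rfl
    simp only [h4] at this
    exact LinearMap.congr_fun (RingHom.mem_ker.1 this) x
  · intro t ht
    refine LinearMap.ext fun x => ?_
    exact lemmaK (k := ZMod p) (π := fun i => (π i, (1 : Λ))) (e := e) hπ idem orth
      (fun w i b => hcomm w.1 i b) j t h2
      (fun i _ => ⟨fun m => by simp, fun b m => rfl⟩) ht x

lemma triv1 (hπ : ∀ i b, φ (π i) b = b - e i b) (idem : ∀ i b, e i (e i b) = e i b)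
    (orth : ∀ i j, i ≠ j → ∀ b, e i (e j b) = 0)
    (hcomm : ∀ w i b, φ w (e i b) = e i (φ w b))
    {ρ : Representation (ZMod p) (Multiplicative B) M}
    {ν : Representation (ZMod p) Λ M} (h : Compat φ ρ ν) (hρ : ∀ g m, ρ g m = m) (j N : ℕ)
    (hN : ∀ t : Finset ι, N ≤ t.card → ν.asAlgebraHom (∏ i ∈ t, om (ZMod p) (π i)) = 0)
    (t : Finset ι) (ht : N + j ≤ t.card) (x : H ρ j) :
    (h.rep j).asAlgebraHom (∏ i ∈ t, om (ZMod p) (π i)) x = 0 := by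
  rw [← one_mul (∏ i ∈ t, om (ZMod p) (π i))]
  refine triv_gen hπ idem orth hcomm h hρ j N 1 (fun h2 t ht => ?_) t ht x
  rw [map_one, one_mul]
  have := rep_coef h2 ((MonoidHom.inr Λ Λ).comp (MonoidHom.snd Λ Λ)) j (fun w => by simp)
    (∏ i ∈ t, om (ZMod p) ((1 : Λ), π i))
  rw [mapDomain_prod_om] at this
  refine this.trans ?_
  have h5 := asAlgebraHom_mono ν (MonoidHom.snd Λ Λ) (∏ i ∈ t, om (ZMod p) ((1 : Λ), π i))
  rw [mapDomain_prod_om] at h5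
  refine (congrArg (coefL B j) (h5.trans (hN t ht))).trans (map_zero _)

lemma triv2 (hπ : ∀ i b, φ (π i) b = b - e i b) (idem : ∀ i b, e i (e i b) = e i b)
    (orth : ∀ i j, i ≠ j → ∀ b, e i (e j b) = 0)
    (hcomm : ∀ w i b, φ w (e i b) = e i (φ w b))
    {ρ : Representation (ZMod p) (Multiplicative B) M}
    {ν : Representation (ZMod p) Λ M} (h : Compat φ ρ ν) (hρ : ∀ g m, ρ g m = m) (N : ℕ)
    {S : Type} [Fintype S] (σ : S → Λ) (hσ : ∀ b, ∑ s, φ (σ s) b = 0)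
    (hN : ∀ t : Finset ι, N ≤ t.card → ∀ s,
      ν.asAlgebraHom (om (ZMod p) (σ s) * ∏ i ∈ t, om (ZMod p) (π i)) = 0)
    (t : Finset ι) (ht : N + 1 ≤ t.card) (x : H ρ 1) :
    (h.rep 1).asAlgebraHom ((∑ s, MonoidAlgebra.of (ZMod p) Λ (σ s)) *
      ∏ i ∈ t, om (ZMod p) (π i)) x = 0 := by
  refine triv_gen hπ idem orth hcomm h hρ 1 N _ (fun h2 t ht => ?_) t ht x
  have key : ∀ s, (h2.rep 1).asAlgebraHom
      (om (ZMod p) ((1 : Λ), σ s) * ∏ i ∈ t, om (ZMod p) ((1 : Λ), π i)) = 0 := fun s => by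
    have := rep_coef h2 ((MonoidHom.inr Λ Λ).comp (MonoidHom.snd Λ Λ)) 1 (fun w => by simp)
      (om (ZMod p) ((1 : Λ), σ s) * ∏ i ∈ t, om (ZMod p) ((1 : Λ), π i))
    rw [map_mul, mapDomain_prod_om, mapDomain_om] at this
    refine this.trans ?_
    have h5 := asAlgebraHom_mono ν (MonoidHom.snd Λ Λ)
      (om (ZMod p) ((1 : Λ), σ s) * ∏ i ∈ t, om (ZMod p) ((1 : Λ), π i))
    rw [map_mul (MonoidAlgebra.mapDomainAlgHom (ZMod p) (ZMod p) (MonoidHom.snd Λ Λ)),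
      mapDomain_prod_om, mapDomain_om] at h5
    exact (congrArg (coefL B 1) (h5.trans (hN t ht s))).trans (map_zero _)
  have h6 : MonoidAlgebra.mapDomainAlgHom (ZMod p) (ZMod p)
        ((MonoidHom.id Λ).prod (MonoidHom.id Λ)) (∑ s, MonoidAlgebra.of (ZMod p) Λ (σ s)) *
        ∏ i ∈ t, om (ZMod p) ((1 : Λ), π i) =
      (∑ s, MonoidAlgebra.of (ZMod p) (Λ × Λ) (σ s, 1)) * (∏ i ∈ t, om (ZMod p) ((1 : Λ), π i)) -
      ∑ s, MonoidAlgebra.of (ZMod p) (Λ × Λ) (σ s, 1) *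
        (om (ZMod p) ((1 : Λ), σ s) * ∏ i ∈ t, om (ZMod p) ((1 : Λ), π i)) := by
    rw [map_sum, Finset.sum_mul, Finset.sum_mul, ← Finset.sum_sub_distrib]
    refine Finset.sum_congr rfl fun s _ => ?_
    have : MonoidAlgebra.mapDomainAlgHom (ZMod p) (ZMod p)
        ((MonoidHom.id Λ).prod (MonoidHom.id Λ)) (MonoidAlgebra.of (ZMod p) Λ (σ s)) =
        MonoidAlgebra.of (ZMod p) (Λ × Λ) (σ s, 1) * MonoidAlgebra.of (ZMod p) (Λ × Λ) (1, σ s) := by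
      rw [← map_mul, Prod.mk_mul_mk, one_mul, mul_one]
      simp
    rw [this, om]
    ring
  rw [h6, map_sub, map_sum]
  have h7 : ∀ s, (h2.rep 1).asAlgebraHom (MonoidAlgebra.of (ZMod p) (Λ × Λ) (σ s, 1) *
        (om (ZMod p) ((1 : Λ), σ s) * ∏ i ∈ t, om (ZMod p) ((1 : Λ), π i))) = 0 := fun s => by
    rw [map_mul, key, mul_zero]
  simp only [h7, Finset.sum_const_zero, sub_zero]
  rw [map_mul]
  have h8 : (h2.rep 1).asAlgebraHom (∑ s, MonoidAlgebra.of (ZMod p) (Λ × Λ) (σ s, 1)) = 0 := by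
    rw [map_sum]
    let ψ : S → (B →+ B) := fun s => φ (σ s)
    have := tm_sum (k := ZMod p) (M := M) Finset.univ ψ
    have h0 : ∑ s, ψ s = 0 := by
      ext b
      rw [AddMonoidHom.finsetSum_apply]
      exact hσ b
    rw [h0, tm_zero] at this
    rw [this]
    refine Finset.sum_congr rfl fun s _ => ?_
    rw [Representation.asAlgebraHom_of]
    refine PHom.map_congr (v := tm (ZMod p) M (ψ s)) (u := h2.hom (σ s, 1)) rfl ?_ 1
    change ν 1 = LinearMap.id
    rw [map_one]; rfl
  rw [h8, zero_mul]

end trivcase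

section D12
variable {p : ℕ} [Fact p.Prime] {B : Type} [AddCommGroup B] [Finite B] {Λ : Type} [CommMonoid Λ]
  {φ : Λ →* AddMonoid.End B} {M : Type} [AddCommGroup M] [Module (ZMod p) M] [Finite M]
  {ι : Type} [DecidableEq ι] {π : ι → Λ} {e : ι → AddMonoid.End B}

lemma lemD1 (hB : IsPGroup p (Multiplicative B))
    (hπ : ∀ i b, φ (π i) b = b - e i b) (idem : ∀ i b, e i (e i b) = e i b)
    (orth : ∀ i j, i ≠ j → ∀ b, e i (e j b) = 0)
    (hcomm : ∀ w i b, φ w (e i b) = e i (φ w b)) (hπ2 : ∀ i, π i * π i = π i)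
    {ρ : Representation (ZMod p) (Multiplicative B) M}
    {ν : Representation (ZMod p) Λ M} (h : Compat φ ρ ν) (j N : ℕ)
    (hN : ∀ t : Finset ι, N ≤ t.card → ν.asAlgebraHom (∏ i ∈ t, om (ZMod p) (π i)) = 0)
    (t : Finset ι) (ht : N + j ≤ t.card) (x : H ρ j) :
    (h.rep j).asAlgebraHom (∏ i ∈ t, om (ZMod p) (π i)) x = 0 := by
  refine deviss hB {a | ∃ t : Finset ι, N ≤ t.card ∧ a = ∏ i ∈ t, om (ZMod p) (π i)} _
    (prod_om_idem t π hπ2) j (fun h hρ hΘ x => ?_) _ h rfl ?_ x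
  · exact triv1 hπ idem orth hcomm h hρ j N
      (fun t ht => LinearMap.ext fun m => hΘ _ ⟨t, ht, rfl⟩ m) t ht x
  · rintro a ⟨t, ht, rfl⟩ m
    rw [hN t ht]; rfl

lemma lemD2 (hB : IsPGroup p (Multiplicative B))
    (hπ : ∀ i b, φ (π i) b = b - e i b) (idem : ∀ i b, e i (e i b) = e i b)
    (orth : ∀ i j, i ≠ j → ∀ b, e i (e j b) = 0)
    (hcomm : ∀ w i b, φ w (e i b) = e i (φ w b)) (hπ2 : ∀ i, π i * π i = π i)
    {ρ : Representation (ZMod p) (Multiplicative B) M}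
    {ν : Representation (ZMod p) Λ M} (h : Compat φ ρ ν) (N : ℕ)
    {S : Type} [Fintype S] (σ : S → Λ) (hσ : ∀ b, ∑ s, φ (σ s) b = 0)
    (hσ2 : (∑ s, MonoidAlgebra.of (ZMod p) Λ (σ s)) * (∑ s, MonoidAlgebra.of (ZMod p) Λ (σ s)) =
      - ∑ s, MonoidAlgebra.of (ZMod p) Λ (σ s))
    (hN : ∀ t : Finset ι, N ≤ t.card → ∀ s,
      ν.asAlgebraHom (om (ZMod p) (σ s) * ∏ i ∈ t, om (ZMod p) (π i)) = 0)
    (t : Finset ι) (ht : N + 1 ≤ t.card) (x : H ρ 1) :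
    (h.rep 1).asAlgebraHom ((∑ s, MonoidAlgebra.of (ZMod p) Λ (σ s)) *
      ∏ i ∈ t, om (ZMod p) (π i)) x = 0 := by
  have := deviss hB {a | ∃ t : Finset ι, ∃ s, N ≤ t.card ∧
      a = om (ZMod p) (σ s) * ∏ i ∈ t, om (ZMod p) (π i)}
      (-((∑ s, MonoidAlgebra.of (ZMod p) Λ (σ s)) * ∏ i ∈ t, om (ZMod p) (π i)))
    (by linear_combination (∏ i ∈ t, om (ZMod p) (π i)) * (∏ i ∈ t, om (ZMod p) (π i)) * hσ2 -
        (∑ s, MonoidAlgebra.of (ZMod p) Λ (σ s)) * (prod_om_idem (k := ZMod p) t π hπ2))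
      1 (fun h hρ hΘ x => ?_) _ h rfl ?_ x
  · rw [map_neg] at this
    exact neg_eq_zero.1 this
  · rw [map_neg]
    exact neg_eq_zero.2 (triv2 hπ idem orth hcomm h hρ N σ hσ
      (fun t ht s => LinearMap.ext fun m => hΘ _ ⟨t, s, ht, rfl⟩ m) t ht x)
  · rintro a ⟨t, s, ht, rfl⟩ m
    rw [hN t ht]; rfl

end D12

end GH

namespace GH

/-- Functors from (finite) `F`-vector spaces to `k`-modules, with finite values. -/
structure Fn (F k : Type) [Field F] [CommRing k] where
  /-- Values on objects. -/
  obj : (X : Type) → [AddCommGroup X] → [Module F X] → Type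
  /-- Group structure on the values. -/
  acg : (X : Type) → [AddCommGroup X] → [Module F X] → AddCommGroup (obj X)
  /-- Module structure on the values. -/
  mod : (X : Type) → [AddCommGroup X] → [Module F X] → Module k (obj X)
  /-- Values on morphisms. -/
  map : {X Y : Type} → [AddCommGroup X] → [Module F X] → [AddCommGroup Y] → [Module F Y] →
    (X →ₗ[F] Y) → obj X →ₗ[k] obj Y
  map_id : ∀ (X : Type) [AddCommGroup X] [Module F X], map (LinearMap.id : X →ₗ[F] X) = LinearMap.id
  map_comp : ∀ {X Y Z : Type} [AddCommGroup X] [Module F X] [AddCommGroup Y] [Module F Y]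
    [AddCommGroup Z] [Module F Z] (g : Y →ₗ[F] Z) (f : X →ₗ[F] Y),
    map (g ∘ₗ f) = map g ∘ₗ map f
  fin : ∀ (X : Type) [AddCommGroup X] [Module F X] [Finite X], Finite (obj X)

attribute [instance] Fn.acg Fn.mod Fn.fin

section basics
variable {F k : Type} [Field F] [CommRing k] (T : Fn F k)
  {X Y Z : Type} [AddCommGroup X] [Module F X] [AddCommGroup Y] [Module F Y]
    [AddCommGroup Z] [Module F Z]

lemma Fn.map_id_apply (x : T.obj X) : T.map (LinearMap.id : X →ₗ[F] X) x = x := by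
  rw [T.map_id]; rfl

lemma Fn.map_comp_apply (g : Y →ₗ[F] Z) (f : X →ₗ[F] Y) (x : T.obj X) :
    T.map (g ∘ₗ f) x = T.map g (T.map f x) := by
  rw [T.map_comp]; rfl

/-- Action of the endomorphism monoid. -/
def Fn.endRep (X : Type) [AddCommGroup X] [Module F X] :
    Representation k (Module.End F X) (T.obj X) where
  toFun f := T.map f
  map_one' := T.map_id X
  map_mul' f g := T.map_comp f g

/-- Underlying endomorphism of an automorphism. -/
def toEnd (F X : Type) [Field F] [AddCommGroup X] [Module F X] : (X ≃ₗ[F] X) →* Module.End F X where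
  toFun g := g
  map_one' := rfl
  map_mul' _ _ := rfl

/-- Action of the general linear group. -/
def Fn.gl (X : Type) [AddCommGroup X] [Module F X] : Representation k (X ≃ₗ[F] X) (T.obj X) :=
  (T.endRep X).comp (toEnd F X)

lemma Fn.gl_apply (g : X ≃ₗ[F] X) (x : T.obj X) : T.gl X g x = T.map (g : X →ₗ[F] X) x := rfl

/-- Operators attached to a family of orthogonal idempotents. -/
def Psi {ι : Type} [Fintype ι] (e : ι → Module.End F Y) (idem : ∀ i, e i * e i = e i)
    (orth : ∀ i j, i ≠ j → e i * e j = 0) : (ι → F) →* Module.End F Y where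
  toFun w := 1 - ∑ i, (1 - w i) • e i
  map_one' := by simp
  map_mul' w v := by
    have : (∑ i, (1 - w i) • e i) * (∑ i, (1 - v i) • e i) = ∑ i, ((1 - w i) * (1 - v i)) • e i := by
      rw [Finset.sum_mul]
      refine Finset.sum_congr rfl fun i _ => ?_
      rw [Finset.mul_sum, Finset.sum_eq_single i]
      · rw [smul_mul_smul_comm, idem]
      · intro j _ hj
        rw [smul_mul_smul_comm, orth i j hj.symm, smul_zero]
      · simp
    rw [sub_mul, one_mul, mul_sub, mul_one, this, sub_sub, ← Finset.sum_sub_distrib,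
      ← Finset.sum_add_distrib]
    congr 1
    refine Finset.sum_congr rfl fun i _ => ?_
    rw [← sub_smul, ← add_smul, Pi.mul_apply]
    congr 1
    ring

lemma Psi_apply {ι : Type} [Fintype ι] (e : ι → Module.End F Y) (idem orth) (w : ι → F) :
    Psi e idem orth w = 1 - ∑ i, (1 - w i) • e i := rfl

/-- The element of `ι → F` which is zero at `i` and one elsewhere. -/
def pie (F : Type) [Field F] {ι : Type} [DecidableEq ι] (i : ι) : ι → F := Function.update 1 i 0

lemma pie_idem {ι : Type} [DecidableEq ι] (i : ι) : pie F i * pie F i = pie F i := by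
  ext j
  by_cases h : j = i
  · subst h; simp [pie]
  · simp [pie, h]

lemma Psi_pie {ι : Type} [Fintype ι] [DecidableEq ι] (e : ι → Module.End F Y) (idem orth) (i : ι) :
    Psi e idem orth (pie F i) = 1 - e i := by
  rw [Psi_apply, Finset.sum_eq_single i]
  · simp [pie]
  · intro j _ hj
    simp [pie, hj]
  · simp

/-- Vanishing of cross effects: the functor has degree less than `N`. -/
def CE (N : ℕ) (T : Fn F k) : Prop :=
  ∀ (Y : Type) [AddCommGroup Y] [Module F Y] [Finite Y] (ι : Type) [Fintype ι] [DecidableEq ι]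
    (e : ι → Module.End F Y) (idem : ∀ i, e i * e i = e i)
    (orth : ∀ i j, i ≠ j → e i * e j = 0) (s : Finset ι), N ≤ s.card →
    Representation.asAlgebraHom ((T.endRep Y).comp (Psi e idem orth)) (∏ i ∈ s, om k (pie F i)) = 0

/-- Iterated differences. -/
def iterD {A M : Type} [AddCommGroup A] [AddCommGroup M] : List A → (A → M) → A → M
  | [], ψ, x => ψ x
  | a :: l, ψ, x => iterD l ψ (x + a) - iterD l ψ x

/-- Polynomial maps of degree less than `N`. -/
def PD {A M : Type} [AddCommGroup A] [AddCommGroup M] (N : ℕ) (ψ : A → M) : Prop :=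
  ∀ l : List A, N ≤ l.length → ∀ x, iterD l ψ x = 0

lemma iterD_cross {ι : Type} [DecidableEq ι] (e : ι → Module.End F Z)
    (orth : ∀ i j, i ≠ j → e i * e j = 0) (D : X →ₗ[F] Z) (L : List ι) (hL : L.Nodup) :
    ∀ R : Z →ₗ[F] Y, iterD (L.map fun i => R ∘ₗ e i ∘ₗ D) (fun f => T.map f)
        (R ∘ₗ (1 - (L.map e).sum) ∘ₗ D) =
      T.map R ∘ₗ (L.map fun i => (1 - T.map (1 - e i))).prod ∘ₗ T.map D := by
  induction L with
  | nil =>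
    intro R
    change T.map _ = _
    simp only [List.map_nil, List.sum_nil, sub_zero, List.prod_nil]
    exact T.map_comp R D
  | cons a L ih =>
    intro R
    have hL' := List.nodup_cons.1 hL
    simp only [List.map_cons, List.prod_cons, List.sum_cons]
    change iterD _ _ _ - iterD _ _ _ = _
    have e1 : R ∘ₗ (1 - (e a + (L.map e).sum)) ∘ₗ D + R ∘ₗ e a ∘ₗ D =
        R ∘ₗ (1 - (L.map e).sum) ∘ₗ D := by
      refine LinearMap.ext fun x => ?_
      simp only [LinearMap.add_apply, LinearMap.comp_apply, LinearMap.sub_apply, map_sub, map_add]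
      abel
    have e3 : e a * (L.map e).sum = 0 := by
      rw [← List.sum_map_mul_left]
      apply List.sum_eq_zero
      intro x hx
      obtain ⟨i, hi, rfl⟩ := List.mem_map.1 hx
      exact orth a i (fun h => hL'.1 (h ▸ hi))
    have e2 : R ∘ₗ (1 - (e a + (L.map e).sum)) ∘ₗ D =
        (R ∘ₗ (1 - e a)) ∘ₗ (1 - (L.map e).sum) ∘ₗ D := by
      have : (1 - (e a + (L.map e).sum)) = (1 - e a) * (1 - (L.map e).sum) := by
        rw [sub_mul, one_mul, mul_sub, mul_one, e3]; abel
      rw [this]; rfl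
    have e4 : (L.map fun i => R ∘ₗ e i ∘ₗ D) = L.map fun i => (R ∘ₗ (1 - e a)) ∘ₗ e i ∘ₗ D := by
      refine List.map_congr_left fun i hi => ?_
      have : (1 - e a) * e i = e i := by
        rw [sub_mul, orth a i (fun h => hL'.1 (h ▸ hi))]; simp
      rw [LinearMap.comp_assoc, ← LinearMap.comp_assoc D (e i) (1 - e a)]
      change _ = R ∘ₗ ((1 - e a) * e i) ∘ₗ D
      rw [this]
    rw [e1, ih hL'.2 R, e2, e4, ih hL'.2 (R ∘ₗ (1 - e a)), T.map_comp]
    ext x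
    simp

lemma CE_prod' {ι : Type} [Fintype ι] [DecidableEq ι]
    (e : ι → Module.End F Y) (idem : ∀ i, e i * e i = e i)
    (orth : ∀ i j, i ≠ j → e i * e j = 0) (L : List ι) :
    Representation.asAlgebraHom ((T.endRep Y).comp (Psi e idem orth))
      (L.map fun i => om k (pie F i)).prod = (L.map fun i => (1 - T.map (1 - e i))).prod := by
  rw [map_list_prod, List.map_map]
  congr 1
  refine List.map_congr_left fun i _ => ?_
  refine LinearMap.ext fun m => ?_
  rw [Function.comp_apply, om_apply, MonoidHom.comp_apply, Psi_pie]
  rfl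

lemma CE_prod {ι : Type} [Fintype ι] [DecidableEq ι]
    (e : ι → Module.End F Y) (idem : ∀ i, e i * e i = e i)
    (orth : ∀ i j, i ≠ j → e i * e j = 0) (s : Finset ι) :
    Representation.asAlgebraHom ((T.endRep Y).comp (Psi e idem orth)) (∏ i ∈ s, om k (pie F i)) =
      (s.toList.map fun i => (1 - T.map (1 - e i))).prod := by
  rw [← Finset.prod_map_toList, CE_prod']

lemma CE.pd {N : ℕ} {T : Fn F k} (h : CE N T) [Finite X] :
    PD N (fun f : X →ₗ[F] Y => T.map f) := by
  intro l hl f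
  let e : Fin l.length → Module.End F ((Fin l.length → X) × X) := fun i =>
    LinearMap.inl F _ _ ∘ₗ LinearMap.single F (fun _ => X) i ∘ₗ LinearMap.proj i ∘ₗ LinearMap.fst F _ _
  have he : ∀ i x, e i x = (Pi.single i (x.1 i), 0) := fun _ _ => rfl
  have idem : ∀ i, e i * e i = e i := fun i => by
    refine LinearMap.ext fun x => ?_
    simp [he, Module.End.mul_apply]
  have orth : ∀ i j, i ≠ j → e i * e j = 0 := fun i j hij => by
    refine LinearMap.ext fun x => ?_
    simp [he, Module.End.mul_apply, hij]
  let D : X →ₗ[F] ((Fin l.length → X) × X) := LinearMap.prod (LinearMap.pi fun _ => LinearMap.id) LinearMap.id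
  let R : ((Fin l.length → X) × X) →ₗ[F] Y := LinearMap.coprod (∑ i, l.get i ∘ₗ LinearMap.proj i) f
  have hD : ∀ x, D x = (fun _ => x, x) := fun _ => rfl
  have hR : ∀ z, R z = ∑ i, l.get i (z.1 i) + f z.2 := fun z => by
    simp [R]
  have h1 := iterD_cross T e orth D (List.finRange l.length) (List.nodup_finRange _) R
  rw [← CE_prod' T e idem orth, ← List.prod_toFinset _ (List.nodup_finRange _),
    h _ _ e idem orth _ (by simpa using hl)] at h1
  have h2 : (List.finRange l.length).map (fun i => R ∘ₗ e i ∘ₗ D) = l := by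
    conv_rhs => rw [← List.map_get_finRange l]
    refine List.map_congr_left fun i _ => LinearMap.ext fun x => ?_
    simp only [LinearMap.comp_apply, he, hR, hD, _root_.map_zero, add_zero]
    rw [Finset.sum_eq_single i]
    · simp
    · intro j _ hj
      simp [hj]
    · simp
  have h3 : R ∘ₗ (1 - ((List.finRange l.length).map e).sum) ∘ₗ D = f := by
    have h4 : ((List.finRange l.length).map e).sum = LinearMap.inl F _ _ ∘ₗ LinearMap.fst F _ _ := by
      rw [← List.sum_toFinset _ (List.nodup_finRange _), List.toFinset_finRange]
      refine LinearMap.ext fun x => ?_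
      rw [LinearMap.sum_apply]
      refine Prod.ext ?_ ?_
      · rw [Prod.fst_sum]
        exact Finset.univ_sum_single x.1
      · rw [Prod.snd_sum]
        exact Finset.sum_const_zero
    rw [h4]
    refine LinearMap.ext fun x => ?_
    simp only [LinearMap.comp_apply, LinearMap.sub_apply, Module.End.one_apply, LinearMap.fst_apply,
      LinearMap.inl_apply, hR, hD]
    simp
  rw [h2, h3] at h1
  rw [h1]
  simp

lemma CE.of_pd {N : ℕ} {T : Fn F k} (h : ∀ (Y : Type) [AddCommGroup Y] [Module F Y] [Finite Y], 
    PD N (fun f : Y →ₗ[F] Y => T.map f)) : CE N T := by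
  intro Y _ _ _ ι _ _ e idem orth s hs
  rw [CE_prod]
  have h1 := iterD_cross T e orth LinearMap.id s.toList (Finset.nodup_toList _) LinearMap.id
  rw [h Y _ (by simpa using hs), T.map_id] at h1
  exact h1.symm

lemma CE.mono {N N' : ℕ} {T : Fn F k} (h : CE N T) (hN : N ≤ N') : CE N' T := 
  fun Y _ _ _ ι _ _ e idem orth s hs => h Y ι e idem orth s (hN.trans hs)

lemma CE.of_surj {N : ℕ} {T T' : Fn F k} (h : CE N T)
    (f : ∀ (Y : Type) [AddCommGroup Y] [Module F Y], T.obj Y →ₗ[k] T'.obj Y)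
    (hf : ∀ (Y : Type) [AddCommGroup Y] [Module F Y], Function.Surjective (f Y))
    (hn : ∀ (Y : Type) [AddCommGroup Y] [Module F Y] (u : Module.End F Y) m,
      f Y (T.map u m) = T'.map u (f Y m)) : CE N T' := by
  intro Y _ _ _ ι _ _ e idem orth s hs
  refine LinearMap.ext fun m => ?_
  obtain ⟨m, rfl⟩ := hf Y m
  have := intertwine ((T.endRep Y).comp (Psi e idem orth)) ((T'.endRep Y).comp (Psi e idem orth))
    (f Y) (fun w m => hn Y _ m) (∏ i ∈ s, om k (pie F i)) m
  rw [← this, h Y ι e idem orth s hs]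
  simp

lemma CE.of_inj {N : ℕ} {T T' : Fn F k} (h : CE N T')
    (f : ∀ (Y : Type) [AddCommGroup Y] [Module F Y], T.obj Y →ₗ[k] T'.obj Y)
    (hf : ∀ (Y : Type) [AddCommGroup Y] [Module F Y], Function.Injective (f Y))
    (hn : ∀ (Y : Type) [AddCommGroup Y] [Module F Y] (u : Module.End F Y) m,
      f Y (T.map u m) = T'.map u (f Y m)) : CE N T := by
  intro Y _ _ _ ι _ _ e idem orth s hs
  refine LinearMap.ext fun m => hf Y ?_
  have := intertwine ((T.endRep Y).comp (Psi e idem orth)) ((T'.endRep Y).comp (Psi e idem orth))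
    (f Y) (fun w m => hn Y _ m) (∏ i ∈ s, om k (pie F i)) m
  rw [this, h Y ι e idem orth s hs]
  simp

/-- Reduced functors. -/
def Red (T : Fn F k) : Prop := Subsingleton (T.obj PUnit.{1})

lemma Red.map_zero {T : Fn F k} (h : Red T) : T.map (0 : X →ₗ[F] Y) = 0 := by
  have : (0 : X →ₗ[F] Y) = (0 : PUnit.{1} →ₗ[F] Y) ∘ₗ (0 : X →ₗ[F] PUnit.{1}) := by simp
  rw [this, T.map_comp]
  refine LinearMap.ext fun x => ?_
  have := h.elim (T.map (0 : X →ₗ[F] PUnit.{1}) x) 0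
  simp [this]

lemma Red.subsingleton {T : Fn F k} (h : Red T) [Subsingleton X] : Subsingleton (T.obj X) := by
  refine subsingleton_of_forall_eq 0 fun x => ?_
  rw [← T.map_id_apply x, show (LinearMap.id : X →ₗ[F] X) = 0 from Subsingleton.elim _ _,
    h.map_zero]
  rfl

lemma CE.one_sub {N : ℕ} {T : Fn F k} (h : CE N T) (hN : N ≤ 1) (hT : Red T) [Finite X] :
    Subsingleton (T.obj X) := by
  refine subsingleton_of_forall_eq 0 fun x => ?_
  have := h X Unit (fun _ => 1) (fun _ => by simp) (fun i j hij => (hij rfl).elim) Finset.univ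
    (by simpa using hN)
  rw [CE_prod] at this
  have := LinearMap.congr_fun this x
  simpa [hT.map_zero] using this

/-- The reduced part of a functor. -/
def Fn.red : Fn F k where
  obj X := LinearMap.ker (T.map (0 : X →ₗ[F] PUnit.{1}))
  acg X := inferInstance
  mod X := inferInstance
  map f := (T.map f).restrict fun x hx => by
    rw [LinearMap.mem_ker] at hx ⊢
    rw [← T.map_comp_apply]
    simpa using hx
  map_id X := by
    refine LinearMap.ext fun x => Subtype.ext ?_
    exact T.map_id_apply x.1
  map_comp g f := by
    refine LinearMap.ext fun x => Subtype.ext ?_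
    exact T.map_comp_apply g f x.1
  fin X := inferInstance

lemma Fn.red_red : Red T.red := by
  refine subsingleton_of_forall_eq 0 fun x => Subtype.ext ?_
  have := x.2
  rw [LinearMap.mem_ker, show (0 : PUnit.{1} →ₗ[F] PUnit.{1}) = LinearMap.id from Subsingleton.elim _ _,
    T.map_id_apply] at this
  exact this

lemma CE.red {N : ℕ} {T : Fn F k} (h : CE N T) : CE N T.red :=
  h.of_inj (fun _ _ _ => Submodule.subtype _) (fun _ _ _ _ _ h => Subtype.ext h) (fun _ _ _ _ _ => rfl)

/-- The reduction sequence. -/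
def Fn.redSES (X : Type) [AddCommGroup X] [Module F X] :
    SES (T.red.gl X) (T.gl X) (triv k (X ≃ₗ[F] X) (T.obj PUnit.{1})) where
  i := Submodule.subtype _
  q := T.map 0
  hi _ _ := rfl
  hq g m := by
    rw [Fn.gl_apply, ← T.map_comp_apply]
    simp
  inj := Subtype.val_injective
  surj x := ⟨T.map 0 x, by
    rw [← T.map_comp_apply, show (0 : X →ₗ[F] PUnit.{1}) ∘ₗ (0 : PUnit.{1} →ₗ[F] X) = LinearMap.id
      from Subsingleton.elim _ _, T.map_id_apply]⟩
  ex x := ⟨fun hx => ⟨⟨x, hx⟩, rfl⟩, fun ⟨y, hy⟩ => hy ▸ y.2⟩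

end basics

end GH

namespace GH

section pd
variable {A A' M M' : Type} [AddCommGroup A] [AddCommGroup A'] [AddCommGroup M] [AddCommGroup M']

lemma iterD_comp (g : A' →+ A) (ψ : A → M) (l : List A') :
    ∀ x, iterD l (fun x => ψ (g x)) x = iterD (l.map g) ψ (g x) := by
  induction l with
  | nil => exact fun x => rfl
  | cons a l ih =>
    intro x
    change iterD l _ (x + a) - iterD l _ x = iterD (l.map g) ψ (g x + g a) - iterD (l.map g) ψ (g x)
    rw [ih, ih, map_add]

lemma iterD_shift (ψ : A → M) (b : A) (l : List A) :
    ∀ x, iterD l (fun x => ψ (x + b)) x = iterD l ψ (x + b) := by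
  induction l with
  | nil => exact fun x => rfl
  | cons a l ih =>
    intro x
    change iterD l _ (x + a) - iterD l _ x = iterD l ψ (x + b + a) - iterD l ψ (x + b)
    rw [ih, ih, add_right_comm]

lemma iterD_map (L : M →+ M') (ψ : A → M) (l : List A) :
    ∀ x, iterD l (fun x => L (ψ x)) x = L (iterD l ψ x) := by
  induction l with
  | nil => exact fun x => rfl
  | cons a l ih =>
    intro x
    change iterD l _ (x + a) - iterD l _ x = L (iterD l ψ (x + a) - iterD l ψ x)
    rw [ih, ih, map_sub]

lemma iterD_append (ψ : A → M) (l l' : List A) :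
    ∀ x, iterD (l ++ l') ψ x = iterD l (iterD l' ψ) x := by
  induction l with
  | nil => exact fun x => rfl
  | cons a l ih =>
    intro x
    change iterD (l ++ l') _ (x + a) - iterD (l ++ l') _ x = _ - _
    rw [ih, ih]

lemma iterD_sub (ψ χ : A → M) (l : List A) :
    ∀ x, iterD l (fun x => ψ x - χ x) x = iterD l ψ x - iterD l χ x := by
  induction l with
  | nil => exact fun x => rfl
  | cons a l ih =>
    intro x
    change iterD l _ (x + a) - iterD l _ x =
      (iterD l ψ (x + a) - iterD l ψ x) - (iterD l χ (x + a) - iterD l χ x)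
    rw [ih, ih]
    abel

lemma iterD_sum {α : Type} (s : Finset α) (ψ : α → A → M) (l : List A) :
    ∀ x, iterD l (fun x => ∑ c ∈ s, ψ c x) x = ∑ c ∈ s, iterD l (ψ c) x := by
  induction l with
  | nil => exact fun x => rfl
  | cons a l ih =>
    intro x
    change iterD l _ (x + a) - iterD l _ x = ∑ c ∈ s, (iterD l (ψ c) (x + a) - iterD l (ψ c) x)
    rw [ih, ih, Finset.sum_sub_distrib]

lemma PD.comp {N : ℕ} {ψ : A → M} (h : PD N ψ) (g : A' →+ A) : PD N (fun x => ψ (g x)) := by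
  intro l hl x
  rw [iterD_comp]
  exact h _ (by simpa using hl) _

lemma PD.shift {N : ℕ} {ψ : A → M} (h : PD N ψ) (b : A) : PD N (fun x => ψ (x + b)) := by
  intro l hl x
  rw [iterD_shift]
  exact h _ hl _

lemma PD.map {N : ℕ} {ψ : A → M} (h : PD N ψ) (L : M →+ M') : PD N (fun x => L (ψ x)) := by
  intro l hl x
  rw [iterD_map, h _ hl, map_zero]

lemma sum_fin {p : ℕ} [Fact p.Prime] (hM : ∀ m : M, p • m = 0) (n : ℕ) :
    ∀ (N : ℕ) (ψ : (Fin n → ZMod p) → M), N ≤ n → PD N ψ → ∑ v, ψ v = 0 := by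
  induction n with
  | zero =>
    intro N ψ hN h
    exact Finset.sum_eq_zero fun v _ => h [] (by simpa using hN) v
  | succ n ih =>
    intro N ψ hN h
    rcases N with _ | N
    · exact Finset.sum_eq_zero fun v _ => h [] (by simp) v
    rw [← (Fin.consEquiv fun _ => ZMod p).sum_comp, Fintype.sum_prod_type_right]
    refine ih N _ (by omega) ?_
    let g : (Fin n → ZMod p) →+ (Fin (n + 1) → ZMod p) :=
      { toFun := fun w => Fin.cons 0 w
        map_zero' := by ext i; refine Fin.cases ?_ (fun _ => ?_) i <;> simp
        map_add' := fun w v => by ext i; refine Fin.cases ?_ (fun _ => ?_) i <;> simp }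
    have hg : ∀ (c : ZMod p) (w : Fin n → ZMod p), (Fin.consEquiv fun _ => ZMod p) (c, w) =
        g w + Fin.cons c 0 := fun c w => by
      ext i; refine Fin.cases ?_ (fun _ => ?_) i <;> simp [g, Fin.consEquiv]
    have h2 : (fun w => ∑ c : ZMod p, ψ ((Fin.consEquiv fun _ => ZMod p) (c, w))) =
        fun w => ∑ c : ZMod p, ((fun v => ψ (v + Fin.cons c 0)) (g w) - ψ (g w)) := by
      funext w
      rw [Finset.sum_sub_distrib, Finset.sum_const, Finset.card_univ, ZMod.card, hM, sub_zero]
      exact Finset.sum_congr rfl fun c _ => by rw [hg]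
    intro l hl w
    rw [h2, iterD_sum]
    refine Finset.sum_eq_zero fun c _ => ?_
    have e1 := (iterD_comp g (fun v => ψ (v + Fin.cons c 0)) l w).trans
      (iterD_shift ψ (Fin.cons c 0) _ _)
    rw [iterD_sub, e1, iterD_comp g ψ l w]
    exact h ((Fin.cons c 0 : Fin (n + 1) → ZMod p) :: l.map g) (by simpa using hl) (g w)

/-- The sum of a polynomial map of low degree over a vector space vanishes. -/
lemma sum_pd {p : ℕ} [Fact p.Prime] (hM : ∀ m : M, p • m = 0) {V : Type} [AddCommGroup V]
    [Fintype V] [Module (ZMod p) V] {N : ℕ} (hN : N ≤ Module.finrank (ZMod p) V) (ψ : V → M)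
    (h : PD N ψ) : ∑ v, ψ v = 0 := by
  let b := (Module.finBasis (ZMod p) V).equivFun.symm
  rw [← b.toEquiv.sum_comp]
  exact sum_fin hM _ N _ hN (h.comp b.toLinearMap.toAddMonoidHom)

end pd

section D3
variable {F M : Type} [Field F] [AddCommGroup M]
  {X Y : Type} [AddCommGroup X] [Module F X] [AddCommGroup Y] [Module F Y]

/-- The shear by `h`. -/
def shear (F : Type) [Field F] {Y : Type} [AddCommGroup Y] [Module F Y] (h : Y) :
    Module.End F (Y × F) :=
  LinearMap.id + LinearMap.inl F Y F ∘ₗ LinearMap.toSpanSingleton F Y h ∘ₗ LinearMap.snd F Y F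

lemma shear_apply (h : Y) (x : Y × F) : shear F h x = (x.1 + x.2 • h, x.2) := by
  simp [shear, Prod.ext_iff]

/-- Scaling of the last coordinate. -/
def scal (Y : Type) [AddCommGroup Y] {F : Type} [Field F] [Module F Y] (s : F) :
    Module.End F (Y × F) := LinearMap.id.prodMap (s • LinearMap.id)

lemma scal_apply (s : F) (x : Y × F) : scal Y s x = (x.1, s * x.2) := rfl

/-- A map into the first factor. -/
def inY : (X →ₗ[F] Y) →+ (X × F →ₗ[F] Y × F) where
  toFun f := LinearMap.inl F Y F ∘ₗ f ∘ₗ LinearMap.fst F X F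
  map_zero' := by simp
  map_add' f g := by ext x <;> simp

/-- A map into the second factor. -/
def inF : (X × F →ₗ[F] F) →+ (X × F →ₗ[F] Y × F) where
  toFun f := LinearMap.inr F Y F ∘ₗ f
  map_zero' := by simp
  map_add' f g := by ext x <;> simp

lemma inY_apply (f : X →ₗ[F] Y) (x : X × F) : inY f x = (f x.1, 0) := rfl
lemma inF_apply (f : X × F →ₗ[F] F) (x : X × F) : inF (Y := Y) f x = (0, f x) := rfl

lemma scal_inY (s : F) (f : X →ₗ[F] Y) : scal Y s ∘ₗ inY f = inY f :=
  LinearMap.ext fun x => by simp [scal_apply, inY_apply]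
lemma scal_inF (s : F) (f : X × F →ₗ[F] F) : scal Y s ∘ₗ inF f = inF (s • f) :=
  LinearMap.ext fun x => by simp [scal_apply, inF_apply]
lemma shear_inY (h : Y) (f : X →ₗ[F] Y) : shear F h ∘ₗ inY f = inY f :=
  LinearMap.ext fun x => by simp [shear_apply, inY_apply]
lemma shear_inF (h : Y) (f : X →ₗ[F] F) : shear F h ∘ₗ inF (f ∘ₗ LinearMap.fst F X F) =
    inY (LinearMap.toSpanSingleton F Y h ∘ₗ f) + inF (f ∘ₗ LinearMap.fst F X F) :=
  LinearMap.ext fun x => by simp [shear_apply, inF_apply, inY_apply]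

lemma D3aux [Finite X] (χ : (X × F →ₗ[F] Y × F) → M) (h3 : PD 3 χ) {s : F} (hs0 : s ≠ 0)
    (hs1 : s ≠ 1)
    (hs : ∀ φ, χ (scal Y s ∘ₗ φ) = χ φ) (hh : ∀ h φ, χ (shear F h ∘ₗ φ) = χ φ) (f : X →ₗ[F] Y) :
    χ (inY f + inF (LinearMap.snd F X F)) = χ (inF (LinearMap.snd F X F)) := by
  have hB : ∀ (f : X →ₗ[F] Y) γ, χ (inY f + inF γ) = χ (inY f) + χ (inF γ) - χ 0 := by
    intro f
    have hB1 : ∀ γ γ', χ (inY f + inF (γ + γ')) - χ (inY f) - χ (inF (γ + γ')) + χ 0 =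
      (χ (inY f + inF γ) - χ (inY f) - χ (inF γ) + χ 0) +
      (χ (inY f + inF γ') - χ (inY f) - χ (inF γ') + χ 0) := fun γ γ' => by
      have := h3 [inY f, inF γ, inF γ'] (by simp) 0
      simp only [iterD, zero_add] at this
      rw [map_add, ← add_assoc]
      rw [← sub_eq_zero, ← this]
      abel
    have hB2 : ∀ γ, χ (inY f + inF (s • γ)) - χ (inY f) - χ (inF (s • γ)) + χ 0 =
      (χ (inY f + inF γ) - χ (inY f) - χ (inF γ) + χ 0) := fun γ => by
      have e1 := hs (inY f + inF γ)
      rw [LinearMap.comp_add, scal_inY, scal_inF] at e1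
      have e2 := hs (inF γ)
      rw [scal_inF] at e2
      rw [e1, e2]
    intro γ
    have hs1' : s - 1 ≠ 0 := sub_ne_zero.2 hs1
    have e := hB1 ((s - 1)⁻¹ • γ) γ
    have e' : (s - 1)⁻¹ • γ + γ = s • ((s - 1)⁻¹ • γ) := by
      rw [smul_smul]
      nth_rewrite 2 [← one_smul F γ]
      rw [← add_smul]
      congr 1
      field_simp
      ring
    rw [e', hB2] at e
    have e2 := left_eq_add.1 e
    rw [← sub_eq_zero, ← e2]
    abel
  have hC : ∀ (g f : X →ₗ[F] Y), χ (inY (g + f)) = χ (inY g) := by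
    have hC1 : ∀ (g : X →ₗ[F] Y) h (α : X →ₗ[F] F),
        χ (inY (g + LinearMap.toSpanSingleton F Y h ∘ₗ α)) = χ (inY g) := fun g h α => by
      have e1 := hh h (inY g + inF (α ∘ₗ LinearMap.fst F X F))
      rw [LinearMap.comp_add, shear_inY, shear_inF, ← add_assoc, ← map_add, hB, hB] at e1
      simpa using e1
    intro g f
    let b := Module.finBasis F X
    have hf : f = ∑ i, LinearMap.toSpanSingleton F Y (f (b i)) ∘ₗ b.coord i := by
      refine LinearMap.ext fun x => ?_
      rw [LinearMap.sum_apply]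
      conv_lhs => rw [← b.sum_repr x, map_sum]
      refine Finset.sum_congr rfl fun i _ => ?_
      simp
    rw [hf]
    generalize (Finset.univ : Finset (Fin (Module.finrank F X))) = S
    induction S using Finset.induction_on generalizing g with
    | empty => simp
    | insert a S ha ih => rw [Finset.sum_insert ha, ← add_assoc, ih, hC1]
  have := hC 0 f
  rw [zero_add, map_zero] at this
  rw [hB, this]
  abel

lemma D3core [Finite X] {N : ℕ} (hN : 3 ≤ N) (ψ : (X × F →ₗ[F] Y × F) → M) (h : PD N ψ)
    {s : F} (hs0 : s ≠ 0) (hs1 : s ≠ 1)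
    (hs : ∀ φ, ψ (scal Y s ∘ₗ φ) = ψ φ) (hh : ∀ h φ, ψ (shear F h ∘ₗ φ) = ψ φ) :
    PD (N - 2) (fun f : X →ₗ[F] Y => ψ (f.prodMap LinearMap.id)) := by
  intro l hl x
  rcases l with _ | ⟨f, l⟩
  · simp at hl; omega
  rw [List.length_cons] at hl
  have h1 : ∀ f : X →ₗ[F] Y, f.prodMap LinearMap.id = inY f + inF (LinearMap.snd F X F) := fun f =>
    LinearMap.ext fun x => by simp [inY_apply, inF_apply]
  let χ := iterD (l.map inY) ψ
  have key : ∀ x : X →ₗ[F] Y, iterD l (fun f : X →ₗ[F] Y => ψ (f.prodMap LinearMap.id)) x =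
      χ (inY x + inF (LinearMap.snd F X F)) := fun x => by
    simp only [h1]
    exact (iterD_comp inY (fun φ => ψ (φ + inF (LinearMap.snd F X F))) l x).trans
      (iterD_shift ψ _ _ _)
  have hu : ∀ u : Module.End F (Y × F), (∀ f : X →ₗ[F] Y, u ∘ₗ inY f = inY f) →
      (∀ φ, ψ (u ∘ₗ φ) = ψ φ) → ∀ φ, χ (u ∘ₗ φ) = χ φ := fun u hu1 hu2 φ => by
    let g : (X × F →ₗ[F] Y × F) →+ (X × F →ₗ[F] Y × F) :=
      { toFun := fun φ => u ∘ₗ φ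
        map_zero' := by simp
        map_add' := fun _ _ => LinearMap.comp_add _ _ _ }
    have e1 := iterD_comp g ψ (l.map inY) φ
    have e2 : (l.map inY).map g = l.map (inY : (X →ₗ[F] Y) →+ (X × F →ₗ[F] Y × F)) := by
      rw [List.map_map]
      exact List.map_congr_left fun f _ => hu1 f
    rw [e2] at e1
    refine e1.symm.trans ?_
    exact congrFun (congrArg (iterD (l.map inY)) (funext hu2)) φ
  have h3 : PD 3 χ := fun l' hl' y => by
    have := iterD_append ψ l' (l.map inY) y
    rw [← this]
    exact h _ (by simp; omega) _
  change iterD l _ (x + f) - iterD l _ x = 0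
  have a1 := D3aux χ h3 hs0 hs1 (hu _ (scal_inY s) hs) (fun k => hu _ (shear_inY k) (hh k))
  rw [key, key, a1, a1, sub_self]

end D3

end GH

namespace GH

/-- Functors from `F`-vector spaces to groups. -/
structure GF (F : Type) [Field F] where
  /-- Values on objects. -/
  obj : (X : Type) → [AddCommGroup X] → [Module F X] → Type
  /-- Group structure on the values. -/
  grp : (X : Type) → [AddCommGroup X] → [Module F X] → Group (obj X)
  /-- Values on morphisms. -/
  map : {X Y : Type} → [AddCommGroup X] → [Module F X] → [AddCommGroup Y] → [Module F Y] →
    (X →ₗ[F] Y) → obj X →* obj Y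
  map_id : ∀ (X : Type) [AddCommGroup X] [Module F X] (a : obj X),
    map (LinearMap.id : X →ₗ[F] X) a = a
  map_comp : ∀ {X Y Z : Type} [AddCommGroup X] [Module F X] [AddCommGroup Y] [Module F Y]
    [AddCommGroup Z] [Module F Z] (g : Y →ₗ[F] Z) (f : X →ₗ[F] Y) (a : obj X),
    map (g ∘ₗ f) a = map g (map f a)
  fin : ∀ (X : Type) [AddCommGroup X] [Module F X] [Finite X], Finite (obj X)

attribute [instance] GF.grp GF.fin

/-- Coefficient systems on a group-valued functor. -/
structure GM {F : Type} [Field F] (A : GF F) (k : Type) [CommRing k] where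
  /-- The coefficients. -/
  T : Fn F k
  /-- The action. -/
  ρ : (X : Type) → [AddCommGroup X] → [Module F X] → Representation k (A.obj X) (T.obj X)
  comm : ∀ {X Y : Type} [AddCommGroup X] [Module F X] [AddCommGroup Y] [Module F Y]
    (f : X →ₗ[F] Y) (a : A.obj X) (m : T.obj X), T.map f (ρ X a m) = ρ Y (A.map f a) (T.map f m)

section
variable {F k : Type} [Field F] [CommRing k] {A : GF F} (Γ : GM A k)
  {X Y Z : Type} [AddCommGroup X] [Module F X] [AddCommGroup Y] [Module F Y]
    [AddCommGroup Z] [Module F Z]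

/-- The morphism of pairs attached to a linear map. -/
def GM.hom (f : X →ₗ[F] Y) : PHom (Γ.ρ X) (Γ.ρ Y) where
  φ := A.map f
  f := Γ.T.map f
  comm := Γ.comm f

/-- Homology of the group-valued functor, as a functor. -/
noncomputable def GM.Hj (j : ℕ) : Fn F k where
  obj X := H (Γ.ρ X) j
  acg X := inferInstance
  mod X := inferInstance
  map f := (Γ.hom f).map j
  map_id X := by
    intro _ _
    rw [← PHom.map_id (ρ := Γ.ρ X)]
    apply PHom.map_congr
    · ext n; exact A.map_id X n
    · exact Γ.T.map_id X
  map_comp g f := by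
    rw [← PHom.map_comp]
    apply PHom.map_congr
    · ext n; exact A.map_comp g f n
    · exact Γ.T.map_comp g f
  fin X := H_finite j _

/-- Action of the general linear group. -/
def GF.act (A : GF F) (X : Type) [AddCommGroup X] [Module F X] : (X ≃ₗ[F] X) →* MulAut (A.obj X) where
  toFun g := 
    { toFun := A.map (g : X →ₗ[F] X)
      invFun := A.map (g.symm : X →ₗ[F] X)
      left_inv := fun a => by
        rw [← A.map_comp, LinearEquiv.comp_coe, LinearEquiv.self_trans_symm]
        exact A.map_id X a
      right_inv := fun a => by
        rw [← A.map_comp, LinearEquiv.comp_coe, LinearEquiv.symm_trans_self]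
        exact A.map_id X a
      map_mul' := _root_.map_mul _ }
  map_one' := MulEquiv.ext fun a => A.map_id X a
  map_mul' g h := MulEquiv.ext fun a => A.map_comp (g : X →ₗ[F] X) (h : X →ₗ[F] X) a

lemma GF.act_apply (A : GF F) (g : X ≃ₗ[F] X) (a : A.obj X) : A.act X g a = A.map (g : X →ₗ[F] X) a :=
  rfl

open SemidirectProduct

/-- The representation of the semidirect product. -/
def GM.rep (X : Type) [AddCommGroup X] [Module F X] :
    Representation k (A.obj X ⋊[A.act X] (X ≃ₗ[F] X)) (Γ.T.obj X) where
  toFun x := Γ.ρ X x.left * Γ.T.gl X x.right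
  map_one' := by simp
  map_mul' x y := by
    refine LinearMap.ext fun m => ?_
    have := Γ.comm (x.right : X →ₗ[F] X) y.left (Γ.T.gl X y.right m)
    simp only [mul_left, mul_right, _root_.map_mul, Module.End.mul_apply]
    exact (congrArg _ this).symm

lemma GM.rep_apply (x : A.obj X ⋊[A.act X] (X ≃ₗ[F] X)) (m : Γ.T.obj X) :
    Γ.rep X x m = Γ.ρ X x.left (Γ.T.map (x.right : X →ₗ[F] X) m) := rfl

/-- Comparison of representations. -/
noncomputable def GM.cmp (X : Type) [AddCommGroup X] [Module F X] :
    PHom ((Γ.rep X).comp (inl : A.obj X →* A.obj X ⋊[A.act X] (X ≃ₗ[F] X))) (Γ.ρ X) :=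
  PHom.mk₁ LinearMap.id (fun a m => by
    change Γ.ρ X a (Γ.T.map LinearMap.id m) = _
    rw [Γ.T.map_id_apply]
    rfl)

/-- Comparison of homology groups. -/
noncomputable def GM.cmpL (X : Type) [AddCommGroup X] [Module F X] (j : ℕ) :
    H ((Γ.rep X).comp (inl : A.obj X →* A.obj X ⋊[A.act X] (X ≃ₗ[F] X))) j →ₗ[k] (Γ.Hj j).obj X :=
  (Γ.cmp X).map j

lemma GM.cmp_bij (X : Type) [AddCommGroup X] [Module F X] (j : ℕ) :
    Function.Bijective (Γ.cmpL X j) :=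
  PHom.map_bijective _ _ Function.bijective_id j

lemma GM.cmp_eq (j : ℕ) (g : X ≃ₗ[F] X) (x) :
    Γ.cmpL X j (QRep (Γ.rep X) j g x) = (Γ.Hj j).gl X g (Γ.cmpL X j x) := by
  change (Γ.cmp X).map j (QRep (Γ.rep X) j g x) = (Γ.hom (g : X →ₗ[F] X)).map j ((Γ.cmp X).map j x)
  rw [QRep_apply, ← PHom.map_comp_apply, ← PHom.map_comp_apply]
  congr 2
  refine PHom.ext rfl (LinearMap.ext fun m => ?_)
  change Γ.ρ X 1 (Γ.T.map (g : X →ₗ[F] X) m) = _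
  rw [_root_.map_one]
  rfl

/-- The class in degree zero. -/
noncomputable def GM.mk0 (X : Type) [AddCommGroup X] [Module F X] :
    Γ.T.obj X →ₗ[k] (Γ.Hj 0).obj X := H0mk (Γ.ρ X)

lemma GM.mk0_surj (X : Type) [AddCommGroup X] [Module F X] : Function.Surjective (Γ.mk0 X) :=
  H0mk_surjective _

lemma GM.mk0_smul (a : A.obj X) (m : Γ.T.obj X) : Γ.mk0 X (Γ.ρ X a m) = Γ.mk0 X m :=
  H0mk_smul _ _ _

lemma GM.map_mk0 (f : X →ₗ[F] Y) (m : Γ.T.obj X) :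
    (Γ.Hj 0).map f (Γ.mk0 X m) = Γ.mk0 Y (Γ.T.map f m) := map_H0mk (Γ.hom f) m

/-- The edge morphism. -/
noncomputable def GM.edgeHom (X : Type) [AddCommGroup X] [Module F X] :
    PHom (Γ.rep X) ((Γ.Hj 0).gl X) where
  φ := rightHom
  f := Γ.mk0 X
  comm g m := by
    rw [GM.rep_apply, GM.mk0_smul]
    exact (Γ.map_mk0 (g.right : X →ₗ[F] X) m).symm

lemma GM.edge_inj (X : Type) [AddCommGroup X] [Module F X] (d : ℕ)
    (h : ∀ i j, i + j = d → 1 ≤ j → Subsingleton (H ((Γ.Hj j).gl X) i)) :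
    Function.Injective ((Γ.edgeHom X).map d) := by
  have h1 := edge_injective d (Γ.rep X) (fun i j hij hj =>
    H_subsingleton_of_bij' _ (Γ.cmp_eq j) (Γ.cmp_bij X j) i (h i j hij hj))
  have h2 := PHom.map_bijective (Γ.cmpL X 0) (Γ.cmp_eq 0) (Γ.cmp_bij X 0) d
  have h3 : Γ.edgeHom X = (PHom.mk₁ (Γ.cmpL X 0) (Γ.cmp_eq 0)).comp (edge (Γ.rep X)) := by
    refine PHom.ext rfl (LinearMap.ext fun m => ?_)
    exact (map_H0mk (Γ.cmp X) m).symm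
  rw [h3, PHom.map_comp]
  exact h2.1.comp h1

end

end GH

namespace GH

/-- The group of automorphisms of `X × F` which are trivial on `X`. -/
@[ext] structure Aff (F X : Type) [Field F] where
  /-- Translation part. -/
  h : X
  /-- Scaling part. -/
  s : Fˣ

namespace Aff
variable {F : Type} [Field F] {X Y Z : Type} [AddCommGroup X] [Module F X] [AddCommGroup Y] [Module F Y]
    [AddCommGroup Z] [Module F Z]

instance : Mul (Aff F X) := ⟨fun a b => ⟨a.h + (a.s⁻¹ : Fˣ) • b.h, a.s * b.s⟩⟩
instance : One (Aff F X) := ⟨⟨0, 1⟩⟩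
instance : Inv (Aff F X) := ⟨fun a => ⟨-(a.s • a.h), a.s⁻¹⟩⟩

@[simp] lemma mul_h (a b : Aff F X) : (a * b).h = a.h + (a.s⁻¹ : Fˣ) • b.h := rfl
@[simp] lemma mul_s (a b : Aff F X) : (a * b).s = a.s * b.s := rfl
@[simp] lemma one_h : (1 : Aff F X).h = 0 := rfl
@[simp] lemma one_s : (1 : Aff F X).s = 1 := rfl
@[simp] lemma inv_h (a : Aff F X) : (a⁻¹).h = -(a.s • a.h) := rfl
@[simp] lemma inv_s (a : Aff F X) : (a⁻¹).s = a.s⁻¹ := rfl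

instance : Group (Aff F X) :=
  Group.ofLeftAxioms
    (fun a b c => by
      ext1
      · simp [smul_add, smul_smul, add_assoc, mul_comm]
      · simp [mul_assoc])
    (fun a => by ext1 <;> simp)
    (fun a => by ext1 <;> simp)

instance [Finite F] [Finite X] : Finite (Aff F X) :=
  Finite.of_injective (fun a => (a.h, a.s)) (fun a b hab => by
    simp only [Prod.mk.injEq] at hab
    exact Aff.ext hab.1 hab.2)

/-- The linear map. -/
def lin (X : Type) [AddCommGroup X] [Module F X] : Aff F X →* Module.End F (X × F) where
  toFun a := shear F a.h * scal X (a.s : F)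
  map_one' := LinearMap.ext fun x => by
    simp [shear_apply, scal_apply]
  map_mul' a b := LinearMap.ext fun x => by
    simp only [Module.End.mul_apply, shear_apply, scal_apply, mul_h, mul_s]
    ext1
    · simp only [Units.smul_def, smul_add, smul_smul, Units.val_mul, add_assoc]
      rw [add_comm ((_ : F) • b.h), mul_right_comm _ _ ((a.s⁻¹ : Fˣ) : F),
        mul_right_comm _ _ ((a.s⁻¹ : Fˣ) : F), Units.mul_inv, one_mul, mul_assoc]
    · simp [mul_assoc]

lemma lin_apply (a : Aff F X) (x : X × F) : lin X a x = (x.1 + ((a.s : F) * x.2) • a.h, a.s * x.2) := by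
  simp [lin, shear_apply, scal_apply]

/-- Functoriality. -/
def map (f : X →ₗ[F] Y) : Aff F X →* Aff F Y where
  toFun a := ⟨f a.h, a.s⟩
  map_one' := by ext1 <;> simp
  map_mul' a b := by ext1 <;> simp [Units.smul_def]

lemma map_lin (f : X →ₗ[F] Y) (a : Aff F X) :
    (f.prodMap LinearMap.id) ∘ₗ lin X a = lin Y (map f a) ∘ₗ (f.prodMap LinearMap.id) :=
  LinearMap.ext fun x => by simp [lin_apply, map]

/-- The linear automorphism. -/
def linE (X : Type) [AddCommGroup X] [Module F X] : Aff F X →* ((X × F) ≃ₗ[F] (X × F)) where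
  toFun a := LinearEquiv.ofLinearMap (lin X a) (lin X a⁻¹)
    (by rw [← Module.End.mul_eq_comp, ← map_mul, mul_inv_cancel, map_one]; rfl)
    (by rw [← Module.End.mul_eq_comp, ← map_mul, inv_mul_cancel, map_one]; rfl)
  map_one' := by
    refine LinearEquiv.ext fun x => ?_
    change lin X 1 x = x
    rw [map_one]; rfl
  map_mul' a b := by
    refine LinearEquiv.ext fun x => ?_
    change lin X (a * b) x = _
    rw [map_mul]; rfl

lemma linE_apply (a : Aff F X) (x : X × F) : linE X a x = lin X a x := rfl

/-- Translations. -/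
def tr (F X : Type) [Field F] [AddCommGroup X] [Module F X] : Multiplicative X →* Aff F X where
  toFun b := ⟨b.toAdd, 1⟩
  map_one' := rfl
  map_mul' a b := by ext1 <;> simp

end Aff

section
variable {F k : Type} [Field F] [Finite F] [CommRing k] 
  {X Y Z : Type} [AddCommGroup X] [Module F X] [AddCommGroup Y] [Module F Y]
    [AddCommGroup Z] [Module F Z]

/-- The group-valued functor. -/
def affGF (F : Type) [Field F] [Finite F] : GF F where
  obj X := Aff F X
  grp X := inferInstance
  map f := Aff.map f
  map_id X := fun _ => rfl
  map_comp g f a := rfl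
  fin X := inferInstance

/-- Shift of a functor. -/
def Fn.shift (T : Fn F k) : Fn F k where
  obj X := T.obj (X × F)
  acg X := inferInstance
  mod X := inferInstance
  map f := T.map (f.prodMap LinearMap.id)
  map_id X := by
    intro _ _
    rw [LinearMap.prodMap_id]; exact T.map_id _
  map_comp g f := by
    rw [← T.map_comp]
    rfl
  fin X := inferInstance

/-- The coefficient system. -/
def affGM (T : Fn F k) : GM (affGF F) k where
  T := T.shift
  ρ X := (T.endRep (X × F)).comp (Aff.lin X)
  comm f a m := by
    exact ((T.map_comp_apply _ _ m).symm.trans (congrArg (fun g => T.map g m) (Aff.map_lin f a))).trans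
      (T.map_comp_apply _ _ m)

instance affMul : MulAction (Aff F X) Fˣ where
  smul a t := a.s * t
  one_smul t := one_mul t
  mul_smul a b t := mul_assoc _ _ _

omit [Finite F] in
lemma aff_smul (a : Aff F X) (t : Fˣ) : a • t = a.s * t := rfl

end

end GH

namespace GH

section
variable {F k : Type} [Field F] [CommRing k] 
  {X Y Z : Type} [AddCommGroup X] [Module F X] [AddCommGroup Y] [Module F Y]
    [AddCommGroup Z] [Module F Z]

/-- The representation of the affine group. -/
def affRho (T : Fn F k) (X : Type) [AddCommGroup X] [Module F X] :
    Representation k (Aff F X) (T.obj (X × F)) := (T.endRep (X × F)).comp (Aff.lin X)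

/-- Morphism of monoids. -/
def kap (F ι : Type) [Field F] : (ι → F) × Fˣ →* (Option ι → F) where
  toFun w o := o.elim (w.2 : F) w.1
  map_one' := by ext o; cases o <;> rfl
  map_mul' a b := by ext o; cases o <;> simp

lemma kap_pie {ι : Type} [DecidableEq ι] (i : ι) : kap F ι (pie F i, 1) = pie F (some i) := by
  ext o
  rcases o with _ | j
  · simp [kap, pie]
  · by_cases h : j = i
    · subst h; simp [kap, pie]
    · simp [kap, pie, h]

lemma kap_none {ι : Type} [DecidableEq ι] (s : Fˣ) :
    kap F ι (1, s) * pie F none = pie F none := by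
  ext o
  rcases o with _ | j
  · simp [kap, pie]
  · simp [kap, pie]

variable {ι : Type}

/-- Extended family of idempotents. -/
def opE (e : ι → Module.End F Y) : Option ι → Module.End F (Y × F) :=
  fun o => o.elim (LinearMap.prodMap 0 1) (fun i => LinearMap.prodMap (e i) 0)

variable {e : ι → Module.End F Y} (idem : ∀ i, e i * e i = e i)
    (orth : ∀ i j, i ≠ j → e i * e j = 0)

include idem in
lemma opE_idem : ∀ i, opE e i * opE e i = opE e i := by
  rintro (_ | i)
  · ext x <;> simp [opE]
  · exact LinearMap.ext fun x => Prod.ext (LinearMap.congr_fun (idem i) x.1) rfl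

include orth in
lemma opE_orth : ∀ i j, i ≠ j → opE e i * opE e j = 0 := by
  rintro (_ | i) (_ | j) h
  · exact absurd rfl h
  · ext x <;> simp [opE]
  · ext x <;> simp [opE]
  · exact LinearMap.ext fun x =>
      Prod.ext (LinearMap.congr_fun (orth i j (fun h' => h (by rw [h']))) x.1) rfl

variable [Fintype ι]

lemma Psi_opE (w : (ι → F) × Fˣ) (x : Y × F) :
    Psi (opE e) (opE_idem idem) (opE_orth orth) (kap F ι w) x =
      (Psi e idem orth w.1 x.1, (w.2 : F) * x.2) := by
  rw [Psi_apply, Psi_apply, Fintype.sum_option]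
  ext1
  · simp [opE, kap, LinearMap.sum_apply, Prod.fst_sum]
  · simp [opE, kap, LinearMap.sum_apply, Prod.snd_sum]
    ring

/-- The action of the operators on the coefficients. -/
def nuO (T : Fn F k) : Representation k ((ι → F) × Fˣ) (T.obj (Y × F)) :=
  ((T.endRep (Y × F)).comp (Psi (opE e) (opE_idem idem) (opE_orth orth))).comp (kap F ι)

/-- The action of the operators on the translations. -/
def phO : ((ι → F) × Fˣ) →* AddMonoid.End Y where
  toFun w := (((w.2⁻¹ : Fˣ) : F) • Psi e idem orth w.1).toAddMonoidHom
  map_one' := by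
    refine AddMonoidHom.ext fun x => ?_
    change (((1 : Fˣ)⁻¹ : Fˣ) : F) • Psi e idem orth 1 x = x
    simp
  map_mul' a b := by
    refine AddMonoidHom.ext fun x => ?_
    change (((a.2 * b.2)⁻¹ : Fˣ) : F) • Psi e idem orth (a.1 * b.1) x =
      ((a.2⁻¹ : Fˣ) : F) • Psi e idem orth a.1 (((b.2⁻¹ : Fˣ) : F) • Psi e idem orth b.1 x)
    rw [map_smul, smul_smul, map_mul, mul_inv, Units.val_mul]
    rfl

lemma phO_apply (w : (ι → F) × Fˣ) (x : Y) :
    phO idem orth w x = ((w.2⁻¹ : Fˣ) : F) • Psi e idem orth w.1 x := rfl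

/-- The representation of the translations. -/
def rhoA (T : Fn F k) (X : Type) [AddCommGroup X] [Module F X] :
    Representation k (Multiplicative X) (T.obj (X × F)) := (affRho T X).comp (Aff.tr F X)

lemma compO (T : Fn F k) : Compat (phO idem orth) (rhoA T Y) (nuO idem orth T) := by
  intro w b m
  refine (T.map_comp_apply _ _ m).symm.trans (Eq.trans (congrArg (fun g => T.map g m) ?_)
    (T.map_comp_apply _ _ m))
  refine LinearMap.ext fun x => ?_
  rw [LinearMap.comp_apply, LinearMap.comp_apply, Psi_opE idem orth, Psi_opE idem orth,
    Aff.lin_apply, Aff.lin_apply]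
  have : (w.2 : F) * x.2 * (w.2 : F)⁻¹ = x.2 := by
    rw [mul_right_comm, mul_inv_cancel₀ w.2.ne_zero, one_mul]
  simp [Aff.tr, phO_apply, smul_smul, this]

end

section
variable {p : ℕ} [Fact p.Prime] {F : Type} [Field F] [Fintype F] [CharP F p]
  {X Y Z : Type} [AddCommGroup X] [Module F X] [AddCommGroup Y] [Module F Y]
    [AddCommGroup Z] [Module F Z]

lemma card_units_unit (k F : Type) [CommRing k] [Field F] [Fintype F] (p : ℕ) [CharP k p]
    [Fact p.Prime] [CharP F p] [Fintype Fˣ] : ((Fintype.card Fˣ : ℕ) : k) = -1 := by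
  classical
  have h2 : (Fintype.card F : k) = 0 := by
    obtain ⟨n, hp, hn⟩ := FiniteField.card F p
    rw [hn]
    simp
  have h : (Fintype.card Fˣ : k) + 1 = (Fintype.card F : k) := by
    rw [← Nat.cast_add_one]
    congr 1
    have := Fintype.card_units (α := F)
    have h1 : 0 < Fintype.card F := Fintype.card_pos
    have h3 : Fintype.card Fˣ = Fintype.card F - 1 := by convert this
    omega
  rw [h2] at h
  linear_combination h

/-- The corestriction from the translations. -/
def coresT (T : Fn F (ZMod p)) (X : Type) [AddCommGroup X] [Module F X] :
    PHom (rhoA T X) (affRho T X) := cores (affRho T X) (Aff.tr F X)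

lemma cores_tr_surj (T : Fn F (ZMod p)) (j : ℕ) :
    Function.Surjective ((coresT T X).map j) := by
  classical
  refine cores_surj (S := Fˣ) 1 (Aff.tr F X) (fun c => ?_) (fun a b h => ?_) (fun t => ⟨⟨0, t⟩, ?_⟩)
    (fun g hg => ⟨.ofAdd g.h, ?_⟩) ?_ _ j
  · rw [aff_smul]; exact mul_one _
  · exact congrArg Aff.h h
  · rw [aff_smul]; exact mul_one _
  · rw [aff_smul, mul_one] at hg
    exact Aff.ext rfl hg.symm
  · rw [card_units_unit (ZMod p) F p]
    exact isUnit_one.neg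

lemma pgroup_mod (p : ℕ) [Fact p.Prime] (F X : Type) [Field F] [CharP F p] [AddCommGroup X] [Module F X] :
    IsPGroup p (Multiplicative X) := by
  intro g
  refine ⟨1, ?_⟩
  rw [pow_one]
  change Multiplicative.ofAdd (p • g.toAdd) = 1
  rw [← Nat.cast_smul_eq_nsmul F, CharP.cast_eq_zero, zero_smul]
  rfl

variable {ι : Type} [Fintype ι] {e : ι → Module.End F Y} (idem : ∀ i, e i * e i = e i)
    (orth : ∀ i j, i ≠ j → e i * e j = 0)

/-- The action on the homology of the affine group. -/
noncomputable def affEnd (T : Fn F (ZMod p)) (j : ℕ) : Representation (ZMod p) (ι → F) (H (affRho T Y) j) :=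
  (((affGM T).Hj j).endRep Y).comp (Psi e idem orth)

lemma affEnd_cores (T : Fn F (ZMod p)) (j : ℕ) (w : ι → F) (x) :
    (coresT T Y).map j ((compO idem orth T).rep j (w, 1) x) =
      affEnd idem orth T j w ((coresT T Y).map j x) := by
  let u : PHom (affRho T Y) (affRho T Y) := (affGM T).hom (Psi e idem orth w)
  change _ = u.map j _
  rw [Compat.rep_apply, ← PHom.map_comp_apply, ← PHom.map_comp_apply]
  congr 2
  refine PHom.ext (MonoidHom.ext fun b => Aff.ext ?_ rfl) (LinearMap.ext fun m => ?_)
  · change phO idem orth (w, 1) b.toAdd = Psi e idem orth w b.toAdd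
    simp [phO_apply]
  · refine congrArg (fun g => T.map g m) (LinearMap.ext fun x => ?_)
    rw [Psi_opE idem orth]
    simp

lemma cores_scal (T : Fn F (ZMod p)) (j : ℕ) (s : Fˣ) (x) :
    (coresT T Y).map j ((compO idem orth T).rep j (1, s) x) =
      (coresT T Y).map j x := by
  rw [← inner_map (affRho T Y) ⟨0, s⟩ j ((coresT T Y).map j x)]
  rw [Compat.rep_apply, ← PHom.map_comp_apply, ← PHom.map_comp_apply]
  congr 2
  refine PHom.ext (MonoidHom.ext fun b => Aff.ext ?_ ?_) (LinearMap.ext fun m => ?_)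
  · change phO idem orth (1, s) b.toAdd = 
      ((⟨0, s⟩ : Aff F Y) * Aff.tr F Y b * (⟨0, s⟩ : Aff F Y)⁻¹).h
    simp [phO_apply, Aff.tr, Units.smul_def]
  · change 1 = ((⟨0, s⟩ : Aff F Y) * Aff.tr F Y b * (⟨0, s⟩ : Aff F Y)⁻¹).s
    simp [Aff.tr]
  · refine congrArg (fun g => T.map g m) (LinearMap.ext fun x => ?_)
    rw [Psi_opE idem orth, Aff.lin_apply]
    simp

variable [DecidableEq ι]

lemma cores_alg (T : Fn F (ZMod p)) (j : ℕ) (t : Finset ι) (x) :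
    (coresT T Y).map j (((compO idem orth T).rep j).asAlgebraHom
        (∏ i ∈ t, om (ZMod p) ((pie F i, 1) : (ι → F) × Fˣ)) x) =
      (affEnd idem orth T j).asAlgebraHom (∏ i ∈ t, om (ZMod p) (pie F i))
        ((coresT T Y).map j x) := by
  have h := intertwine (MonoidHom.comp ((compO idem orth T).rep j) (MonoidHom.inl (ι → F) Fˣ))
    (affEnd idem orth T j)
    ((coresT T Y).map j) (fun w m => affEnd_cores idem orth T j w m)
    (∏ i ∈ t, om (ZMod p) (pie F i)) x
  rw [asAlgebraHom_mono, mapDomain_prod_om] at h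
  exact h

omit [Fintype F] [DecidableEq ι] in
lemma phO_comm (w : (ι → F) × Fˣ) (i : ι) (b : Y) :
    phO idem orth w (e i b) = e i (phO idem orth w b) := by
  rw [phO_apply, phO_apply, map_smul]
  congr 1
  have : Commute (Psi e idem orth w.1) (e i) := by
    rw [Psi_apply]
    refine (Commute.one_left _).sub_left (Commute.sum_left _ _ _ fun j _ => Commute.smul_left ?_ _)
    by_cases h : j = i
    · rw [h]
      exact Commute.refl _
    · exact (orth j i h).trans (orth i j (Ne.symm h)).symm
  exact LinearMap.congr_fun this.eq b

lemma nuO_alg {N : ℕ} {T : Fn F (ZMod p)} (h : CE N T) [Finite Y] (t : Finset ι) (ht : N ≤ t.card) :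
    (nuO idem orth T).asAlgebraHom (∏ i ∈ t, om (ZMod p) ((pie F i, 1) : (ι → F) × Fˣ)) = 0 := by
  rw [nuO, asAlgebraHom_mono, mapDomain_prod_om]
  have := h (Y × F) (Option ι) (opE e) (opE_idem idem) (opE_orth orth) (t.map Function.Embedding.some)
    (by simpa using ht)
  rw [Finset.prod_map] at this
  rw [← this]
  congr 1
  exact Finset.prod_congr rfl fun i _ => by rw [kap_pie]; rfl

lemma nuO_alg2 {N : ℕ} {T : Fn F (ZMod p)} (h : CE N T) [Finite Y] (t : Finset ι) (ht : N ≤ t.card + 1)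
    (s : Fˣ) :
    (nuO idem orth T).asAlgebraHom (om (ZMod p) ((1, s) : (ι → F) × Fˣ) *
      ∏ i ∈ t, om (ZMod p) ((pie F i, 1) : (ι → F) × Fˣ)) = 0 := by
  rw [nuO, asAlgebraHom_mono, map_mul, mapDomain_prod_om, mapDomain_om]
  have := h (Y × F) (Option ι) (opE e) (opE_idem idem) (opE_orth orth) (Finset.insertNone t)
    (by simpa using ht)
  rw [Finset.prod_insertNone] at this
  have h2 : om (ZMod p) (kap F ι (1, s)) = om (ZMod p) (kap F ι (1, s)) * om (ZMod p) (pie F none) := by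
    have : MonoidAlgebra.of (ZMod p) _ (kap F ι (1, s)) * MonoidAlgebra.of (ZMod p) _ (pie F none) =
        MonoidAlgebra.of (ZMod p) _ (pie F none) := by
      rw [← map_mul, kap_none]
    unfold om
    linear_combination -this
  have h3 : ∏ i ∈ t, om (ZMod p) (kap F ι (pie F i, 1)) = ∏ i ∈ t, om (ZMod p) (pie F (some i)) :=
    Finset.prod_congr rfl fun i _ => by rw [kap_pie]
  rw [h2, h3, mul_assoc, map_mul, this, mul_zero]

end

section
variable {p : ℕ} [Fact p.Prime] {F : Type} [Field F] [Fintype F] [CharP F p]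

lemma affD1 {N : ℕ} {T : Fn F (ZMod p)} (h : CE N T) (j : ℕ) : CE (N + j) ((affGM T).Hj j) := by
  intro Y _ _ _ ι _ _ e idem orth t ht
  refine LinearMap.ext fun x => ?_
  obtain ⟨y, rfl⟩ := cores_tr_surj T j x
  refine (cores_alg idem orth T j t y).symm.trans ?_
  rw [lemD1 (e := fun i => (e i).toAddMonoidHom) (pgroup_mod p F Y) ?_ ?_ ?_ ?_ ?_ (compO idem orth T) j N
    (nuO_alg idem orth h) t ht y]
  · exact _root_.map_zero _
  · intro i b
    rw [phO_apply, Psi_pie]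
    simp
    rfl
  · exact fun i b => LinearMap.congr_fun (idem i) b
  · exact fun i j hij b => LinearMap.congr_fun (orth i j hij) b
  · intro w i b
    exact phO_comm idem orth w i b
  · intro i
    rw [Prod.mk_mul_mk, pie_idem, one_mul]

lemma sum_units (h2 : 2 < Fintype.card F) [Fintype Fˣ] : ∑ s : Fˣ, ((s⁻¹ : Fˣ) : F) = 0 := by
  classical
  have h1 : ∃ t : Fˣ, (t : F) ≠ 1 := by
    by_contra! hc
    have : Fintype.card F ≤ 2 := by
      rw [← Finset.card_univ]
      refine (Finset.card_le_card (t := {0, 1}) fun x _ => ?_).trans Finset.card_le_two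
      by_cases hx : x = 0
      · simp [hx]
      · simp [hc (Units.mk0 x hx), show x = 1 from hc (Units.mk0 x hx)]
    omega
  obtain ⟨t, ht⟩ := h1
  have h3 : ∑ s : Fˣ, ((s⁻¹ : Fˣ) : F) = t * ∑ s : Fˣ, ((s⁻¹ : Fˣ) : F) := by
    rw [Finset.mul_sum, ← Equiv.sum_comp (Equiv.mulLeft t⁻¹)]
    refine Finset.sum_congr rfl fun s _ => ?_
    simp
    ring
  have h4 : ((t : F) - 1) * ∑ s : Fˣ, ((s⁻¹ : Fˣ) : F) = 0 := by linear_combination -h3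
  exact (mul_eq_zero.1 h4).resolve_left (sub_ne_zero.2 ht)

lemma affD2 (hF : 2 < Fintype.card F) {N : ℕ} (hN : 1 ≤ N) {T : Fn F (ZMod p)} (h : CE N T) :
    CE N ((affGM T).Hj 1) := by
  classical
  intro Y _ _ _ ι _ _ e idem orth t ht
  refine LinearMap.ext fun x => ?_
  obtain ⟨y, rfl⟩ := cores_tr_surj T 1 x
  refine (cores_alg idem orth T 1 t y).symm.trans ?_
  have key := lemD2 (e := fun i => (e i).toAddMonoidHom) (pgroup_mod p F Y)
    (π := fun i => ((pie F i, 1) : (ι → F) × Fˣ)) ?_ ?_ ?_ ?_ ?_ (compO idem orth T) (N - 1)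
    (fun s : Fˣ => ((1, s) : (ι → F) × Fˣ)) ?_ ?_
    (fun t ht s => nuO_alg2 idem orth h t (by omega) s) t (by omega) y
  · have h2 := congrArg ((coresT T Y).map 1) key
    rw [map_mul, Module.End.mul_apply, map_sum, LinearMap.sum_apply, map_sum] at h2
    generalize ((compO idem orth T).rep 1).asAlgebraHom
        (∏ i ∈ t, om (ZMod p) ((pie F i, 1) : (ι → F) × Fˣ)) y = z at h2 ⊢
    have h3 : ∀ s : Fˣ, (coresT T Y).map 1 (((compO idem orth T).rep 1).asAlgebraHom
        (MonoidAlgebra.of (ZMod p) ((ι → F) × Fˣ) (1, s)) z) = (coresT T Y).map 1 z := fun s => by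
      rw [Representation.asAlgebraHom_of]
      exact cores_scal idem orth T 1 s z
    rw [Finset.sum_congr rfl (fun s _ => h3 s), Finset.sum_const, Finset.card_univ,
      ← Nat.cast_smul_eq_nsmul (ZMod p), card_units_unit (ZMod p) F p, neg_smul, one_smul,
      _root_.map_zero, neg_eq_zero] at h2
    exact h2
  · intro i b
    rw [phO_apply, Psi_pie]
    simp
    rfl
  · exact fun i b => LinearMap.congr_fun (idem i) b
  · exact fun i j hij b => LinearMap.congr_fun (orth i j hij) b
  · intro w i b
    exact phO_comm idem orth w i b
  · intro i
    rw [Prod.mk_mul_mk, pie_idem, one_mul]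
  · intro b
    simp only [phO_apply, map_one, Module.End.one_apply]
    rw [← Finset.sum_smul, sum_units hF, zero_smul]
  · have h5 : ∀ s : Fˣ, MonoidAlgebra.of (ZMod p) ((ι → F) × Fˣ) (1, s) *
        (∑ s : Fˣ, MonoidAlgebra.of (ZMod p) ((ι → F) × Fˣ) (1, s)) =
          ∑ s : Fˣ, MonoidAlgebra.of (ZMod p) ((ι → F) × Fˣ) (1, s) := fun s => by
      rw [Finset.mul_sum, ← Equiv.sum_comp (Equiv.mulLeft s)
        (fun s => MonoidAlgebra.of (ZMod p) ((ι → F) × Fˣ) (1, s))]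
      refine Finset.sum_congr rfl fun s' _ => ?_
      rw [← map_mul, Prod.mk_mul_mk, one_mul]
      rfl
    rw [Finset.sum_mul, Finset.sum_congr rfl (fun s _ => h5 s), Finset.sum_const, Finset.card_univ,
      ← Nat.cast_smul_eq_nsmul (ZMod p), card_units_unit (ZMod p) F p, neg_smul, one_smul]

end

end GH

namespace GH

section
variable {p : ℕ} [Fact p.Prime] {F : Type} [Field F] [Fintype F] [CharP F p]

lemma affD3 (hF : 2 < Fintype.card F) {N : ℕ} (hN : 3 ≤ N) {T : Fn F (ZMod p)} (h : CE N T) :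
    CE (N - 2) ((affGM T).Hj 0) := by
  refine CE.of_pd fun Y _ _ _ => ?_
  intro l hl x
  refine LinearMap.ext fun z => ?_
  obtain ⟨z, rfl⟩ := (affGM T).mk0_surj Y z
  let z' : T.obj (Y × F) := z
  let L : ((((affGM T).Hj 0).obj Y) →ₗ[ZMod p] (((affGM T).Hj 0).obj Y)) →+ ((affGM T).Hj 0).obj Y :=
    (LinearMap.applyₗ ((affGM T).mk0 Y z)).toAddMonoidHom
  change L (iterD l (fun f : Y →ₗ[F] Y => ((affGM T).Hj 0).map f) x) = 0
  rw [← iterD_map]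
  let mk : T.obj (Y × F) →ₗ[ZMod p] ((affGM T).Hj 0).obj Y := (affGM T).mk0 Y
  have hmk : ∀ (a : Aff F Y) (m : T.obj (Y × F)), mk (T.map (Aff.lin Y a) m) = mk m := fun a m =>
    (affGM T).mk0_smul (X := Y) a m
  let L' : (T.obj (Y × F) →ₗ[ZMod p] T.obj (Y × F)) →+ ((affGM T).Hj 0).obj Y :=
    (mk ∘ₗ LinearMap.applyₗ z').toAddMonoidHom
  have h1 : ∀ f : Y →ₗ[F] Y, L (((affGM T).Hj 0).map f) = L' (T.map (f.prodMap LinearMap.id)) :=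
    fun f => (affGM T).map_mk0 f z
  have h2 : PD N (fun f : (Y × F) →ₗ[F] (Y × F) => L' (T.map f)) := (h.pd).map L'
  obtain ⟨s, hs0, hs1⟩ : ∃ s : F, s ≠ 0 ∧ s ≠ 1 := by
    classical
    by_contra! hc
    have : Fintype.card F ≤ 2 := by
      rw [← Finset.card_univ]
      refine (Finset.card_le_card (t := {0, 1}) fun x _ => ?_).trans Finset.card_le_two
      by_cases hx : x = 0
      · simp [hx]
      · simp [hc x hx]
    omega
  have h3 := D3core hN _ h2 hs0 hs1 (fun φ => ?_) (fun b φ => ?_)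
  · simp only [h1]
    exact h3 l hl x
  · change mk (T.map _ z') = mk (T.map _ z')
    rw [T.map_comp_apply, ← hmk ⟨0, Units.mk0 s hs0⟩ (T.map φ z')]
    congr 3
    refine LinearMap.ext fun x => ?_
    rw [Aff.lin_apply, scal_apply]
    simp
  · change mk (T.map _ z') = mk (T.map _ z')
    rw [T.map_comp_apply, ← hmk ⟨b, 1⟩ (T.map φ z')]
    congr 3
    refine LinearMap.ext fun x => ?_
    rw [Aff.lin_apply, shear_apply]
    simp

lemma affRed (T : Fn F (ZMod p)) (j : ℕ) : Red ((affGM T).Hj (j + 1)) := by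
  classical
  have : Fintype (Aff F PUnit.{1}) := Fintype.ofFinite _
  refine H_coprime (G := Aff F PUnit.{1}) ?_ (affRho T PUnit.{1}) j
  have e : Aff F PUnit.{1} ≃ Fˣ := ⟨fun a => a.s, fun s => ⟨0, s⟩, fun a => rfl, fun s => rfl⟩
  rw [Fintype.card_congr e, card_units_unit (ZMod p) F p]
  exact isUnit_one.neg

/-- The constant functor. -/
def constFn (F : Type) [Field F] (p : ℕ) [Fact p.Prime] : Fn F (ZMod p) where
  obj _ := ZMod p
  acg _ := inferInstance
  mod _ := inferInstance
  map _ := LinearMap.id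
  map_id _ := rfl
  map_comp _ _ := rfl
  fin _ := inferInstance

lemma const_CE : CE 1 (constFn F p) := by
  intro Y _ _ _ ι _ _ e idem orth t ht
  obtain ⟨i, hi⟩ := Finset.card_pos.1 ht
  rw [← Finset.mul_prod_erase _ _ hi, map_mul]
  have : Representation.asAlgebraHom (((constFn F p).endRep Y).comp (Psi e idem orth))
      (om (ZMod p) (pie F i)) = 0 := by
    refine LinearMap.ext fun m => ?_
    rw [om_apply]
    exact sub_self m
  rw [this, zero_mul]

end

section
variable {k : Type} [CommRing k] {G P M : Type} [Group G] [Group P] [AddCommGroup M] [Module k M]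

lemma cores_surj_of_le [Finite G] (ι : P →* G) (hι : Function.Injective ι) (C : Subgroup G)
    (hC : C ≤ ι.range) (hidx : IsUnit ((C.index : ℕ) : k)) (ρ : Representation k G M) (n : ℕ) :
    Function.Surjective ((cores ρ ι).map n) := by
  classical
  have : Fintype (G ⧸ C) := Fintype.ofFinite _
  have h1 := cores_surj (S := G ⧸ C) (k := k) (QuotientGroup.mk 1) C.subtype
    (fun c => by
      change (QuotientGroup.mk ((c : G) * 1) : G ⧸ C) = _
      rw [QuotientGroup.eq]
      simp)
    C.subtype_injective
    (fun s => by
      obtain ⟨g, rfl⟩ := QuotientGroup.mk_surjective s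
      exact ⟨g, by change (QuotientGroup.mk (g * 1) : G ⧸ C) = _; rw [mul_one]⟩)
    (fun g hg => by
      change (QuotientGroup.mk (g * 1) : G ⧸ C) = _ at hg
      rw [eq_comm, QuotientGroup.eq] at hg
      exact ⟨⟨g, by simpa using hg⟩, rfl⟩)
    (by rw [← Nat.card_eq_fintype_card]; exact hidx) ρ n
  let κ : C →* P := (MonoidHom.ofInjective hι).symm.toMonoidHom.comp (Subgroup.inclusion hC)
  have hκ : ∀ c : C, ι (κ c) = c := fun c => by
    have := (MonoidHom.ofInjective hι).apply_symm_apply (Subgroup.inclusion hC c)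
    exact congrArg Subtype.val this
  let u : PHom (ρ.comp C.subtype) (ρ.comp ι) := 
    { φ := κ, f := LinearMap.id, comm := fun g m => by
        change ρ g m = ρ (ι (κ g)) m
        rw [hκ] }
  have h2 : cores ρ C.subtype = (cores ρ ι).comp u :=
    PHom.ext (MonoidHom.ext fun c => (hκ c).symm) rfl
  rw [h2, PHom.map_comp] at h1
  exact Function.Surjective.of_comp h1

end

end GH

namespace GH
open SemidirectProduct

lemma phom_surj_of_le {k : Type} [CommRing k] {G P M M' : Type} [Group G] [Group P]
    [AddCommGroup M] [Module k M] [AddCommGroup M'] [Module k M'] [Finite G]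
    {ρ' : Representation k P M'} {ρ : Representation k G M} (u : PHom ρ' ρ)
    (hι : Function.Injective u.φ) (hf : Function.Bijective u.f) (C : Subgroup G)
    (hC : C ≤ u.φ.range) (hidx : IsUnit ((C.index : ℕ) : k)) (n : ℕ) :
    Function.Surjective (u.map n) := by
  have h := cores_surj_of_le u.φ hι C hC hidx ρ n
  let e := LinearEquiv.ofBijective u.f hf
  let w : PHom (MonoidHom.comp ρ u.φ) ρ' :=
    ⟨MonoidHom.id _, e.symm, fun x m => by
      obtain ⟨m, rfl⟩ := e.surjective m
      apply e.injective
      rw [LinearEquiv.coe_coe, e.apply_symm_apply, e.symm_apply_apply]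
      exact (u.comm x m).symm⟩
  have e : cores ρ u.φ = u.comp w := PHom.ext rfl (LinearMap.ext fun m => (e.apply_symm_apply m).symm)
  rw [e, PHom.map_comp] at h
  exact Function.Surjective.of_comp h

section
variable {F k : Type} [Field F] [Finite F] [CommRing k]
  {X Y Z : Type} [AddCommGroup X] [Module F X] [AddCommGroup Y] [Module F Y]

/-- The parabolic subgroup. -/
abbrev Par (F : Type) [Field F] [Finite F] (X : Type) [AddCommGroup X] [Module F X] : Type :=
  (affGF F).obj X ⋊[(affGF F).act X] (X ≃ₗ[F] X)

/-- Parabolic element as a linear map. -/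
def embFun (x : Par F X) : (X × F) ≃ₗ[F] (X × F) :=
  Aff.linE X x.left * (x.right.prodCongr (LinearEquiv.refl F F))

lemma embFun_apply (x : Par F X) (v : X × F) :
    embFun x v = Aff.lin X x.left (x.right v.1, v.2) := rfl

lemma par_left (x y : Par F X) : (x * y).left = @HMul.hMul (Aff F X) (Aff F X) (Aff F X) _ x.left (Aff.map (x.right : X →ₗ[F] X) y.left) := rfl

/-- The embedding of the parabolic subgroup. -/
def emb (X : Type) [AddCommGroup X] [Module F X] : Par F X →* ((X × F) ≃ₗ[F] (X × F)) where
  toFun x := embFun x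
  map_one' := by
    refine LinearEquiv.ext fun v => ?_
    change Aff.lin X 1 v = v
    rw [map_one]; rfl
  map_mul' x y := by
    refine LinearEquiv.ext fun v => ?_
    change embFun (x * y) v = embFun x (embFun y v)
    simp only [embFun_apply]
    refine (congrArg (fun f : Module.End F (X × F) => f ((x * y).right v.1, v.2))
      (map_mul (Aff.lin X) (x.left : Aff F X) (Aff.map (x.right : X →ₗ[F] X) y.left))).trans ?_
    have := LinearMap.congr_fun (Aff.map_lin (x.right : X →ₗ[F] X) y.left) (y.right v.1, v.2)
    change Aff.lin X x.left (Aff.lin X (Aff.map (x.right : X →ₗ[F] X) y.left) (x.right (y.right v.1), v.2)) = _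
    exact congrArg (Aff.lin X x.left) this.symm

lemma emb_apply (x : Par F X) (v : X × F) :
    emb X x v = (x.right v.1 + ((Aff.s x.left : F) * v.2) • (Aff.h x.left), Aff.s x.left * v.2) := by
  exact Aff.lin_apply _ _

lemma emb_inj : Function.Injective (emb (F := F) X) := by
  refine (injective_iff_map_eq_one _).2 fun x hx => ?_
  have h1 : ∀ v : X × F, emb X x v = v := fun v => by rw [hx]; rfl
  simp only [emb_apply] at h1
  have h2 : Aff.s x.left = 1 := by
    have := congrArg Prod.snd (h1 (0, 1))
    ext1
    simpa using this
  have h3 : Aff.h x.left = 0 := by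
    have := congrArg Prod.fst (h1 (0, 1))
    simpa [h2] using this
  refine SemidirectProduct.ext (Aff.ext h3 h2) ?_
  refine LinearEquiv.ext fun v => ?_
  have := congrArg Prod.fst (h1 (v, 0))
  simpa using this

instance funAct : MulAction ((X × F) ≃ₗ[F] (X × F)) ((X × F) →ₗ[F] F) where
  smul g φ := φ ∘ₗ (g.symm : (X × F) →ₗ[F] (X × F))
  one_smul φ := rfl
  mul_smul g h φ := rfl

omit [Finite F] in
lemma funAct_apply (g : (X × F) ≃ₗ[F] (X × F)) (φ : (X × F) →ₗ[F] F) (v : X × F) :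
  (g • φ) v = φ (g.symm v) := rfl

lemma stab_le : MulAction.stabilizer ((X × F) ≃ₗ[F] (X × F)) (LinearMap.snd F X F) ≤ (emb (F := F) X).range := by
  intro g hg
  have h1 : ∀ v, (g v).2 = v.2 := fun v => by
    have := LinearMap.congr_fun (MulAction.mem_stabilizer_iff.1 hg) (g v)
    rw [funAct_apply, g.symm_apply_apply] at this
    exact this.symm
  have h2 : ∀ v, (g.symm v).2 = v.2 := fun v => by
    rw [← h1, g.apply_symm_apply]
  let q : X ≃ₗ[F] X := LinearEquiv.ofLinearMap
    (LinearMap.fst F X F ∘ₗ (g : (X × F) →ₗ[F] (X × F)) ∘ₗ LinearMap.inl F X F)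
    (LinearMap.fst F X F ∘ₗ (g.symm : (X × F) →ₗ[F] (X × F)) ∘ₗ LinearMap.inl F X F)
    (LinearMap.ext fun x => by
      change (g ((g.symm (x, 0)).1, 0)).1 = x
      have : ((g.symm (x, 0)).1, (0 : F)) = g.symm (x, 0) := Prod.ext rfl (h2 (x, 0)).symm
      rw [this, g.apply_symm_apply])
    (LinearMap.ext fun x => by
      change (g.symm ((g (x, 0)).1, 0)).1 = x
      have : ((g (x, 0)).1, (0 : F)) = g (x, 0) := Prod.ext rfl (h1 (x, 0)).symm
      rw [this, g.symm_apply_apply])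
  refine ⟨(⟨(⟨(g (0, 1)).1, 1⟩ : Aff F X), q⟩ : Par F X), LinearEquiv.ext fun v => ?_⟩
  rw [emb_apply]
  change ((g (v.1, 0)).1 + (((1 : Fˣ) : F) * v.2) • (g (0, 1)).1, ((1 : Fˣ) : F) * v.2) = g v
  have h3 : g v = g (v.1, 0) + v.2 • g (0, 1) := by
    rw [← map_smul, ← map_add]
    simp
  ext1
  · rw [h3]; simp
  · simp [h1]

omit [Finite F] in
lemma snd_orbit [Finite X] : MulAction.orbit ((X × F) ≃ₗ[F] (X × F)) (LinearMap.snd F X F) = {0}ᶜ := by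
  ext φ
  simp only [Set.mem_compl_iff, Set.mem_singleton_iff]
  constructor
  · rintro ⟨g, rfl⟩ h
    have := LinearMap.congr_fun h (g (0, 1))
    change (g.symm (g (0, 1))).2 = 0 at this
    rw [g.symm_apply_apply] at this
    exact one_ne_zero this
  · intro h
    obtain ⟨v, hv⟩ : ∃ v, φ v ≠ 0 := by
      by_contra! hc
      exact h (LinearMap.ext hc)
    have hsurj : Function.Surjective φ := fun c => ⟨(c / φ v) • v, by
      rw [map_smul, smul_eq_mul, div_mul_cancel₀ _ hv]⟩
    obtain ⟨v0, hv0⟩ := hsurj 1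
    have : Module.Finite F X := Module.Finite.of_finite
    have hd : Module.finrank F X = Module.finrank F (LinearMap.ker φ) := by
      have h1 := LinearMap.finrank_range_add_finrank_ker φ
      rw [LinearMap.range_eq_top.2 hsurj, finrank_top, Module.finrank_prod, Module.finrank_self] at h1
      omega
    let e : X ≃ₗ[F] LinearMap.ker φ := LinearEquiv.ofFinrankEq _ _ hd
    let f : (X × F) →ₗ[F] (X × F) := LinearMap.coprod ((LinearMap.ker φ).subtype ∘ₗ e.toLinearMap)
      (LinearMap.toSpanSingleton F _ v0)
    have hf : ∀ v, f v = e v.1 + v.2 • v0 := fun v => rfl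
    have hφ : ∀ v, φ (f v) = v.2 := fun v => by
      rw [hf, map_add, map_smul, hv0, (e v.1).2]; simp
    have hinj : Function.Injective f := by
      refine (injective_iff_map_eq_zero _).2 fun v hv => ?_
      have h1 : v.2 = 0 := by rw [← hφ, hv, map_zero]
      have h2 := hf v
      rw [hv, h1, zero_smul, add_zero, eq_comm] at h2
      have h3 : e v.1 = 0 := Subtype.ext h2
      exact Prod.ext (by simpa using h3) h1
    let g : (X × F) ≃ₗ[F] (X × F) := LinearEquiv.ofInjectiveEndo f hinj
    refine ⟨g, LinearMap.ext fun v => ?_⟩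
    change (g.symm v).2 = φ v
    rw [← hφ]
    exact congrArg φ (g.apply_symm_apply v)

end

section
variable {p : ℕ} [Fact p.Prime] {F : Type} [Field F] [Fintype F] [CharP F p]
  {X : Type} [AddCommGroup X] [Module F X] [Finite X]

instance finLin {F V W : Type} [Field F] [AddCommGroup V] [AddCommGroup W] [Module F V] [Module F W]
    [Finite V] [Finite W] : Finite (V →ₗ[F] W) :=
  Finite.of_injective (fun e => (e : V → W)) DFunLike.coe_injective

instance finGL {F V W : Type} [Field F] [AddCommGroup V] [AddCommGroup W] [Module F V] [Module F W]
    [Finite V] [Finite W] : Finite (V ≃ₗ[F] W) :=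
  Finite.of_injective (fun e => (e : V → W)) DFunLike.coe_injective

lemma stab_index : IsUnit (((MulAction.stabilizer ((X × F) ≃ₗ[F] (X × F)) (LinearMap.snd F X F)).index : ℕ) : ZMod p) := by
  classical
  rw [MulAction.index_stabilizer, snd_orbit]
  have : Fintype ((X × F) →ₗ[F] F) := Fintype.ofFinite _
  rw [Set.ncard_compl, Set.ncard_singleton, Nat.card_eq_fintype_card]
  have h1 : p ∣ Fintype.card ((X × F) →ₗ[F] F) := by
    have : Nontrivial ((X × F) →ₗ[F] F) := ⟨LinearMap.snd F X F, 0, fun h => by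
      simpa using LinearMap.congr_fun h (0, 1)⟩
    obtain ⟨n, hn⟩ := (IsPGroup.iff_card (p := p)).1 (pgroup_mod p F ((X × F) →ₗ[F] F))
    have h2 : Fintype.card ((X × F) →ₗ[F] F) = p ^ n := by
      rw [← hn, ← Nat.card_eq_fintype_card]; rfl
    have h3 := Fintype.one_lt_card (α := ((X × F) →ₗ[F] F))
    rw [h2] at h3 ⊢
    refine dvd_pow_self _ fun h0 => ?_
    rw [h0] at h3; simp at h3
  rw [Nat.cast_sub Fintype.card_pos, (ZMod.natCast_eq_zero_iff _ _).2 h1]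
  simp

/-- Corestriction from the parabolic. -/
def affCores (T : Fn F (ZMod p)) (X : Type) [AddCommGroup X] [Module F X] :
    PHom ((affGM T).rep X) (T.gl (X × F)) where
  φ := emb X
  f := LinearMap.id
  comm x m := by
    rw [GM.rep_apply]
    exact (T.map_comp_apply (Aff.lin X x.left) ((x.right : X →ₗ[F] X).prodMap LinearMap.id) m).symm

lemma affCores_surj (T : Fn F (ZMod p)) (X : Type) [AddCommGroup X] [Module F X] [Finite X] (n : ℕ) :
    Function.Surjective ((affCores T X).map n) := by
  exact phom_surj_of_le (affCores T X) emb_inj Function.bijective_id _ stab_le (stab_index (p := p)) n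

end

end GH

namespace GH
open SemidirectProduct

section
variable {F k : Type} [Field F] [CommRing k]
  {X Y : Type} [AddCommGroup X] [Module F X] [AddCommGroup Y] [Module F Y]

/-- Conjugation. -/
def conjE (e : X ≃ₗ[F] Y) : (X ≃ₗ[F] X) →* (Y ≃ₗ[F] Y) where
  toFun g := e.symm.trans (g.trans e)
  map_one' := LinearEquiv.ext fun v => e.apply_symm_apply v
  map_mul' g h := LinearEquiv.ext fun v => by
    change e (g (h (e.symm v))) = e (g (e.symm (e (h (e.symm v)))))
    rw [e.symm_apply_apply]

/-- Transport along an isomorphism. -/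
def Fn.conj (T : Fn F k) (e : X ≃ₗ[F] Y) : PHom (T.gl X) (T.gl Y) where
  φ := conjE e
  f := T.map (e : X →ₗ[F] Y)
  comm g m := by
    rw [Fn.gl_apply, Fn.gl_apply, ← T.map_comp_apply, ← T.map_comp_apply]
    congr 2
    refine LinearMap.ext fun v => ?_
    change e (g v) = e (g (e.symm (e v)))
    rw [e.symm_apply_apply]

lemma Fn.conj_comp (T : Fn F k) (e : X ≃ₗ[F] Y) : (T.conj e).comp (T.conj e.symm) = PHom.id (T.gl Y) := by
  refine PHom.ext ?_ ?_
  · refine MonoidHom.ext fun g => LinearEquiv.ext fun v => ?_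
    change e (e.symm (g (e (e.symm v)))) = g v
    simp
  · refine LinearMap.ext fun m => ?_
    change T.map _ (T.map _ m) = m
    rw [← T.map_comp_apply]
    have : (e : X →ₗ[F] Y) ∘ₗ (e.symm : Y →ₗ[F] X) = LinearMap.id := by ext v; simp
    rw [this, T.map_id_apply]

lemma Fn.conj_surj (T : Fn F k) (e : X ≃ₗ[F] Y) (n : ℕ) : Function.Surjective ((T.conj e).map n) := by
  have := congrArg (fun u => u.map n) (T.conj_comp e)
  simp only [PHom.map_comp, PHom.map_id] at this
  exact fun x => ⟨_, LinearMap.congr_fun this x⟩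

lemma Fn.gl_transfer (T : Fn F k) (e : X ≃ₗ[F] Y) {n : ℕ} (h : Subsingleton (H (T.gl X) n)) :
    Subsingleton (H (T.gl Y) n) := (T.conj_surj e n).subsingleton

lemma exists_split [Finite X] (h : 0 < Module.finrank F X) :
    Nonempty (((Fin (Module.finrank F X - 1) → F) × F) ≃ₗ[F] X) := by
  have : Module.Finite F X := Module.Finite.of_finite
  refine ⟨LinearEquiv.ofFinrankEq _ _ ?_⟩
  rw [Module.finrank_prod, Module.finrank_self, Module.finrank_fin_fun]
  omega

end

section
variable (p : ℕ) [Fact p.Prime] {F : Type} [Field F] [Fintype F] [CharP F p]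
  {X Y C V : Type} [AddCommGroup X] [Module F X] [AddCommGroup Y] [Module F Y]
  [AddCommGroup C] [Module F C] [AddCommGroup V] [Module F V]

/-- Block embedding. -/
def blk (ι : (X × C) ≃ₗ[F] V) : (X ≃ₗ[F] X) →* (V ≃ₗ[F] V) where
  toFun g := ι.symm.trans ((g.prodCongr (LinearEquiv.refl F C)).trans ι)
  map_one' := LinearEquiv.ext fun v => ι.apply_symm_apply v
  map_mul' g h := LinearEquiv.ext fun v => by
    change ι _ = ι ((g.prodCongr (LinearEquiv.refl F C)) (ι.symm (ι _)))
    rw [ι.symm_apply_apply]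
    rfl

omit [Fintype F] in
lemma blk_apply (ι : (X × C) ≃ₗ[F] V) (g : X ≃ₗ[F] X) (v : V) :
    blk ι g v = ι (g (ι.symm v).1, (ι.symm v).2) := rfl

/-- Block embedding, on constant coefficients. -/
def sHom (ι : (X × C) ≃ₗ[F] V) : PHom ((constFn F p).gl X) ((constFn F p).gl V) where
  φ := blk ι
  f := LinearMap.id (M := ZMod p)
  comm _ _ := rfl

/-- Block embedding of parabolics. -/
def parBlk (X C : Type) [AddCommGroup X] [Module F X] [AddCommGroup C] [Module F C] :
    Par F X →* Par F (X × C) :=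
  SemidirectProduct.map (Aff.map (LinearMap.inl F X C)) (blk (LinearEquiv.refl F (X × C)))
    (fun g => MonoidHom.ext fun a => Aff.ext (Prod.ext rfl rfl) rfl)

/-- Block embedding of parabolics, on constant coefficients. -/
def parHom (X C : Type) [AddCommGroup X] [Module F X] [AddCommGroup C] [Module F C] :
    PHom ((affGM (constFn F p)).rep X) ((affGM (constFn F p)).rep (X × C)) where
  φ := parBlk X C
  f := LinearMap.id (M := ZMod p)
  comm _ _ := rfl

/-- Inclusion of the Levi subgroup. -/
def leviIn (X : Type) [AddCommGroup X] [Module F X] :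
    PHom ((constFn F p).gl X) ((affGM (constFn F p)).rep X) where
  φ := inr
  f := LinearMap.id (M := ZMod p)
  comm _ _ := rfl

/-- Projection to the Levi subgroup. -/
def leviPr (X : Type) [AddCommGroup X] [Module F X] :
    PHom ((affGM (constFn F p)).rep X) ((constFn F p).gl X) where
  φ := rightHom
  f := LinearMap.id (M := ZMod p)
  comm _ _ := rfl

/-- The vanishing statement with reduced coefficients. -/
def Van (F : Type) [Field F] (a : ℕ) : Prop :=
  ∀ (N : ℕ) (T : Fn F (ZMod p)), Red T → CE N T → 1 ≤ N →
    ∀ (V : Type) [AddCommGroup V] [Module F V] [Finite V], 2 * a + N ≤ 2 * Module.finrank F V →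
      Subsingleton (H (T.gl V) a)

lemma blk_zero (a : ℕ) (ha : 0 < a) (hV : ∀ i, i < a → Van p F i) (m : ℕ) :
    ∀ (X C V : Type) [AddCommGroup X] [Module F X] [AddCommGroup C] [Module F C] [AddCommGroup V]
      [Module F V] [Finite X] [Finite C] [Finite V] (ι : (X × C) ≃ₗ[F] V), Module.finrank F X = m →
      a < Module.finrank F V → (sHom p ι).map a = 0 := by
  classical
  induction m with
  | zero =>
    intro X C V _ _ _ _ _ _ _ _ _ ι hX hVa
    have : Module.Finite F X := Module.Finite.of_finite
    have : Subsingleton X := Module.finrank_zero_iff.1 hX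
    have : Fintype (X ≃ₗ[F] X) := Fintype.ofFinite _
    have h1 : Fintype.card (X ≃ₗ[F] X) = 1 :=
      Fintype.card_eq_one_iff.2 ⟨1, fun g => LinearEquiv.ext fun v => Subsingleton.elim _ _⟩
    obtain ⟨b, rfl⟩ := Nat.exists_eq_add_of_lt ha
    have h2 : Subsingleton (H ((constFn F p).gl X) (0 + b + 1)) :=
      H_coprime (by rw [h1]; simp) ((constFn F p).gl X) (0 + b)
    exact LinearMap.ext fun x => by rw [Subsingleton.elim x 0, _root_.map_zero, _root_.map_zero]
  | succ m ih =>
    intro X C V _ _ _ _ _ _ _ _ _ ι hX hVa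
    have : Module.Finite F C := Module.Finite.of_finite
    obtain ⟨e⟩ := exists_split (F := F) (X := X) (by omega)
    rw [hX, Nat.add_sub_cancel] at e
    let Y := Fin m → F
    have hY : Module.finrank F Y = m := Module.finrank_fin_fun _
    have hd : Module.finrank F V = m + 1 + Module.finrank F C := by
      have : Module.Finite F X := Module.Finite.of_finite
      rw [← ι.finrank_eq, Module.finrank_prod, hX]
    refine LinearMap.ext fun x => ?_
    obtain ⟨x, rfl⟩ := (constFn F p).conj_surj e a x
    obtain ⟨y, rfl⟩ := affCores_surj (constFn F p) Y a x
    have hinj := (affGM (constFn F p)).edge_inj (Y × C) a (fun i j hij hj => by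
      obtain ⟨j, rfl⟩ := Nat.exists_eq_add_of_le' hj
      refine hV i (by omega) (1 + (j + 1)) _ (affRed _ j) (affD1 const_CE (j + 1)) (by omega) _ ?_
      rw [Module.finrank_prod, hY]
      omega)
    let κ : ((Y × C) × F) ≃ₗ[F] V :=
      ((LinearEquiv.prodAssoc F Y C F).trans ((((LinearEquiv.refl F Y).prodCongr (LinearEquiv.prodComm F C F))).trans
        ((LinearEquiv.prodAssoc F Y F C).symm.trans (e.prodCongr (LinearEquiv.refl F C))))).trans ι
    let κ' : (Y × (C × F)) ≃ₗ[F] V := (LinearEquiv.prodAssoc F Y C F).symm.trans κ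
    have hκ : ∀ y c t, κ ((y, c), t) = ι (e (y, t), c) := fun _ _ _ => rfl
    have hκ' : ∀ y c t, κ' (y, c, t) = ι (e (y, t), c) := fun _ _ _ => rfl
    have h1 : ((sHom p ι).comp (((constFn F p).conj e).comp (affCores (constFn F p) Y))) =
        ((constFn F p).conj κ).comp ((affCores (constFn F p) (Y × C)).comp (parHom p Y C)) := by
      refine PHom.ext (MonoidHom.ext fun g => LinearEquiv.ext fun v => ?_) rfl
      obtain ⟨⟨⟨y, c⟩, t⟩, rfl⟩ := κ.surjective v
      change ι (e (emb Y g (e.symm (ι.symm (κ ((y, c), t))).1)), (ι.symm (κ ((y, c), t))).2) =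
        κ (emb (Y × C) (parBlk Y C g) (κ.symm (κ ((y, c), t))))
      rw [κ.symm_apply_apply, hκ, ι.symm_apply_apply, e.symm_apply_apply, emb_apply, emb_apply]
      refine Eq.trans ?_ (hκ _ _ _).symm
      congr 2
      change c = c + _ • 0
      rw [smul_zero, add_zero]
    have h2 : ((affGM (constFn F p)).edgeHom (Y × C)).comp ((leviIn p (Y × C)).comp (leviPr p (Y × C))) =
       (affGM (constFn F p)).edgeHom (Y × C) := PHom.ext rfl rfl
    have h3 : (leviIn p (Y × C)).map a ((leviPr p (Y × C)).map a ((parHom p Y C).map a y)) =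
        (parHom p Y C).map a y := by
      apply hinj
      rw [← PHom.map_comp_apply, ← PHom.map_comp_apply]
      exact congrArg (fun u => u.map a ((parHom p Y C).map a y)) h2
    have h4 : ((constFn F p).conj κ).comp ((affCores (constFn F p) (Y × C)).comp ((leviIn p (Y × C)).comp
        ((leviPr p (Y × C)).comp (parHom p Y C)))) = (sHom p κ').comp (leviPr p Y) := by
      refine PHom.ext (MonoidHom.ext fun g => LinearEquiv.ext fun v => ?_) rfl
      obtain ⟨⟨y, c, t⟩, rfl⟩ := κ'.surjective v
      have h5 : κ' (y, c, t) = κ ((y, c), t) := rfl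
      change κ (emb (Y × C) (inr (blk (LinearEquiv.refl F (Y × C)) g.right)) (κ.symm (κ' (y, c, t)))) =
        κ' (g.right (κ'.symm (κ' (y, c, t))).1, (κ'.symm (κ' (y, c, t))).2)
      rw [κ'.symm_apply_apply, h5, κ.symm_apply_apply, emb_apply]
      refine Eq.trans ?_ (hκ' _ _ _).symm
      refine Eq.trans ?_ (hκ _ _ _)
      congr 1
      change ((g.right y, c) + _ • (0 : Y × C), ((1 : Fˣ) : F) * t) = ((g.right y, c), t)
      rw [smul_zero, add_zero, Units.val_one, one_mul]
    have h1' := congrArg (fun u => u.map a y) h1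
    have h4' := congrArg (fun u => u.map a y) h4
    simp only [PHom.map_comp_apply] at h1' h4'
    rw [h1', ← h3, h4', ih Y (C × F) V κ' hY hVa]
    rfl

lemma const_van (a : ℕ) (ha : 0 < a) (hV : ∀ i, i < a → Van p F i) (V : Type) [AddCommGroup V]
    [Module F V] [Finite V] (h : a < Module.finrank F V) : Subsingleton (H ((constFn F p).gl V) a) := by
  have h1 := blk_zero p a ha hV (Module.finrank F V) V PUnit.{1} V (LinearEquiv.prodUnique) rfl h
  have h2 : sHom p (LinearEquiv.prodUnique (R := F) (M := V) (M₂ := PUnit.{1})) = PHom.id _ :=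
    PHom.ext rfl rfl
  rw [h2, PHom.map_id] at h1
  exact subsingleton_of_forall_eq 0 fun x => LinearMap.congr_fun h1 x

lemma triv_van (a : ℕ) (ha : 0 < a) (hV : ∀ i, i < a → Van p F i) (V : Type) [AddCommGroup V]
    [Module F V] [Finite V] (h : a < Module.finrank F V) (M : Type) [AddCommGroup M] [Module (ZMod p) M]
    [Finite M] : Subsingleton (H (triv (ZMod p) (V ≃ₗ[F] V) M) a) := by
  refine H_triv _ (fun g m => rfl) a ?_
  have h1 := const_van p a ha hV V h
  exact H_subsingleton_of_bij (ρ := (constFn F p).gl V) (LinearMap.id (M := ZMod p)) (fun _ _ => rfl)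
    Function.bijective_id a h1

end
end GH

namespace GH
open SemidirectProduct

section
variable {p : ℕ} [Fact p.Prime] {F : Type} [Field F] [Fintype F] [CharP F p]

/-- The composite of the edge morphism and the reduction. -/
noncomputable def edgeQ (T : Fn F (ZMod p)) (X : Type) [AddCommGroup X] [Module F X] :
    PHom ((affGM T).rep X) (triv (ZMod p) (X ≃ₗ[F] X) (((affGM T).Hj 0).obj PUnit.{1})) :=
  (((affGM T).Hj 0).redSES X).Q.comp ((affGM T).edgeHom X)

lemma edgeQ_inj (hF : 2 < Fintype.card F) (a N : ℕ) (hN : 1 ≤ N) (T : Fn F (ZMod p)) (hT : CE N T)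
    (hV : ∀ i, i < a → Van p F i)
    (X : Type) [AddCommGroup X] [Module F X] [Finite X] (hX : 2 * a + N ≤ 2 * Module.finrank F X + 2)
    (ih : ∀ N', 1 ≤ N' → N' < N → ∀ (T : Fn F (ZMod p)), Red T → CE N' T →
      2 * a + N' ≤ 2 * Module.finrank F X →
      Subsingleton (H (T.gl X) a)) :
    Function.Injective ((edgeQ T X).map a) := by
  have hinj := (affGM T).edge_inj X a (fun i j hij hj => by
    obtain ⟨j, rfl⟩ := Nat.exists_eq_add_of_le' hj
    rcases j with _ | j
    · exact hV i (by omega) N _ (affRed _ 0) (affD2 hF hN hT) hN _ (by omega)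
    · exact hV i (by omega) (N + (j + 1 + 1)) _ (affRed _ (j + 1)) (affD1 hT (j + 1 + 1)) (by omega) _ (by omega))
  have hred : Subsingleton (H (((affGM T).Hj 0).red.gl X) a) := by
    by_cases h3 : N ≤ 3
    · have h1 : CE 1 ((affGM T).Hj 0) := affD3 hF le_rfl (hT.mono h3)
      have := h1.red.one_sub le_rfl (Fn.red_red _) (X := X)
      exact H_subsingleton_of_subsingleton _ _
    · exact ih (N - 2) (by omega) (by omega) _ (Fn.red_red _) (affD3 hF (by omega) hT).red (by omega)
  rw [edgeQ, PHom.map_comp, LinearMap.coe_comp]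
  refine Function.Injective.comp ?_ hinj
  refine (injective_iff_map_eq_zero _).2 fun x hx => ?_
  obtain ⟨y, rfl⟩ := (SES.exact₂ _ _ _).1 hx
  rw [Subsingleton.elim y 0, map_zero]

lemma Fn.p_smul (T : Fn F (ZMod p)) {X : Type} [AddCommGroup X] [Module F X] (m : T.obj X) : p • m = 0 := by
  rw [← Nat.cast_smul_eq_nsmul (ZMod p)]
  simp

omit [CharP F p] in
lemma van_zero_aux [CharP F p] (hF : p ^ 2 ≤ Fintype.card F) {N : ℕ} {T : Fn F (ZMod p)} (hR : Red T) (hT : CE N T)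
    (X : Type) [AddCommGroup X] [Module F X] [Finite X] (hX : N ≤ 2 * Module.finrank F X + 2)
    (z : T.obj F) : H0mk (T.gl (X × F)) (T.map (LinearMap.inr F X F) z) = 0 := by
  classical
  have : Fintype (X × F) := Fintype.ofFinite _
  have : Module.Finite F X := Module.Finite.of_finite
  letI : Algebra (ZMod p) F := ZMod.algebra F p
  letI : Module (ZMod p) (X × F) := Module.compHom _ (algebraMap (ZMod p) F)
  let ψ : X × F → T.obj (X × F) := fun v => T.map (LinearMap.toSpanSingleton F _ v) z
  have hψ : PD N ψ := by
    have h1 : PD N (fun f : F →ₗ[F] X × F => T.map f) := hT.pd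
    let g : (X × F) →+ (F →ₗ[F] X × F) := 
      { toFun := fun v => LinearMap.toSpanSingleton F _ v
        map_zero' := by ext <;> simp
        map_add' := fun v w => by ext <;> simp }
    exact (h1.comp g).map (LinearMap.applyₗ z).toAddMonoidHom
  have hcardF : Fintype.card (X × F) = Fintype.card F ^ (Module.finrank F X + 1) := by
    rw [Module.card_eq_pow_finrank (K := F), Module.finrank_prod, Module.finrank_self]
  have hN : N ≤ Module.finrank (ZMod p) (X × F) := by
    refine hX.trans ?_
    have h1 := Module.card_eq_pow_finrank (K := ZMod p) (V := X × F)
    rw [hcardF, ZMod.card] at h1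
    have h2 := Nat.pow_le_pow_left hF (Module.finrank F X + 1)
    rw [h1, ← pow_mul] at h2
    have := (Nat.pow_le_pow_iff_right (Fact.out : p.Prime).one_lt).1 h2
    omega
  have hs := sum_pd (M := T.obj (X × F)) (fun m => T.p_smul m) hN ψ hψ
  have hz : ψ 0 = 0 := by
    change T.map (LinearMap.toSpanSingleton F _ 0) z = 0
    rw [LinearMap.toSpanSingleton_zero, hR.map_zero]; rfl
  have hc : ∀ v : X × F, v ≠ 0 → H0mk (T.gl (X × F)) (ψ v) = H0mk (T.gl (X × F)) (ψ (0, 1)) := by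
    intro v hv
    obtain ⟨g, hg⟩ : ∃ g : (X × F) ≃ₗ[F] (X × F), g (0, 1) = v := by
      have h0 : ((0 : X), (1 : F)) ≠ 0 := fun h => one_ne_zero (congrArg Prod.snd h)
      let e1 := LinearEquiv.toSpanNonzeroSingleton F (X × F) _ h0
      let e2 := LinearEquiv.toSpanNonzeroSingleton F (X × F) v hv
      obtain ⟨g, hg⟩ := Submodule.exists_linearEquiv_restrict_eq (e1.symm.trans e2)
      refine ⟨g, ?_⟩
      have h1 := hg (e1 1)
      have h2 : ((e1 1 : _) : X × F) = (0, 1) := one_smul F ((0 : X), (1 : F))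
      rw [h2, LinearEquiv.trans_apply, e1.symm_apply_apply] at h1
      rw [← h1]
      exact one_smul F v
    rw [← H0mk_smul _ g (ψ (0, 1)), Fn.gl_apply]
    change _ = H0mk _ (T.map (g : (X × F) →ₗ[F] (X × F)) (T.map _ z))
    rw [← T.map_comp_apply]
    change H0mk _ (T.map _ z) = _
    congr 3
    refine LinearMap.ext_ring ?_
    rw [LinearMap.toSpanSingleton_apply, one_smul, ← hg]
    change _ = g ((1 : F) • _)
    rw [one_smul]
  have h1 := congrArg (H0mk (T.gl (X × F))) hs
  rw [map_sum, ← Finset.add_sum_erase _ _ (Finset.mem_univ 0), hz, map_zero, zero_add,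
    Finset.sum_congr rfl (fun v hv => hc v (Finset.ne_of_mem_erase hv)), Finset.sum_const,
    Finset.card_erase_of_mem (Finset.mem_univ _), Finset.card_univ, hcardF,
    ← Nat.cast_smul_eq_nsmul (ZMod p), Nat.cast_sub (Nat.one_le_pow _ _ Fintype.card_pos)] at h1
  have h2 : (((Fintype.card F ^ (Module.finrank F X + 1) : ℕ)) : ZMod p) = 0 := by
    rw [Nat.cast_pow, pow_succ]
    have : ((Fintype.card F : ℕ) : ZMod p) = 0 := by
      rw [ZMod.natCast_eq_zero_iff]
      rw [← CharP.cast_eq_zero_iff F p]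
      exact Nat.cast_card_eq_zero F
    rw [this, mul_zero]
  rw [h2, Nat.cast_one, zero_sub, neg_smul, one_smul, neg_eq_zero] at h1
  refine Eq.trans ?_ h1
  change _ = H0mk _ (T.map _ z)
  congr 3
  refine LinearMap.ext_ring ?_
  rw [LinearMap.toSpanSingleton_apply, one_smul]
  rfl

lemma van_one (hF : p ^ 2 ≤ Fintype.card F) (hF2 : 2 < Fintype.card F) (N : ℕ) (hN : 1 ≤ N) (T : Fn F (ZMod p)) (hR : Red T)
    (hT : CE N T) (X : Type) [AddCommGroup X] [Module F X] [Finite X] (hX : N ≤ 2 * Module.finrank F X + 2)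
    (ih : ∀ N', 1 ≤ N' → N' < N → ∀ (T : Fn F (ZMod p)), Red T → CE N' T →
      2 * 0 + N' ≤ 2 * Module.finrank F X → Subsingleton (H (T.gl X) 0)) :
    Subsingleton (H (T.gl (X × F)) 0) := by
  have hinj := edgeQ_inj hF2 0 N hN T hT (fun i hi => by omega) X (by omega) ih
  refine subsingleton_of_forall_eq 0 fun x => ?_
  obtain ⟨m, rfl⟩ := H0mk_surjective _ x
  rw [← van_zero_aux hF hR hT X hX (T.map (LinearMap.snd F X F) m), ← T.map_comp_apply]
  let m' : T.obj (X × F) := T.map (LinearMap.inr F X F ∘ₗ LinearMap.snd F X F) m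
  have h1 : ∀ m : T.obj (X × F), (edgeQ T X).f m = (affGM T).mk0 PUnit.{1} (T.map ((0 : X →ₗ[F] PUnit.{1}).prodMap LinearMap.id) m) :=
    fun m => (affGM T).map_mk0 (0 : X →ₗ[F] PUnit.{1}) m
  have h2 : H0mk ((affGM T).rep X) m = H0mk ((affGM T).rep X) m' := by
    apply hinj
    refine (map_H0mk (edgeQ T X) m).trans (Eq.trans ?_ (map_H0mk (edgeQ T X) m').symm)
    refine congrArg _ ((h1 m).trans (Eq.trans ?_ (h1 m').symm))
    congr 1
    refine Eq.trans ?_ (T.map_comp_apply _ _ m)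
    rfl
  have h3 := congrArg ((affCores T X).map 0) h2
  exact (map_H0mk (affCores T X) m).symm.trans (h3.trans (map_H0mk (affCores T X) m'))

lemma van_sub (hF2 : 2 < Fintype.card F) (h0 : Van p F 0) (N : ℕ) (hN : N ≤ 2) (T : Fn F (ZMod p)) (hR : Red T)
    (hT : CE N T) : Subsingleton (((affGM T).Hj 0).obj PUnit.{1}) := by
  have h1 : Subsingleton (H (T.gl (PUnit.{1} × F)) 0) := h0 2 T hR (hT.mono hN) (by omega) _ (by
    rw [Module.finrank_prod, Module.finrank_self]
    simp)
  refine subsingleton_of_forall_eq 0 fun x => ?_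
  obtain ⟨m, rfl⟩ := (affGM T).mk0_surj _ x
  let f : T.obj (PUnit.{1} × F) →ₗ[ZMod p] ((affGM T).Hj 0).obj PUnit.{1} := (affGM T).mk0 PUnit.{1}
  refine H0_lift (T.gl (PUnit.{1} × F)) f (fun g m => ?_) (m := m) (Subsingleton.elim _ _)
  have hs : (g (PUnit.unit, 1)).2 ≠ 0 := fun h => by
    have h2 : g (PUnit.unit, 1) = g 0 := by rw [map_zero]; exact Prod.ext rfl h
    exact one_ne_zero (congrArg Prod.snd (g.injective h2))
  let a : Aff F PUnit.{1} := ⟨0, Units.mk0 _ hs⟩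
  have ha : (g : (PUnit.{1} × F) →ₗ[F] (PUnit.{1} × F)) = Aff.lin _ a := by
    refine LinearMap.ext fun v => Prod.ext rfl ?_
    rw [Aff.lin_apply]
    have : v = v.2 • (PUnit.unit, 1) := Prod.ext rfl (mul_one v.2).symm
    change (g v).2 = (g (PUnit.unit, 1)).2 * v.2
    conv_lhs => rw [this, map_smul]
    exact mul_comm _ _
  rw [Fn.gl_apply, ha]
  exact (affGM T).mk0_smul (X := PUnit.{1}) a m

lemma van_all (hF : p ^ 2 ≤ Fintype.card F) (a : ℕ) : Van p F a := by
  have hF2 : 2 < Fintype.card F := by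
    have := (Fact.out : p.Prime).two_le
    nlinarith
  induction a using Nat.strong_induction_on with
  | _ a iha =>
  intro N
  induction N using Nat.strong_induction_on with
  | _ N ihN =>
  intro T hR hT hN V _ _ _ hVN
  have : Module.Finite F V := Module.Finite.of_finite
  obtain ⟨e⟩ := exists_split (F := F) (X := V) (by omega)
  refine T.gl_transfer e ?_
  have hX : Module.finrank F (Fin (Module.finrank F V - 1) → F) = Module.finrank F V - 1 :=
    Module.finrank_fin_fun _
  let X := Fin (Module.finrank F V - 1) → F
  change Subsingleton (H (T.gl (X × F)) a)
  change Module.finrank F X = _ at hX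
  have ih : ∀ N', 1 ≤ N' → N' < N → ∀ (T : Fn F (ZMod p)), Red T → CE N' T →
      2 * a + N' ≤ 2 * Module.finrank F X → Subsingleton (H (T.gl X) a) :=
    fun N' h1 h2 T h3 h4 h5 => ihN N' h2 T h3 h4 h1 X h5
  rcases Nat.eq_zero_or_pos a with rfl | ha
  · exact van_one hF hF2 N hN T hR hT X (by omega) ih
  · have hinj := edgeQ_inj hF2 a N hN T hT iha X (by omega) ih
    have hsub : Subsingleton (H (triv (ZMod p) (X ≃ₗ[F] X) (((affGM T).Hj 0).obj PUnit.{1})) a) := by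
      by_cases h2 : N ≤ 2
      · have := van_sub hF2 (iha 0 ha) N h2 T hR hT
        exact H_subsingleton_of_subsingleton _ _
      · have : Finite (((affGM T).Hj 0).obj PUnit.{1}) := ((affGM T).Hj 0).fin _
        exact triv_van p a ha iha X (by omega) _
    have := hinj.subsingleton
    exact (affCores_surj T X a).subsingleton

lemma const_all (hF : p ^ 2 ≤ Fintype.card F) (a : ℕ) (ha : 0 < a) (V : Type) [AddCommGroup V]
    [Module F V] [Finite V] (h : a < Module.finrank F V) (M : Type) [AddCommGroup M] [Module (ZMod p) M]
    [Finite M] : Subsingleton (H (triv (ZMod p) (V ≃ₗ[F] V) M) a) :=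
  triv_van p a ha (fun i _ => van_all hF i) V h M

end
end GH

namespace GH

section comb2

lemma one_sub_prod_mem {R S : Type} [CommRing R] [DecidableEq S] (I : Ideal R) (a : S → R) (A : Finset S)
    (h : ∀ s ∈ A, 1 - a s ∈ I) : 1 - ∏ s ∈ A, a s ∈ I := by
  induction A using Finset.induction_on with
  | empty => simp
  | insert s A hs ih =>
    rw [Finset.prod_insert hs]
    have h1 := h s (Finset.mem_insert_self _ _)
    have h2 := ih fun s hs => h s (Finset.mem_insert_of_mem hs)
    have : 1 - a s * ∏ s ∈ A, a s = (1 - a s) + a s * (1 - ∏ s ∈ A, a s) := by ring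
    rw [this]
    exact I.add_mem h1 (I.mul_mem_left _ h2)

lemma comb2 {R S ι : Type} [CommRing R] [DecidableEq S] [DecidableEq ι] (J : Ideal R) (a : S → R) (y : ι → R)
    (rel : ι → S → Prop) (hy : ∀ i, y i ∈ Ideal.span {z | ∃ s, rel i s ∧ z = a s}) (s0 : Finset ι)
    (h : ∀ t : Finset S, (∀ i ∈ s0, ∃ s ∈ t, rel i s) → ∏ s ∈ t, a s ∈ J) : ∏ i ∈ s0, y i ∈ J := by
  have key : ∀ u : Finset ι, ∀ t : Finset S, (∀ i ∈ s0, i ∉ u → ∃ s ∈ t, rel i s) →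
      (∏ s ∈ t, a s) * ∏ i ∈ u, y i ∈ J := by
    intro u
    induction u using Finset.induction_on with
    | empty =>
      intro t ht
      rw [Finset.prod_empty, mul_one]
      exact h t fun i hi => ht i hi (Finset.notMem_empty i)
    | insert i u hi ih =>
      intro t ht
      rw [Finset.prod_insert hi]
      have h2 : ∀ z ∈ Ideal.span {z | ∃ s, rel i s ∧ z = a s}, (∏ s ∈ t, a s) * (z * ∏ i ∈ u, y i) ∈ J := by
        intro z hz
        induction hz using Submodule.span_induction with
        | mem z hz =>
          obtain ⟨s, hs, rfl⟩ := hz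
          by_cases hst : s ∈ t
          · have := ih t (fun i' hi' hu => by
              by_cases hii : i' = i
              · subst hii; exact ⟨s, hst, hs⟩
              · exact ht i' hi' (by simp [hii, hu]))
            have := J.mul_mem_left (a s) this
            convert this using 1; ring
          · have := ih (insert s t) (fun i' hi' hu => by
              by_cases hii : i' = i
              · subst hii; exact ⟨s, Finset.mem_insert_self _ _, hs⟩
              · obtain ⟨s', h1, h2⟩ := ht i' hi' (by simp [hii, hu])
                exact ⟨s', Finset.mem_insert_of_mem h1, h2⟩)
            rw [Finset.prod_insert hst] at this
            convert this using 1; ring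
        | zero => simp
        | add x z _ _ hx hz =>
          have := J.add_mem hx hz
          convert this using 1; ring
        | smul c x _ hx =>
          have := J.mul_mem_left c hx
          rw [smul_eq_mul]
          convert this using 1; ring
      exact h2 _ (hy i)
  have := key s0 ∅ (fun i h1 h2 => (h2 h1).elim)
  simpa using this

end comb2

/-- Antihermitian forms on the dual space. -/
def AH {F : Type} [Field F] (σ : F →+* F) (X : Type) [AddCommGroup X] [Module F X] :
    AddSubgroup ((X →ₗ[F] F) → (X →ₗ[F] F) → F) where
  carrier := {b | (∀ κ κ' μ, b (κ + κ') μ = b κ μ + b κ' μ) ∧ (∀ (c : F) κ μ, b (c • κ) μ = c * b κ μ) ∧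
    ∀ κ μ, b μ κ = - σ (b κ μ)}
  zero_mem' := ⟨by simp, by simp, by simp⟩
  add_mem' := by
    rintro b b' ⟨h1, h2, h3⟩ ⟨h1', h2', h3'⟩
    refine ⟨fun κ κ' μ => ?_, fun c κ μ => ?_, fun κ μ => ?_⟩
    · simp only [Pi.add_apply, h1, h1']; ring
    · simp only [Pi.add_apply, h2, h2']; ring
    · simp only [Pi.add_apply, h3 κ μ, h3' κ μ, map_add]; ring
  neg_mem' := by
    rintro b ⟨h1, h2, h3⟩
    refine ⟨fun κ κ' μ => ?_, fun c κ μ => ?_, fun κ μ => ?_⟩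
    · simp only [Pi.neg_apply, h1]; ring
    · simp only [Pi.neg_apply, h2]; ring
    · simp only [Pi.neg_apply, h3 κ μ, map_neg]

namespace AH
section
variable {F : Type} [Field F] {σ : F →+* F} {X Y Z : Type} [AddCommGroup X] [Module F X]
  [AddCommGroup Y] [Module F Y] [AddCommGroup Z] [Module F Z]

lemma ext' {b b' : AH σ X} (h : ∀ κ μ, b.1 κ μ = b'.1 κ μ) : b = b' :=
  Subtype.ext (funext fun κ => funext fun μ => h κ μ)

lemma add_left (b : AH σ X) (κ κ' μ) : b.1 (κ + κ') μ = b.1 κ μ + b.1 κ' μ := b.2.1 _ _ _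
lemma smul_left (b : AH σ X) (c : F) (κ μ) : b.1 (c • κ) μ = c * b.1 κ μ := b.2.2.1 _ _ _
lemma anti (b : AH σ X) (κ μ) : b.1 μ κ = - σ (b.1 κ μ) := b.2.2.2 _ _
lemma add_right (b : AH σ X) (κ μ μ') : b.1 κ (μ + μ') = b.1 κ μ + b.1 κ μ' := by
  rw [anti, add_left, map_add, anti b μ κ, anti b μ' κ]; ring
lemma zero_left (b : AH σ X) (μ) : b.1 0 μ = 0 := by simpa using smul_left b 0 0 μ
lemma zero_right (b : AH σ X) (μ) : b.1 μ 0 = 0 := by rw [anti, zero_left]; simp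

/-- Linearity in the first variable. -/
def linL (b : AH σ X) (μ : X →ₗ[F] F) : (X →ₗ[F] F) →ₗ[F] F where
  toFun κ := b.1 κ μ
  map_add' κ κ' := add_left b κ κ' μ
  map_smul' c κ := smul_left b c κ μ

/-- Additivity in the second variable. -/
def addR (b : AH σ X) (κ : X →ₗ[F] F) : (X →ₗ[F] F) →+ F where
  toFun μ := b.1 κ μ
  map_zero' := zero_right b κ
  map_add' μ μ' := add_right b κ μ μ'

lemma sum_left (b : AH σ X) {ι : Type} (s : Finset ι) (κ : ι → (X →ₗ[F] F)) (μ) :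
    b.1 (∑ i ∈ s, κ i) μ = ∑ i ∈ s, b.1 (κ i) μ := map_sum (linL b μ) κ s
lemma sum_right (b : AH σ X) {ι : Type} (s : Finset ι) (μ : ι → (X →ₗ[F] F)) (κ) :
    b.1 κ (∑ i ∈ s, μ i) = ∑ i ∈ s, b.1 κ (μ i) := map_sum (addR b κ) μ s

/-- Functoriality. -/
def map (f : X →ₗ[F] Y) : AH σ X →+ AH σ Y where
  toFun b := ⟨fun κ μ => b.1 (κ ∘ₗ f) (μ ∘ₗ f), fun κ κ' μ => by
      change b.1 ((κ + κ') ∘ₗ f) _ = _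
      rw [LinearMap.add_comp]
      exact add_left b _ _ _,
    fun c κ μ => by
      change b.1 ((c • κ) ∘ₗ f) _ = _
      rw [LinearMap.smul_comp]
      exact smul_left b _ _ _, fun κ μ => anti b _ _⟩
  map_zero' := rfl
  map_add' _ _ := rfl

lemma map_apply (f : X →ₗ[F] Y) (b : AH σ X) (κ μ) : (map f b).1 κ μ = b.1 (κ ∘ₗ f) (μ ∘ₗ f) := rfl

variable {O : Type} [Fintype O] [DecidableEq O] {E : O → Module.End F Y}

/-- Weighted sum of components. -/
def wtFun (E : O → Module.End F Y) (w : Sym2 O → ℤ) (b : AH σ Y) : AH σ Y :=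
  ⟨fun κ μ => ∑ q : O × O, w s(q.1, q.2) • b.1 (κ ∘ₗ E q.1) (μ ∘ₗ E q.2), 
    fun κ κ' μ => by
      rw [← Finset.sum_add_distrib]
      refine Finset.sum_congr rfl fun q _ => ?_
      rw [LinearMap.add_comp, add_left, smul_add],
    fun c κ μ => by
      rw [Finset.mul_sum]
      refine Finset.sum_congr rfl fun q _ => ?_
      rw [LinearMap.smul_comp, smul_left, mul_smul_comm],
    fun κ μ => by
      rw [map_sum, ← Finset.sum_neg_distrib, ← (Equiv.prodComm O O).sum_comp]
      refine Finset.sum_congr rfl fun q _ => ?_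
      simp only [Equiv.prodComm_apply, Prod.fst_swap, Prod.snd_swap]
      rw [Sym2.eq_swap, anti b, map_zsmul, smul_neg]⟩

lemma wtFun_apply (w : Sym2 O → ℤ) (b : AH σ Y) (κ μ) :
  (wtFun E w b).1 κ μ = ∑ q : O × O, w s(q.1, q.2) • b.1 (κ ∘ₗ E q.1) (μ ∘ₗ E q.2) := rfl

/-- Weighted sum of components, as a ring homomorphism. -/
def wt (idem : ∀ i, E i * E i = E i) (orth : ∀ i j, i ≠ j → E i * E j = 0) (tot : ∑ i, E i = 1) :
    (Sym2 O → ℤ) →+* AddMonoid.End (AH σ Y) where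
  toFun w := 
    { toFun := wtFun E w
      map_zero' := ext' fun κ μ => by
        rw [wtFun_apply]
        exact Finset.sum_eq_zero fun q _ => smul_zero _
      map_add' := fun b b' => ext' fun κ μ => by
        change (wtFun E w (b + b')).1 κ μ = (wtFun E w b).1 κ μ + (wtFun E w b').1 κ μ
        simp only [wtFun_apply]
        rw [← Finset.sum_add_distrib]
        exact Finset.sum_congr rfl fun q _ => smul_add _ _ _ }
  map_one' := AddMonoidHom.ext fun b => ext' fun κ μ => by
    change (wtFun E 1 b).1 κ μ = b.1 κ μ
    rw [wtFun_apply, Fintype.sum_prod_type]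
    simp only [Pi.one_apply, one_smul]
    simp_rw [← sum_right]
    rw [← sum_left]
    have : ∀ ν : Y →ₗ[F] F, ∑ i, ν ∘ₗ E i = ν := fun ν => by
      refine LinearMap.ext fun y => ?_
      rw [LinearMap.sum_apply]
      simp only [LinearMap.comp_apply]
      rw [← map_sum, ← LinearMap.sum_apply, tot]
      rfl
    rw [this, this]
  map_mul' w v := AddMonoidHom.ext fun b => ext' fun κ μ => by
    change (wtFun E (w * v) b).1 κ μ = (wtFun E w (wtFun E v b)).1 κ μ
    simp only [wtFun_apply]
    refine Finset.sum_congr rfl fun q _ => ?_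
    rw [Finset.sum_eq_single q]
    · rw [smul_smul, LinearMap.comp_assoc, LinearMap.comp_assoc, ← Module.End.mul_eq_comp, idem, ← Module.End.mul_eq_comp, idem]
      rfl
    · intro q' _ hq
      rw [LinearMap.comp_assoc, LinearMap.comp_assoc, ← Module.End.mul_eq_comp, ← Module.End.mul_eq_comp]
      by_cases h1 : q.1 = q'.1
      · rw [orth q.2 q'.2 (fun h2 => hq (Prod.ext h1.symm h2.symm)), LinearMap.comp_zero, zero_right, smul_zero]
      · rw [orth q.1 q'.1 h1, LinearMap.comp_zero, zero_left, smul_zero]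
    · simp
  map_zero' := AddMonoidHom.ext fun b => ext' fun κ μ => by
    change (wtFun E 0 b).1 κ μ = 0
    rw [wtFun_apply]
    exact Finset.sum_eq_zero fun q _ => zero_smul _ _
  map_add' w v := AddMonoidHom.ext fun b => ext' fun κ μ => by
    change (wtFun E (w + v) b).1 κ μ = (wtFun E w b).1 κ μ + (wtFun E v b).1 κ μ
    simp only [wtFun_apply]
    rw [← Finset.sum_add_distrib]
    exact Finset.sum_congr rfl fun q _ => add_smul _ _ _

lemma wt_apply (idem : ∀ i, E i * E i = E i) (orth : ∀ i j, i ≠ j → E i * E j = 0) (tot : ∑ i, E i = 1)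
    (w : Sym2 O → ℤ) (b : AH σ Y) : wt idem orth tot w b = wtFun E w b := rfl

/-- The weight removing an index. -/
def rm (i : O) : Sym2 O → ℤ := fun s => if i ∈ s then 0 else 1

lemma wt_rm (idem : ∀ i, E i * E i = E i) (orth : ∀ i j, i ≠ j → E i * E j = 0) (tot : ∑ i, E i = 1)
    (i : O) (b : AH σ Y) : wt idem orth tot (rm i) b = map (1 - E i) b := by
  refine ext' fun κ μ => ?_
  have : 1 - E i = ∑ j, (if i = j then (0 : ℤ) else 1) • E j := by
    rw [← tot, sub_eq_iff_eq_add, ← Finset.add_sum_erase _ _ (Finset.mem_univ i), add_comm,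
      ← Finset.add_sum_erase Finset.univ (fun j => (if i = j then (0 : ℤ) else 1) • E j) (Finset.mem_univ i)]
    rw [if_pos rfl, zero_smul, zero_add]
    congr 1
    refine Finset.sum_congr rfl fun j hj => ?_
    rw [if_neg (Finset.ne_of_mem_erase hj).symm, one_smul]
  have h2 : ∀ ν : Y →ₗ[F] F, ν ∘ₗ (1 - E i) = ∑ j, (if i = j then (0 : ℤ) else 1) • (ν ∘ₗ E j) := by
    intro ν
    rw [this]
    refine LinearMap.ext fun y => ?_
    simp only [LinearMap.sum_apply, LinearMap.comp_apply, map_sum, LinearMap.smul_apply, map_zsmul]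
  rw [map_apply, wt_apply, wtFun_apply, h2, h2, sum_left, Fintype.sum_prod_type]
  refine Finset.sum_congr rfl fun a _ => ?_
  rw [sum_right]
  refine Finset.sum_congr rfl fun c _ => ?_
  change (rm i s(a, c)) • _ = _
  simp only [rm, Sym2.mem_iff]
  by_cases h1 : i = a
  · simp [h1, zero_left]
  · by_cases h3 : i = c
    · simp [h3, zero_right]
    · simp [h1, h3]

end
end AH

end GH

namespace GH

section herm
variable {p : ℕ} [Fact p.Prime] {F : Type} [Field F] [Fintype F] [CharP F p]

/-- Antihermitian forms as a group-valued functor. -/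
def hermGF (σ : F →+* F) : GF F where
  obj X := Multiplicative (AH σ X)
  grp X := inferInstance
  map f := AddMonoidHom.toMultiplicative (AH.map f)
  map_id _ _ _ _ := rfl
  map_comp _ _ _ := rfl
  fin X _ _ _ := by
    have : Finite (X →ₗ[F] F) := inferInstance
    change Finite (AH σ X)
    infer_instance

/-- Constant coefficients. -/
def hermGM (p : ℕ) [Fact p.Prime] (σ : F →+* F) : GM (hermGF σ) (ZMod p) where
  T := constFn F p
  ρ X := 1
  comm _ _ _ := rfl

omit [CharP F p] in
lemma hermRed (σ : F →+* F) (j : ℕ) : Red ((hermGM p σ).Hj (j + 1)) := by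
  classical
  have h0 : Subsingleton (AH σ PUnit.{1}) := ⟨fun b b' => AH.ext' fun κ μ => by
    have : κ = 0 := LinearMap.ext fun x => by
      exact κ.map_zero
    rw [this, AH.zero_left, AH.zero_left]⟩
  have h1 : Fintype (Multiplicative (AH σ PUnit.{1})) := ⟨{1}, fun x => by
    rw [Finset.mem_singleton]; exact h0.elim _ _⟩
  refine H_coprime (G := Multiplicative (AH σ PUnit.{1})) ?_ ((hermGM p σ).ρ PUnit.{1}) j
  have : Fintype.card (Multiplicative (AH σ PUnit.{1})) = 1 := Fintype.card_eq_one_iff.2 ⟨1, fun x => h0.elim _ _⟩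
  rw [this]; simp

/-- The weight killing one index. -/
def piS {S : Type} [DecidableEq S] (s : S) : S → ℤ := 1 - Pi.single s 1

lemma rm_prod {O : Type} [Fintype O] [DecidableEq O] (i : O) :
    AH.rm i = ∏ s ∈ Finset.univ.filter (fun s : Sym2 O => i ∈ s), piS s := by
  ext q
  rw [Finset.prod_apply]
  by_cases h : i ∈ q
  · rw [AH.rm, if_pos h]
    symm
    exact Finset.prod_eq_zero (i := q) (by simpa using h) (by simp [piS])
  · rw [AH.rm, if_neg h]
    symm
    refine Finset.prod_eq_one fun s hs => ?_
    have : q ≠ s := fun e => h (by rw [e]; simpa using hs)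
    simp [piS, this]

lemma cover_card {ι : Type} [DecidableEq ι] (s : Finset ι) (t : Finset (Sym2 (Option ι)))
    (h : ∀ i ∈ s, ∃ q ∈ t, some i ∈ q) : s.card ≤ 2 * t.card := by
  classical
  have h1 : s.image some ⊆ t.biUnion (fun q => q.toFinset) := by
    intro o ho
    obtain ⟨i, hi, rfl⟩ := Finset.mem_image.1 ho
    obtain ⟨q, hq, hiq⟩ := h i hi
    exact Finset.mem_biUnion.2 ⟨q, hq, Sym2.mem_toFinset.2 hiq⟩
  have h2 := Finset.card_le_card h1
  rw [Finset.card_image_of_injective _ (Option.some_injective _)] at h2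
  have h3 : (t.biUnion (fun q => q.toFinset)).card ≤ t.card * 2 :=
    Finset.card_biUnion_le_card_mul _ _ _ fun q _ => by
      rw [Sym2.card_toFinset]; split_ifs <;> omega
  omega

section
variable {Y : Type} [AddCommGroup Y] [Module F Y] {ι : Type} [Fintype ι] [DecidableEq ι]
    (e : ι → Module.End F Y)

/-- Completed family of idempotents. -/
def cpE : Option ι → Module.End F Y := fun o => o.elim (1 - ∑ i, e i) e

variable {e} (idem : ∀ i, e i * e i = e i) (orth : ∀ i j, i ≠ j → e i * e j = 0)

omit [Fintype F] in
include idem orth in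
lemma cp_sum (i : ι) : e i * ∑ j, e j = e i := by
  rw [Finset.mul_sum, Finset.sum_eq_single i, idem]
  · exact fun j _ hj => orth i j hj.symm
  · simp

omit [Fintype F] in
include idem orth in
lemma cp_sum' (i : ι) : (∑ j, e j) * e i = e i := by
  rw [Finset.sum_mul, Finset.sum_eq_single i, idem]
  · exact fun j _ hj => orth j i hj
  · simp

omit [Fintype F] in
include idem orth in
lemma cpE_idem : ∀ i, cpE e i * cpE e i = cpE e i := by
  rintro (_ | i)
  · change (1 - ∑ i, e i) * (1 - ∑ i, e i) = 1 - ∑ i, e i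
    have : (∑ i, e i) * (∑ i, e i) = ∑ i, e i := by
      conv_lhs => rw [Finset.sum_mul]
      exact Finset.sum_congr rfl fun i _ => cp_sum idem orth i
    rw [sub_mul, mul_sub, mul_sub, this]; simp
  · exact idem i

omit [Fintype F] in
include idem orth in
lemma cpE_orth : ∀ i j, i ≠ j → cpE e i * cpE e j = 0 := by
  rintro (_ | i) (_ | j) h
  · exact absurd rfl h
  · change (1 - ∑ i, e i) * e j = 0
    rw [sub_mul, cp_sum' idem orth, one_mul, sub_self]
  · change e i * (1 - ∑ i, e i) = 0
    rw [mul_sub, cp_sum idem orth, mul_one, sub_self]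
  · exact orth i j (fun h' => h (by rw [h']))

omit [Fintype F] in
lemma cpE_tot : ∑ i, cpE e i = 1 := by
  rw [Fintype.sum_option]
  change (1 - ∑ i, e i) + ∑ i, e i = 1
  simp

end

omit [CharP F p] in
lemma hermCE (σ : F →+* F) (j : ℕ) : CE (2 * j + 1) ((hermGM p σ).Hj j) := by
  intro Y _ _ _ ι _ _ e idem orth s hs
  classical
  let w : (Sym2 (Option ι) → ℤ) →+* AddMonoid.End (AH σ Y) :=
    AH.wt (cpE_idem idem orth) (cpE_orth idem orth) cpE_tot
  let φ : (Sym2 (Option ι) → ℤ) →* AddMonoid.End (AH σ Y) := w.toMonoidHom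
  let ρ : Representation (ZMod p) (Multiplicative (AH σ Y)) (ZMod p) := 1
  let ν : Representation (ZMod p) (Sym2 (Option ι) → ℤ) (ZMod p) := 1
  have hC : Compat φ ρ ν := fun _ _ _ => rfl
  have key : ∏ i ∈ s, om (ZMod p) (AH.rm (some i)) ∈ RingHom.ker (hC.rep j).asAlgebraHom := by
    refine comb2 _ (fun S => om (ZMod p) (piS S)) _ (fun i S => some i ∈ S) ?_ s ?_
    · intro i
      change 1 - MonoidAlgebra.of (ZMod p) _ (AH.rm (some i)) ∈ _
      rw [rm_prod, map_prod]
      refine one_sub_prod_mem _ (fun S => MonoidAlgebra.of (ZMod p) _ (piS S)) _ fun S hS => ?_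
      exact Ideal.subset_span ⟨S, by simpa using hS, rfl⟩
    · intro t ht
      rw [RingHom.mem_ker]
      refine LinearMap.ext fun x => ?_
      refine lemmaK (φ := φ) (e := fun S => w (Pi.single S 1)) (π := piS) ?_ ?_ ?_ ?_ j t hC (fun _ _ => ⟨fun _ => rfl, fun _ _ => rfl⟩) ?_ x
      · intro S b
        change w (1 - Pi.single S 1) b = _
        rw [map_sub, map_one]; rfl
      · intro S b
        change (w (Pi.single S 1) * w (Pi.single S 1)) b = _
        rw [← map_mul, ← Pi.single_mul, one_mul]
      · intro S S' hSS b
        change (w (Pi.single S 1) * w (Pi.single S' 1)) b = _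
        have h0 : (Pi.single S 1 * Pi.single S' 1 : Sym2 (Option ι) → ℤ) = 0 := by
          ext q
          by_cases hq : q = S
          · subst hq; simp [hSS]
          · simp [hq]
        rw [← map_mul, h0, map_zero]; rfl
      · intro v S b
        change (w v * w (Pi.single S 1)) b = (w (Pi.single S 1) * w v) b
        rw [← map_mul, mul_comm, map_mul]
      · have := cover_card s t ht
        omega
  rw [CE_prod]
  rw [RingHom.mem_ker, ← Finset.prod_map_toList, map_list_prod, List.map_map] at key
  refine Eq.trans ?_ key
  congr 1
  refine List.map_congr_left fun i _ => ?_
  refine LinearMap.ext fun (m : H ρ j) => ?_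
  refine Eq.trans ?_ (om_apply (hC.rep j) _ m).symm
  refine congrArg (fun L : H ρ j →ₗ[ZMod p] H ρ j => m - L m) 
    (PHom.map_congr (u := (hermGM p σ).hom (1 - e i)) (v := hC.hom (AH.rm (some i))) ?_ rfl j)
  refine MonoidHom.ext fun b => ?_
  exact (AH.wt_rm (cpE_idem idem orth) (cpE_orth idem orth) cpE_tot (some i) b).symm

end herm
end GH

namespace GH

namespace Siegel
variable {F : Type} [Field F] (σ : F →+* F) (n : ℕ)

/-- First half of the coordinates. -/
def px : (Fin n → F × F) →ₗ[F] (Fin n → F) where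
  toFun v i := (v i).1
  map_add' _ _ := rfl
  map_smul' _ _ := rfl

variable {n}

/-- Second half of the coordinates, as a linear form. -/
def lam (v : Fin n → F × F) : (Fin n → F) →ₗ[F] F := ∑ i, σ (v i).2 • LinearMap.proj i

lemma lam_apply (v : Fin n → F × F) (x : Fin n → F) : lam σ v x = ∑ i, σ (v i).2 * x i := by
  simp [lam, LinearMap.sum_apply]

lemma lam_add (v w : Fin n → F × F) : lam σ (v + w) = lam σ v + lam σ w := by
  refine LinearMap.ext fun x => ?_
  simp [lam_apply, add_mul, Finset.sum_add_distrib]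

lemma lam_smul (c : F) (v : Fin n → F × F) : lam σ (c • v) = σ c • lam σ v := by
  refine LinearMap.ext fun x => ?_
  simp [lam_apply, Finset.mul_sum, mul_assoc]

/-- The vector with given halves. -/
def mk (x : Fin n → F) (μ : (Fin n → F) →ₗ[F] F) : Fin n → F × F := 
  fun i => (x i, σ (μ (Pi.single i 1)))

@[simp] lemma px_mk (x : Fin n → F) (μ) : px n (mk σ x μ) = x := rfl

lemma form_eq (κ : (Fin n → F) →ₗ[F] F) (x : Fin n → F) : κ x = ∑ i, κ (Pi.single i 1) * x i := by
  have : x = ∑ i, x i • (Pi.single i (1 : F) : Fin n → F) := by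
    ext j
    simp [Finset.sum_apply, Pi.single_apply]
  conv_lhs => rw [this]
  rw [map_sum]
  exact Finset.sum_congr rfl fun i _ => by rw [map_smul, smul_eq_mul, mul_comm]

lemma omega_eq (hσ : ∀ x, σ (σ x) = x) (v w : Fin n → F × F) : pairForm F (hermPair F σ) n v w =
    σ (lam σ w (px n v)) + lam σ v (px n w) := by
  rw [lam_apply, lam_apply, map_sum, ← Finset.sum_add_distrib]
  refine Finset.sum_congr rfl fun i _ => ?_
  rw [map_mul, hσ]
  change σ (v i).1 * (w i).2 + σ (v i).2 * (w i).1 = (w i).2 * σ (v i).1 + _ * (w i).1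
  ring

lemma mk_add (x x' : Fin n → F) (μ μ') : mk σ (x + x') (μ + μ') = mk σ x μ + mk σ x' μ' := by
  ext i <;> simp [mk]

variable {σ}

lemma lam_mk (hσ : ∀ x, σ (σ x) = x) (x : Fin n → F) (μ) : lam σ (mk σ x μ) = μ := by
  refine LinearMap.ext fun y => ?_
  rw [lam_apply, form_eq μ]
  exact Finset.sum_congr rfl fun i _ => congrArg (· * y i) (hσ _)

lemma mk_eta (hσ : ∀ x, σ (σ x) = x) (v : Fin n → F × F) : mk σ (px n v) (lam σ v) = v := by
  funext i
  refine Prod.ext rfl ?_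
  change σ (lam σ v (Pi.single i 1)) = _
  rw [lam_apply]
  simp [Pi.single_apply, hσ]

lemma ext2 (hσ : ∀ x, σ (σ x) = x) {v w : Fin n → F × F} (h1 : px n v = px n w) (h2 : lam σ v = lam σ w) :
    v = w := by rw [← mk_eta hσ v, ← mk_eta hσ w, h1, h2]

/-- The adjoint of a form. -/
def sharp (b : AH σ (Fin n → F)) (μ : (Fin n → F) →ₗ[F] F) : Fin n → F := fun i => b.1 (LinearMap.proj i) μ

lemma form_sharp (b : AH σ (Fin n → F)) (κ μ) : κ (sharp b μ) = b.1 κ μ := by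
  have : κ = ∑ i, κ (Pi.single i 1) • (LinearMap.proj i : (Fin n → F) →ₗ[F] F) := by
    refine LinearMap.ext fun x => ?_
    rw [form_eq κ x]
    simp [LinearMap.sum_apply]
  conv_rhs => rw [this]
  rw [AH.sum_left, form_eq]
  exact Finset.sum_congr rfl fun i _ => (AH.smul_left b _ _ _).symm

lemma eq_of_forms {x y : Fin n → F} (h : ∀ κ : (Fin n → F) →ₗ[F] F, κ x = κ y) : x = y :=
  funext fun i => h (LinearMap.proj i)

lemma sharp_add (b : AH σ (Fin n → F)) (μ μ') : sharp b (μ + μ') = sharp b μ + sharp b μ' :=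
  funext fun _ => AH.add_right _ _ _ _

lemma sharp_add' (b b' : AH σ (Fin n → F)) (μ) : sharp (b + b') μ = sharp b μ + sharp b' μ := rfl

lemma sharp_zero (b : AH σ (Fin n → F)) : sharp b 0 = 0 :=
  funext fun _ => AH.zero_right _ _

lemma sharp_smul (hσ : ∀ x, σ (σ x) = x) (b : AH σ (Fin n → F)) (c : F) (μ) :
    sharp b (σ c • μ) = c • sharp b μ :=
  funext fun i => by
    change b.1 _ _ = c * b.1 _ _
    rw [AH.anti, AH.smul_left, map_mul, hσ, AH.anti b μ]
    ring

lemma sharp_map (g : (Fin n → F) ≃ₗ[F] (Fin n → F)) (b : AH σ (Fin n → F)) (μ) :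
    g (sharp b μ) = sharp (AH.map (g : (Fin n → F) →ₗ[F] (Fin n → F)) b) (μ ∘ₗ (g.symm : (Fin n → F) →ₗ[F] (Fin n → F))) := by
  refine eq_of_forms fun κ => ?_
  rw [form_sharp, AH.map_apply]
  have h1 : (μ ∘ₗ (g.symm : (Fin n → F) →ₗ[F] (Fin n → F))) ∘ₗ (g : (Fin n → F) →ₗ[F] (Fin n → F)) = μ :=
    LinearMap.ext fun x => by simp
  rw [h1, ← form_sharp]
  rfl

/-- The Siegel parabolic. -/
abbrev Par (σ : F →+* F) [Fintype F] (n : ℕ) : Type :=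
  (hermGF σ).obj (Fin n → F) ⋊[(hermGF σ).act (Fin n → F)] ((Fin n → F) ≃ₗ[F] (Fin n → F))

variable [Fintype F]

/-- The form underlying an element of the Siegel parabolic. -/
def frm (x : Par σ n) : AH σ (Fin n → F) := Multiplicative.toAdd (α := AH σ (Fin n → F)) x.left

lemma frm_mul (x y : Par σ n) : frm (x * y) = frm x + AH.map (x.right : (Fin n → F) →ₗ[F] (Fin n → F)) (frm y) := rfl

/-- The action on vectors. -/
def actE (hσ : ∀ x, σ (σ x) = x) (x : Par σ n) : Module.End F (Fin n → F × F) where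
  toFun v := mk σ (x.right (px n v) + sharp (frm x) (lam σ v ∘ₗ (x.right.symm : (Fin n → F) →ₗ[F] (Fin n → F))))
    (lam σ v ∘ₗ (x.right.symm : (Fin n → F) →ₗ[F] (Fin n → F)))
  map_add' v w := by
    rw [← mk_add, lam_add, LinearMap.add_comp, sharp_add, map_add, map_add, add_add_add_comm]
  map_smul' c v := by
    apply ext2 hσ
    · rw [map_smul, px_mk, lam_smul, LinearMap.smul_comp, sharp_smul hσ, map_smul, ← smul_add]
      rfl
    · rw [lam_mk hσ, RingHom.id_apply, lam_smul, lam_smul, lam_mk hσ]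
      rfl

lemma px_act (hσ : ∀ x, σ (σ x) = x) (x : Par σ n) (v) : px n (actE hσ x v) =
  x.right (px n v) + sharp (frm x) (lam σ v ∘ₗ (x.right.symm : (Fin n → F) →ₗ[F] (Fin n → F))) := rfl

lemma lam_act (hσ : ∀ x, σ (σ x) = x) (x : Par σ n) (v) : lam σ (actE hσ x v) =
   (lam σ v ∘ₗ (x.right.symm : (Fin n → F) →ₗ[F] (Fin n → F))) := lam_mk hσ _ _

lemma actE_one (hσ : ∀ x, σ (σ x) = x) : actE hσ (1 : Par σ n) = 1 := by
  refine LinearMap.ext fun v => ext2 hσ ?_ ?_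
  · rw [px_act]
    exact add_zero (px n v)
  · rw [lam_act]; rfl

lemma actE_mul (hσ : ∀ x, σ (σ x) = x) (x y : Par σ n) : actE hσ (x * y) = actE hσ x * actE hσ y := by
  refine LinearMap.ext fun v => ext2 hσ ?_ ?_
  · rw [Module.End.mul_apply, px_act, px_act, px_act, frm_mul, lam_act, map_add, sharp_map, sharp_add', add_assoc]
    rw [add_comm (sharp (frm x) _)]
    rfl
  · rw [Module.End.mul_apply, lam_act, lam_act, lam_act]; rfl

/-- The action by automorphisms. -/
def actL (hσ : ∀ x, σ (σ x) = x) (x : Par σ n) : (Fin n → F × F) ≃ₗ[F] (Fin n → F × F) :=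
  LinearEquiv.ofLinear (actE hσ x) (actE hσ x⁻¹) 
    (by rw [← Module.End.mul_eq_comp, ← actE_mul, mul_inv_cancel, actE_one]; rfl)
    (by rw [← Module.End.mul_eq_comp, ← actE_mul, inv_mul_cancel, actE_one]; rfl)

/-- The hyperbolic unitary group. -/
abbrev U (σ : F →+* F) (n : ℕ) : Subgroup ((Fin n → F × F) ≃ₗ[F] (Fin n → F × F)) :=
  bilinIsoms F (pairForm F (hermPair F σ) n)

/-- The embedding of the Siegel parabolic. -/
def emb (hσ : ∀ x, σ (σ x) = x) : Par σ n →* U σ n where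
  toFun x := ⟨actL hσ x, by
    intro v w
    change pairForm F (hermPair F σ) n (actE hσ x v) (actE hσ x w) = _
    rw [omega_eq σ hσ, omega_eq σ hσ, px_act, px_act, lam_act, lam_act, map_add, map_add, map_add,
      form_sharp, form_sharp]
    rw [AH.anti (frm x) (lam σ w ∘ₗ _) (lam σ v ∘ₗ _)]
    simp only [LinearMap.comp_apply, LinearEquiv.coe_coe, LinearEquiv.symm_apply_apply]
    ring⟩
  map_one' := Subtype.ext (LinearEquiv.ext fun v => LinearMap.congr_fun (actE_one hσ) v)
  map_mul' x y := Subtype.ext (LinearEquiv.ext fun v => LinearMap.congr_fun (actE_mul hσ x y) v)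

lemma emb_apply (hσ : ∀ x, σ (σ x) = x) (x : Par σ n) (v) : (emb hσ x).1 v = actE hσ x v := rfl

lemma emb_inj (hσ : ∀ x, σ (σ x) = x) : Function.Injective (emb (n := n) hσ) := by
  rw [injective_iff_map_eq_one]
  intro x hx
  have h : ∀ v, actE hσ x v = v := fun v => by rw [← emb_apply, hx]; rfl
  have hr : x.right = 1 := by
    refine LinearEquiv.ext fun y => ?_
    have := congrArg (px n) (h (mk σ y 0))
    rw [px_act, px_mk, lam_mk hσ, LinearMap.zero_comp, sharp_zero, add_zero] at this
    exact this
  have hl : frm x = 0 := by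
    refine AH.ext' fun κ μ => ?_
    have := congrArg (px n) (h (mk σ 0 μ))
    rw [px_act, px_mk, lam_mk hσ, hr, map_zero, zero_add] at this
    rw [← form_sharp]
    refine (congrArg κ this).trans ?_
    rw [map_zero]; rfl
  exact SemidirectProduct.ext hl hr

/-- The standard Lagrangian. -/
def L0 (σ : F →+* F) (n : ℕ) : Set (Fin n → F × F) := {v | lam σ v = 0}

lemma mem_range (hσ : ∀ x, σ (σ x) = x) (u : U σ n) (hu : ∀ v ∈ L0 σ n, u.1 v ∈ L0 σ n) :
    u ∈ (emb (n := n) hσ).range := by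
  have hu' : ∀ x : Fin n → F, lam σ (u.1 (mk σ x 0)) = 0 := fun x => hu _ (lam_mk hσ x 0)
  let g0 : (Fin n → F) →ₗ[F] (Fin n → F) :=
    { toFun := fun x => px n (u.1 (mk σ x 0))
      map_add' := fun x y => by
        rw [← map_add, ← map_add, ← mk_add, add_zero]
      map_smul' := fun c x => by
        have : mk σ (c • x) 0 = c • mk σ x 0 := by
          apply ext2 hσ
          · rfl
          · rw [lam_smul, lam_mk hσ, lam_mk hσ, smul_zero]
        rw [this, map_smul, map_smul]; rfl }
  have hinj : Function.Injective g0 := by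
    rw [injective_iff_map_eq_zero]
    intro x hx
    have h1 : u.1 (mk σ x 0) = 0 := by
      apply ext2 hσ
      · rw [map_zero]; exact hx
      · rw [hu']
        refine LinearMap.ext fun y => ?_
        simp [lam_apply]
    have h2 : mk σ x 0 = 0 := by simpa using h1
    have := congrArg (px n) h2
    rwa [px_mk, map_zero] at this
  let g : (Fin n → F) ≃ₗ[F] (Fin n → F) := LinearEquiv.ofInjectiveEndo g0 hinj
  have hg : ∀ x, g x = px n (u.1 (mk σ x 0)) := fun x => rfl
  have hlam : ∀ v, lam σ (u.1 v) ∘ₗ (g : (Fin n → F) →ₗ[F] (Fin n → F)) = lam σ v := by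
    intro v
    refine LinearMap.ext fun x => ?_
    have := u.2 v (mk σ x 0)
    rw [omega_eq σ hσ, omega_eq σ hσ, hu', lam_mk hσ] at this
    rw [LinearMap.comp_apply]
    change lam σ (u.1 v) (px n (u.1 (mk σ x 0))) = _
    simpa using this
  have hlam' : ∀ v, lam σ (u.1 v) = lam σ v ∘ₗ (g.symm : (Fin n → F) →ₗ[F] (Fin n → F)) := by
    intro v
    rw [← hlam v]
    exact LinearMap.ext fun x => by simp
  let b : AH σ (Fin n → F) := ⟨fun κ μ => κ (px n (u.1 (mk σ 0 (μ ∘ₗ (g : (Fin n → F) →ₗ[F] (Fin n → F)))))),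
    fun _ _ _ => rfl, fun _ _ _ => rfl, fun κ μ => by
      have h1 : ∀ ν : (Fin n → F) →ₗ[F] F, lam σ (u.1 (mk σ 0 (ν ∘ₗ (g : (Fin n → F) →ₗ[F] (Fin n → F))))) = ν := by
        intro ν
        rw [hlam', lam_mk hσ]
        exact LinearMap.ext fun x => by simp
      have := u.2 (mk σ 0 (μ ∘ₗ (g : (Fin n → F) →ₗ[F] (Fin n → F)))) (mk σ 0 (κ ∘ₗ (g : (Fin n → F) →ₗ[F] (Fin n → F))))
      rw [omega_eq σ hσ, omega_eq σ hσ, h1, h1] at this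
      simp only [px_mk, map_zero, add_zero] at this
      exact eq_neg_of_add_eq_zero_right this⟩
  refine ⟨⟨Multiplicative.ofAdd b, g⟩, ?_⟩
  refine Subtype.ext (LinearEquiv.ext fun v => ?_)
  rw [emb_apply]
  apply ext2 hσ
  · rw [px_act]
    change g (px n v) + sharp b (lam σ v ∘ₗ (g.symm : (Fin n → F) →ₗ[F] (Fin n → F))) = _
    have h2 : v = mk σ (px n v) 0 + mk σ 0 (lam σ v) := by
      rw [← mk_add, add_zero, zero_add, mk_eta hσ]
    have h3 : sharp b (lam σ v ∘ₗ (g.symm : (Fin n → F) →ₗ[F] (Fin n → F))) = px n (u.1 (mk σ 0 (lam σ v))) := by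
      have : (lam σ v ∘ₗ (g.symm : (Fin n → F) →ₗ[F] (Fin n → F))) ∘ₗ (g : (Fin n → F) →ₗ[F] (Fin n → F)) = lam σ v :=
        LinearMap.ext fun x => by simp
      conv_rhs => rw [← this]
      rfl
    rw [h3, hg, ← map_add, ← map_add, ← h2]
  · rw [lam_act, hlam']

end Siegel
end GH

namespace GH

namespace Siegel
variable {F : Type} [Field F] {σ : F →+* F} {n : ℕ}

/-- A form of rank at most two. -/
def bform (hσ : ∀ x, σ (σ x) = x) (t : F) (a b : Fin n → F) : AH σ (Fin n → F) :=
  ⟨fun κ μ => t * κ a * σ (μ b) - σ t * κ b * σ (μ a), fun κ κ' μ => by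
      simp only [LinearMap.add_apply]; ring, fun c κ μ => by
      simp only [LinearMap.smul_apply, smul_eq_mul]; ring, fun κ μ => by
      simp only [map_sub, map_mul, hσ]; ring⟩

lemma sharp_bform (hσ : ∀ x, σ (σ x) = x) (t : F) (a b : Fin n → F) (μ) :
    sharp (bform hσ t a b) μ = (t * σ (μ b)) • a - (σ t * σ (μ a)) • b := by
  funext i
  change t * a i * σ (μ b) - σ t * b i * σ (μ a) = t * σ (μ b) * a i - σ t * σ (μ a) * b i
  ring

lemma mk_zero_eq (hσ : ∀ x, σ (σ x) = x) (c : F) (x : Fin n → F) : mk σ (c • x) 0 = c • mk σ x 0 := by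
  apply ext2 hσ
  · rfl
  · rw [lam_smul, lam_mk hσ, lam_mk hσ, smul_zero]

variable [Fintype F]

/-- The unipotent radical. -/
def uni (b : AH σ (Fin n → F)) : Par σ n := ⟨Multiplicative.ofAdd b, 1⟩

lemma act_uni (hσ : ∀ x, σ (σ x) = x) (b : AH σ (Fin n → F)) (v) :
    actE hσ (uni b) v = v + mk σ (sharp b (lam σ v)) 0 := by
  apply ext2 hσ
  · rw [px_act, map_add]; rfl
  · rw [lam_act, lam_add, lam_mk hσ, add_zero]; rfl

lemma L0_le (hσ : ∀ x, σ (σ x) = x) (t : F) (ht : σ t ≠ t) (Λ : Submodule F (Fin n → F × F))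
    (hΛ : ∀ b, ∀ v ∈ Λ, actE hσ (uni b) v ∈ Λ) (v) (hv : v ∈ Λ) (hv0 : lam σ v ≠ 0) (w) (hw : w ∈ L0 σ n) :
    w ∈ Λ := by
  have h1 : ∀ b : AH σ (Fin n → F), mk σ (sharp b (lam σ v)) 0 ∈ Λ := fun b => by
    have := Λ.sub_mem (hΛ b v hv) hv
    rwa [act_uni, add_sub_cancel_left] at this
  obtain ⟨y, hy⟩ : ∃ y, lam σ v y ≠ 0 := by
    by_contra! h
    exact hv0 (LinearMap.ext h)
  let b := (lam σ v y)⁻¹ • y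
  have hb : lam σ v b = 1 := by
    change lam σ v ((lam σ v y)⁻¹ • y) = 1
    rw [map_smul, smul_eq_mul, inv_mul_cancel₀ hy]
  have hbΛ : mk σ b 0 ∈ Λ := by
    have := h1 (bform hσ t b b)
    rw [sharp_bform, hb, map_one, mul_one, mul_one, ← sub_smul, mk_zero_eq hσ] at this
    have h2 := Λ.smul_mem (t - σ t)⁻¹ this
    rwa [smul_smul, inv_mul_cancel₀ (sub_ne_zero.2 ht.symm), one_smul] at h2
  let x := px n w
  let a := x - lam σ v x • b
  have ha : lam σ v a = 0 := by
    change lam σ v (x - lam σ v x • b) = 0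
    rw [map_sub, map_smul, hb, smul_eq_mul, mul_one, sub_self]
  have haΛ : mk σ a 0 ∈ Λ := by
    have := h1 (bform hσ 1 a b)
    rwa [sharp_bform, hb, ha, map_one, map_zero, mul_one, mul_zero, zero_smul, one_smul, sub_zero] at this
  have : w = mk σ a 0 + lam σ v x • mk σ b 0 := by
    rw [← mk_zero_eq hσ, ← mk_add, add_zero]
    change w = mk σ (x - lam σ v x • b + lam σ v x • b) 0
    rw [sub_add_cancel]
    have h0 : lam σ w = 0 := hw
    rw [← h0, mk_eta hσ]
  rw [this]
  exact Λ.add_mem haΛ (Λ.smul_mem _ hbΛ)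

/-- The standard Lagrangian. -/
def L0s (σ : F →+* F) (n : ℕ) : Submodule F (Fin n → F × F) where
  carrier := L0 σ n
  zero_mem' := by
    change lam σ 0 = 0
    refine LinearMap.ext fun x => ?_
    simp [lam_apply]
  add_mem' := by
    intro v w hv hw
    change lam σ (v + w) = 0
    rw [lam_add, show lam σ v = 0 from hv, show lam σ w = 0 from hw, add_zero]
  smul_mem' := by
    intro c v hv
    change lam σ (c • v) = 0
    rw [lam_smul, show lam σ v = 0 from hv, smul_zero]

open Pointwise

/-- Inclusion of the unipotent radical. -/
def uniHom (hσ : ∀ x, σ (σ x) = x) : Multiplicative (AH σ (Fin n → F)) →* U σ n :=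
  (emb hσ).comp (SemidirectProduct.inl : _ →* Par σ n)

lemma uniHom_apply (hσ : ∀ x, σ (σ x) = x) (b : AH σ (Fin n → F)) (v) :
    (uniHom hσ (Multiplicative.ofAdd b)).1 v = actE hσ (uni b) v := rfl

lemma smul_set (u : U σ n) (S : Set (Fin n → F × F)) : u • S = u.1 '' S := rfl

lemma AH_pgroup (p : ℕ) [Fact p.Prime] [CharP F p] : IsPGroup p (Multiplicative (AH σ (Fin n → F))) := by
  intro g
  refine ⟨1, ?_⟩
  rw [pow_one]
  change p • (Multiplicative.toAdd g) = 0
  refine AH.ext' fun κ μ => ?_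
  change p • ((Multiplicative.toAdd g).1 κ μ) = 0
  rw [nsmul_eq_mul, CharP.cast_eq_zero, zero_mul]

lemma index_mod (p : ℕ) [Fact p.Prime] [CharP F p] (hσ : ∀ x, σ (σ x) = x) (t : F) (ht : σ t ≠ t) :
    (MulAction.stabilizer (U σ n) (L0 σ n)).index ≡ 1 [MOD p] := by
  classical
  rw [MulAction.index_stabilizer]
  let A : MulAction (Multiplicative (AH σ (Fin n → F))) (MulAction.orbit (U σ n) (L0 σ n)) :=
    MulAction.compHom _ (uniHom hσ)
  have h1 := (AH_pgroup (σ := σ) (n := n) p).card_modEq_card_fixedPoints (MulAction.orbit (U σ n) (L0 σ n))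
  have hcard : ∀ u : U σ n, (u.1 '' L0 σ n).ncard = (L0 σ n).ncard := fun u =>
    Set.ncard_image_of_injective _ u.1.injective
  have h2 : MulAction.fixedPoints (Multiplicative (AH σ (Fin n → F))) (MulAction.orbit (U σ n) (L0 σ n)) =
      {⟨L0 σ n, MulAction.mem_orbit_self _⟩} := by
    ext ⟨S, hS⟩
    rw [Set.mem_singleton_iff, MulAction.mem_fixedPoints]
    constructor
    · intro h
      obtain ⟨u, rfl⟩ := hS
      refine Subtype.ext ?_
      change u.1 '' L0 σ n = L0 σ n
      have hst : ∀ b, ∀ v ∈ u.1 '' L0 σ n, actE hσ (uni b) v ∈ u.1 '' L0 σ n := by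
        intro b v hv
        have h3 := congrArg Subtype.val (h (Multiplicative.ofAdd b))
        change (uniHom hσ (Multiplicative.ofAdd b)).1 '' (u.1 '' L0 σ n) = u.1 '' L0 σ n at h3
        rw [← h3]
        exact ⟨v, hv, rfl⟩
      by_cases hv : ∃ v ∈ u.1 '' L0 σ n, lam σ v ≠ 0
      · obtain ⟨v, hv, hv0⟩ := hv
        symm
        refine Set.eq_of_subset_of_ncard_le (fun w hw => ?_) (hcard u).le
        have := L0_le hσ t ht ((L0s σ n).map (u.1 : (Fin n → F × F) →ₗ[F] (Fin n → F × F))) hst v hv hv0 w hw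
        exact this
      · push Not at hv
        exact Set.eq_of_subset_of_ncard_le (fun w hw => hv w hw) (hcard u).ge
    · intro h b
      have h' : S = L0 σ n := congrArg Subtype.val h
      subst h'
      refine Subtype.ext ?_
      change (uniHom hσ b).1 '' (L0 σ n) = L0 σ n
      refine Set.eq_of_subset_of_ncard_le ?_ (hcard _).ge
      rintro _ ⟨w, hw, rfl⟩
      have hw' : lam σ w = 0 := hw
      change lam σ (actE hσ (uni (Multiplicative.toAdd b)) w) = 0
      rw [lam_act, hw', LinearMap.zero_comp]
  rw [h2] at h1
  refine h1.trans ?_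
  have h3 := Set.ncard_singleton (⟨L0 σ n, MulAction.mem_orbit_self _⟩ : MulAction.orbit (U σ n) (L0 σ n))
  change Nat.card _ = 1 at h3
  rw [h3]

lemma stab_le (hσ : ∀ x, σ (σ x) = x) :
    MulAction.stabilizer (U σ n) (L0 σ n) ≤ (emb (n := n) hσ).range := by
  intro u hu
  refine mem_range hσ u fun v hv => ?_
  have : u • L0 σ n = L0 σ n := hu
  rw [← this]
  exact ⟨v, hv, rfl⟩

end Siegel
end GH

namespace GH

namespace Siegel
variable {p : ℕ} [Fact p.Prime] {F : Type} [Field F] [Fintype F] [CharP F p]  {σ : F →+* F} {n : ℕ}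

lemma par_van (hF : p ^ 2 ≤ Fintype.card F) (d : ℕ) (hd0 : 0 < d) (hdn : d < n) :
    Subsingleton (H ((hermGM p σ).rep (Fin n → F)) d) := by
  have hfr : Module.finrank F (Fin n → F) = n := by simp
  have hinj := (hermGM p σ).edge_inj (Fin n → F) d (fun i j hij hj => by
    obtain ⟨j, rfl⟩ : ∃ j', j = j' + 1 := ⟨j - 1, by omega⟩
    refine van_all hF i (2 * (j + 1) + 1) _ (hermRed σ j) (hermCE σ (j + 1)) (by omega) _ ?_
    rw [hfr]; omega)
  have : Finite (((hermGM p σ).Hj 0).obj (Fin n → F)) := ((hermGM p σ).Hj 0).fin _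
  have h0 : Subsingleton (H (((hermGM p σ).Hj 0).gl (Fin n → F)) d) := by
    refine H_triv _ (fun g m => ?_) d (const_all hF d hd0 _ (by rw [hfr]; exact hdn) (ZMod p))
    obtain ⟨m, rfl⟩ := (hermGM p σ).mk0_surj _ m
    exact (hermGM p σ).map_mk0 _ m
  exact hinj.subsingleton

open Pointwise

/-- Comparison of homology of the Siegel parabolic and of the unitary group. -/
def embP (p : ℕ) [Fact p.Prime] (hσ : ∀ x, σ (σ x) = x) : PHom ((hermGM p σ).rep (Fin n → F)) (triv (ZMod p) (U σ n) (ZMod p)) where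
  φ := emb hσ
  f := (LinearMap.id : ZMod p →ₗ[ZMod p] ZMod p)
  comm _ _ := rfl

lemma U_van (hF : p ^ 2 ≤ Fintype.card F) (hσ : ∀ x, σ (σ x) = x) (t : F) (ht : σ t ≠ t)
    (d : ℕ) (hd0 : 0 < d) (hdn : d < n) :
    Subsingleton (H (triv (ZMod p) (U σ n) (ZMod p)) d) := by
  have := par_van (σ := σ) hF d hd0 hdn
  have hs : Function.Surjective ((embP (n := n) p hσ).map d) := by
    refine phom_surj_of_le (embP p hσ) (emb_inj hσ) Function.bijective_id
      (MulAction.stabilizer (U σ n) (L0 σ n)) (stab_le hσ) ?_ d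
    have h1 := index_mod (n := n) p hσ t ht
    rw [(ZMod.natCast_eq_natCast_iff _ _ _).2 h1]
    simp
  exact hs.subsingleton

end Siegel

open GroupHomologyBar in
lemma frozen_d0 {G A : Type} [Group G] [AddCommGroup A] (m : ℕ) (D : ((Fin (m + 1) → G) →₀ A) →+ ((Fin m → G) →₀ A))
    (h : ∀ g a, D (Finsupp.single g a) = d G A m (Finsupp.single g a)) (x) : D x = d G A m x := by
  induction x using Finsupp.induction_linear with
  | zero => rw [map_zero, map_zero]
  | add x y hx hy => rw [map_add, map_add, hx, hy]
  | single g a => exact h g a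

/-- Mathlib's differential. -/
noncomputable def mathD (G : Type) [Group G] (ℓ : ℕ) (m : ℕ) :
    ((Fin (m + 1) → G) →₀ ZMod ℓ) →ₗ[ZMod ℓ] ((Fin m → G) →₀ ZMod ℓ) :=
  (groupHomology.inhomogeneousChains.d (Rep.of (triv (ZMod ℓ) G (ZMod ℓ))) m).hom

lemma mathD_single {G : Type} [Group G] {ℓ : ℕ} (m : ℕ) (g : Fin (m + 1) → G) (a : ZMod ℓ) :
    mathD G ℓ m (Finsupp.single g a) = Finsupp.single (fun i => g i.succ) a +
      Finset.univ.sum fun j : Fin (m + 1) =>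
        (-1 : ZMod ℓ) ^ ((j : ℕ) + 1) • Finsupp.single (Fin.contractNth j (· * ·) g) a :=
  groupHomology.inhomogeneousChains.d_single (A := Rep.of (triv (ZMod ℓ) G (ZMod ℓ))) m g a

open GroupHomologyBar in
lemma frozen_d {G : Type} [Group G] {ℓ : ℕ} (m : ℕ) (x : (Fin (m + 1) → G) →₀ ZMod ℓ) :
    mathD G ℓ m x = d G (ZMod ℓ) m x := by
  refine frozen_d0 m (mathD G ℓ m).toAddMonoidHom (fun g a => ?_) x
  rw [d_single]
  refine (mathD_single m g a).trans ?_
  refine congrArg₂ (· + ·) rfl ?_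
  refine Finset.sum_congr rfl fun j _ => ?_
  rw [Finsupp.smul_single, Finsupp.smul_single, zsmul_eq_mul, smul_eq_mul]
  push_cast
  rfl

open GroupHomologyBar in
lemma frozen_sub {G : Type} [Group G] {ℓ : ℕ} (m : ℕ) (h : Subsingleton (H (triv (ZMod ℓ) G (ZMod ℓ)) (m + 1))) :
    Subsingleton (Homology G (ZMod ℓ) (m + 1)) := by
  rw [H_subsingleton_iff] at h
  refine Submodule.Quotient.subsingleton_iff.2 (eq_top_iff.2 fun x _ => ?_)
  obtain ⟨y, hy⟩ := h x.1 ((frozen_d m x.1).trans x.2)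
  exact ⟨y, (frozen_d (m + 1) y).symm.trans hy⟩

end GH

open GroupHomologyBar in
/-- Vanishing of the homology of the hyperbolic unitary groups over the finite field
`𝔽_{ℓ^{2r}}` with the involution `σ(x) = x^{ℓ^r}`, at the characteristic:
`H_d(U_{n,n}(𝔽_{ℓ^{2r}}); 𝔽_ℓ) = 0` for `0 < d < n`.  Here `U_{n,n}(F,σ)` is realized as
the group of linear automorphisms of `F^{2n} = (F²)ⁿ` preserving the form
`ω(v, w) = ∑ᵢ (σ(vᵢ) w_{n+i} + σ(v_{n+i}) wᵢ)`, where the `i`-th copy of `F²` carries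
the pair of coordinates `(vᵢ, v_{n+i})`. -/
theorem U_homology_vanishing (ℓ r : ℕ) (hℓ : ℓ.Prime) (hr : 1 ≤ r)
    (F : Type) [Field F] [Fintype F] (hcard : Fintype.card F = ℓ ^ (2 * r))
    (n d : ℕ) (hd0 : 0 < d) (hdn : d < n) :
    Subsingleton
      (Homology (↥(bilinIsoms F (pairForm F (hermPair F (fun x : F => x ^ ℓ ^ r)) n)))
        (ZMod ℓ) d) := by
  obtain ⟨m, rfl⟩ : ∃ m, d = m + 1 := ⟨d - 1, by omega⟩
  have : Fact ℓ.Prime := ⟨hℓ⟩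
  have : CharP F ℓ := by
    obtain ⟨q, hq⟩ := CharP.exists F
    obtain ⟨k, hp, hk⟩ := FiniteField.card F q
    have h1 : q = ℓ := by
      have : q ∣ ℓ ^ (2 * r) := by rw [← hcard, hk]; exact dvd_pow_self _ k.ne_zero
      exact (Nat.prime_dvd_prime_iff_eq hp hℓ).1 (hp.dvd_of_dvd_pow this)
    exact h1 ▸ hq
  have : ExpChar F ℓ := ExpChar.prime hℓ
  let σ : F →+* F := iterateFrobenius F ℓ r
  have hs : ∀ x, σ x = x ^ ℓ ^ r := fun x => rfl
  have hσ : ∀ x, σ (σ x) = x := fun x => by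
    rw [hs, hs, ← pow_mul, ← pow_add, ← two_mul, ← hcard, FiniteField.pow_card]
  have hlt : 1 < ℓ ^ r := Nat.one_lt_pow (by omega) hℓ.one_lt
  obtain ⟨t, ht⟩ : ∃ t, σ t ≠ t := by
    by_contra! h
    have h1 := FiniteField.X_pow_card_sub_X_ne_zero F hlt
    have h2 := Polynomial.card_roots' (Polynomial.X ^ ℓ ^ r - Polynomial.X : Polynomial F)
    rw [FiniteField.X_pow_card_sub_X_natDegree_eq F hlt] at h2
    have h3 : (Finset.univ : Finset F).val ≤ (Polynomial.X ^ ℓ ^ r - Polynomial.X : Polynomial F).roots := by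
      rw [Multiset.le_iff_subset Finset.univ.nodup]
      intro x _
      rw [Polynomial.mem_roots h1]
      simp [Polynomial.IsRoot, ← hs, h]
    have h4 := Multiset.card_le_card h3
    have h5 : Multiset.card (Finset.univ : Finset F).val = ℓ ^ (2 * r) := hcard
    rw [h5, two_mul, pow_add] at h4
    nlinarith
  have hF : ℓ ^ 2 ≤ Fintype.card F := by
    rw [hcard]
    exact Nat.pow_le_pow_right hℓ.pos (by omega)
  exact GH.frozen_sub m (GH.Siegel.U_van (σ := σ) hF hσ t ht (m + 1) hd0 hdn)
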